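/- arXiv:2603.03086 — 9 statements merged into one kernel-verified Lean document; each statement's English description precedes it below -/
import Mathlib

section
/- Let a₁, a₂ be positive integers and b₁, b₂ be integers with −a₁ ≤ b₁ ≤ 0 and −a₂ ≤ b₂ ≤ 0. Then every (a₁+a₂, b₁+b₂)-sparse finite simple graph G admits an edge-partition E(G) = E(G₁) ∪ E(G₂) such that G₁ is (a₁,b₁)-sparse and G₂ is (a₂,b₂)-sparse. -/
/-- A finite simple graph `G` is `(a,b)`-sparse if every subgraph `H` of `G`
containing at least one edge satisfies `e(H) ≤ a * v(H) + b`. -/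
def IsSparse {V : Type*} [Fintype V] (G : SimpleGraph V) (a b : ℝ) : Prop :=
  ∀ H : G.Subgraph, H.edgeSet.Nonempty →
    (H.edgeSet.ncard : ℝ) ≤ a * H.verts.ncard + b

/-- `G` admits an edge-partition `E(G) = E(G₁) ∪ E(G₂)` (disjointly) with `G₁`
being `(a₁,b₁)`-sparse and `G₂` being `(a₂,b₂)`-sparse. -/
def HasSparsePartition {V : Type*} [Fintype V] (G : SimpleGraph V)
    (a₁ b₁ a₂ b₂ : ℝ) : Prop :=
  ∃ G₁ G₂ : SimpleGraph V, G₁ ≤ G ∧ G₂ ≤ G ∧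
    G₁.edgeSet ∪ G₂.edgeSet = G.edgeSet ∧ Disjoint G₁.edgeSet G₂.edgeSet ∧
    IsSparse G₁ a₁ b₁ ∧ IsSparse G₂ a₂ b₂

open Finset

/-- The count condition on vertex sets: each nonempty vertex set `X` spans at most
`a * #X + b` edges of `F`. -/
def SparseCount {V : Type*} [DecidableEq V] (F : Finset (Sym2 V)) (a b : ℤ) : Prop :=
  ∀ X : Finset V, X.Nonempty → (#(F ∩ X.sym2) : ℤ) ≤ a * #X + b

/-- The vertex set `X` spans exactly `a * #X + b` edges of `F`. -/
def IsTightSet {V : Type*} [DecidableEq V] (F : Finset (Sym2 V)) (a b : ℤ) (X : Finset V) : Prop :=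
  (#(F ∩ X.sym2) : ℤ) = a * #X + b

/-- Iterated closure: starting from `E`, repeatedly keep the edges which, for every `i`, lie in a
tight set of `F i` all of whose `F i`-edges are still present. -/
def tightLevel {V ι : Type*} [DecidableEq V] (E : Finset (Sym2 V)) (a b : ι → ℤ)
    (F : ι → Finset (Sym2 V)) : ℕ → Set (Sym2 V)
  | 0 => E
  | k + 1 => {h | h ∈ tightLevel E a b F k ∧ ∀ i, ∃ X : Finset V, h ∈ X.sym2 ∧
      IsTightSet (F i) (a i) (b i) X ∧ ↑(F i ∩ X.sym2) ⊆ tightLevel E a b F k}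

lemma Finset.nonempty_of_mem_sym2 {V : Type*} {X : Finset V} {e : Sym2 V} (h : e ∈ X.sym2) :
    X.Nonempty := by
  induction e with
  | _ x y => exact ⟨x, (mk_mem_sym2_iff.1 h).1⟩

section
variable {V : Type*} [DecidableEq V]

lemma Finset.sym2_inter (X Y : Finset V) : (X ∩ Y).sym2 = X.sym2 ∩ Y.sym2 := by
  ext e
  simp only [mem_sym2_iff, mem_inter]
  exact ⟨fun h => ⟨fun a ha => (h a ha).1, fun a ha => (h a ha).2⟩,
    fun h a ha => ⟨h.1 a ha, h.2 a ha⟩⟩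

lemma SparseCount.mono {F F' : Finset (Sym2 V)} {a b : ℤ} (h : SparseCount F a b) (hF : F' ⊆ F) :
    SparseCount F' a b := fun X hX =>
  le_trans (by exact_mod_cast card_le_card (inter_subset_inter_right hF)) (h X hX)

lemma card_inter_sym2_add (F : Finset (Sym2 V)) (X Y : Finset V) :
    #(F ∩ X.sym2 ∪ F ∩ Y.sym2) + #(F ∩ (X ∩ Y).sym2) = #(F ∩ X.sym2) + #(F ∩ Y.sym2) := by
  rw [sym2_inter, inter_inter_distrib_left, card_union_add_card_inter]

lemma union_inter_sym2_subset (F : Finset (Sym2 V)) (X Y : Finset V) :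
    F ∩ X.sym2 ∪ F ∩ Y.sym2 ⊆ F ∩ (X ∪ Y).sym2 :=
  union_subset (inter_subset_inter_left (sym2_mono subset_union_left))
    (inter_subset_inter_left (sym2_mono subset_union_right))

/-- Uncrossing: a tight set and a set with deficiency at most `d` whose intersection has
deficiency at least `d` have a tight union, and the union spans no further edges. -/
lemma SparseCount.uncross {F : Finset (Sym2 V)} {a b : ℤ} (hF : SparseCount F a b)
    {X Y : Finset V} (d : ℤ) (hne : (X ∩ Y).Nonempty) (hX : IsTightSet F a b X)
    (hY : a * #Y + b - d ≤ #(F ∩ Y.sym2)) (hXY : (#(F ∩ (X ∩ Y).sym2) : ℤ) ≤ a * #(X ∩ Y) + b - d) :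
    IsTightSet F a b (X ∪ Y) ∧ F ∩ (X ∪ Y).sym2 = F ∩ X.sym2 ∪ F ∩ Y.sym2 := by
  have h1 : (#(F ∩ X.sym2 ∪ F ∩ Y.sym2) : ℤ) + #(F ∩ (X ∩ Y).sym2)
      = #(F ∩ X.sym2) + #(F ∩ Y.sym2) := by exact_mod_cast card_inter_sym2_add F X Y
  have hs := union_inter_sym2_subset F X Y
  have h2 : (#(F ∩ X.sym2 ∪ F ∩ Y.sym2) : ℤ) ≤ #(F ∩ (X ∪ Y).sym2) := by
    exact_mod_cast card_le_card hs
  have h3 := hF (X ∪ Y) (hne.mono (inter_subset_union))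
  have h4 : (#(X ∪ Y) : ℤ) + #(X ∩ Y) = #X + #Y := by exact_mod_cast card_union_add_card_inter X Y
  have h5 : a * #(X ∪ Y) + a * #(X ∩ Y) = a * #X + a * #Y := by rw [← mul_add, h4, mul_add]
  unfold IsTightSet at *
  refine ⟨by linarith, (eq_of_subset_of_card_le hs ?_).symm⟩
  have : (#(F ∩ (X ∪ Y).sym2) : ℤ) ≤ #(F ∩ X.sym2 ∪ F ∩ Y.sym2) := by linarith
  exact_mod_cast this

lemma SparseCount.isTightSet_inter {F : Finset (Sym2 V)} {a b : ℤ} (hF : SparseCount F a b)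
    {X Y : Finset V} (hne : (X ∩ Y).Nonempty) (hX : IsTightSet F a b X)
    (hY : IsTightSet F a b Y) : IsTightSet F a b (X ∩ Y) := by
  refine le_antisymm (hF _ hne) (not_lt.1 fun hlt => ?_)
  have h := (hF.uncross 0 hne hX (by unfold IsTightSet at hY; linarith) (by linarith)).1
  have h1 : (#(F ∩ X.sym2 ∪ F ∩ Y.sym2) : ℤ) + #(F ∩ (X ∩ Y).sym2)
      = #(F ∩ X.sym2) + #(F ∩ Y.sym2) := by exact_mod_cast card_inter_sym2_add F X Y
  have h2 : (#(F ∩ X.sym2 ∪ F ∩ Y.sym2) : ℤ) ≤ #(F ∩ (X ∪ Y).sym2) := by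
    exact_mod_cast card_le_card (union_inter_sym2_subset F X Y)
  have h4 : (#(X ∪ Y) : ℤ) + #(X ∩ Y) = #X + #Y := by exact_mod_cast card_union_add_card_inter X Y
  have h5 : a * #(X ∪ Y) + a * #(X ∩ Y) = a * #X + a * #Y := by rw [← mul_add, h4, mul_add]
  unfold IsTightSet at *
  linarith

/-- A tight set remains tight when cut down to a set that no spanned edge leaves. -/
lemma SparseCount.isTightSet_inter_of_closed {F : Finset (Sym2 V)} {a b : ℤ}
    (hF : SparseCount F a b) (hb : b ≤ 0) {X U : Finset V} (hne : (X ∩ U).Nonempty)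
    (hX : IsTightSet F a b X) (hU : ∀ h ∈ F ∩ X.sym2, ∀ x ∈ h, x ∈ U → h ∈ U.sym2) :
    IsTightSet F a b (X ∩ U) := by
  rcases (X \ U).eq_empty_or_nonempty with h0 | h0
  · rwa [inter_eq_left.2 (sdiff_eq_empty_iff_subset.1 h0)]
  refine le_antisymm (hF _ hne) ?_
  have h1 := hF _ h0
  have h2 : (#(X ∩ U) : ℤ) + #(X \ U) = #X := by exact_mod_cast card_inter_add_card_sdiff X U
  have h5 : a * #(X ∩ U) + a * #(X \ U) = a * #X := by rw [← mul_add, h2]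
  have h3 : F ∩ X.sym2 ⊆ F ∩ (X ∩ U).sym2 ∪ F ∩ (X \ U).sym2 := by
    intro h hh
    have hX' := mem_sym2_iff.1 (mem_inter.1 hh).2
    simp only [mem_union, mem_inter, mem_sym2_iff, mem_sdiff]
    by_cases hx : ∃ x ∈ h, x ∈ U
    · obtain ⟨x, hx, hxU⟩ := hx
      have := mem_sym2_iff.1 (hU h hh x hx hxU)
      exact Or.inl ⟨(mem_inter.1 hh).1, fun y hy => ⟨hX' y hy, this y hy⟩⟩
    · push Not at hx
      exact Or.inr ⟨(mem_inter.1 hh).1, fun y hy => ⟨hX' y hy, hx y hy⟩⟩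
  have h4 : (#(F ∩ X.sym2) : ℤ) ≤ #(F ∩ (X ∩ U).sym2) + #(F ∩ (X \ U).sym2) := by
    exact_mod_cast (card_le_card h3).trans (card_union_le _ _)
  unfold IsTightSet at hX
  linarith

/-- If each edge of `L` lies in a tight set of `F i` whose `F i`-edges are in `L`, then each edge
of `L` lies in a set which is tight for all `F i` simultaneously. -/
lemma exists_isTightSet_forall [Fintype V] {ι : Type*} {a b : ι → ℤ} (hb : ∀ i, b i ≤ 0)
    {F : ι → Finset (Sym2 V)} (hF : ∀ i, SparseCount (F i) (a i) (b i)) {L : Set (Sym2 V)}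
    (hL : ∀ h ∈ L, ∀ i, ∃ X : Finset V, h ∈ X.sym2 ∧ IsTightSet (F i) (a i) (b i) X ∧
      ↑(F i ∩ X.sym2) ⊆ L) {e : Sym2 V} (he : e ∈ L) :
    ∃ U : Finset V, e ∈ U.sym2 ∧ ∀ i, IsTightSet (F i) (a i) (b i) U := by
  classical
  obtain ⟨u, hu⟩ : ∃ u, u ∈ e := by
    induction e with
    | _ x y => exact ⟨x, Sym2.mem_mk_left x y⟩
  set U : Finset V := {v | Relation.ReflTransGen (fun x y => s(x, y) ∈ L) u v} with hUdef
  have huU : u ∈ U := by simp [U, Relation.ReflTransGen.refl]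
  have hU : ∀ h ∈ L, ∀ x ∈ h, x ∈ U → h ∈ U.sym2 := by
    intro h hh x hx hxU
    obtain ⟨y, rfl⟩ := Sym2.mem_iff_exists.1 hx
    refine mk_mem_sym2_iff.2 ⟨hxU, ?_⟩
    simp only [U, mem_filter, mem_univ, true_and] at hxU ⊢
    exact hxU.tail hh
  refine ⟨U, hU e he u hu huU, fun i => ?_⟩
  have key : ∀ h ∈ L, ∀ x ∈ h, x ∈ U → ∃ X : Finset V, h ∈ X.sym2 ∧
      IsTightSet (F i) (a i) (b i) X ∧ ↑(F i ∩ X.sym2) ⊆ L ∧ X ⊆ U := by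
    intro h hh x hx hxU
    obtain ⟨X, hX, hXt, hXL⟩ := hL h hh i
    have hhU := hU h hh x hx hxU
    have hm : h ∈ (X ∩ U).sym2 := by rw [sym2_inter]; exact mem_inter.2 ⟨hX, hhU⟩
    refine ⟨X ∩ U, hm, (hF i).isTightSet_inter_of_closed (hb i) (nonempty_of_mem_sym2 hm) hXt
      fun g hg => hU g (hXL hg), fun g hg => hXL ?_, inter_subset_right⟩
    exact inter_subset_inter_left (sym2_mono inter_subset_left) hg
  let T : Finset (Finset V) := {X | u ∈ X ∧ IsTightSet (F i) (a i) (b i) X ∧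
    ↑(F i ∩ X.sym2) ⊆ L ∧ X ⊆ U}
  have hT : T.Nonempty := by
    obtain ⟨X, hX, h⟩ := key e he u hu huU
    exact ⟨X, by simpa [T] using ⟨mem_sym2_iff.1 hX u hu, by simpa using h⟩⟩
  obtain ⟨W, hWT, hmax⟩ := T.exists_max_image card hT
  have hW := (mem_filter.1 hWT).2
  obtain ⟨huW, hWt, hWL, hWU⟩ := hW
  suffices U ⊆ W by rwa [subset_antisymm this hWU]
  intro v hv
  simp only [U, mem_filter, mem_univ, true_and] at hv
  induction hv with
  | refl => exact huW
  | @tail x y _ hxy ih =>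
    obtain ⟨X, hX, hXt, hXL, hXU⟩ := key _ hxy x (Sym2.mem_mk_left x y) (hWU ih)
    obtain ⟨hxX, hyX⟩ := mk_mem_sym2_iff.1 hX
    have hne : (W ∩ X).Nonempty := ⟨x, mem_inter.2 ⟨ih, hxX⟩⟩
    obtain ⟨h1, h2⟩ := (hF i).uncross 0 hne hWt (by unfold IsTightSet at hXt; linarith)
      (by linarith [hF i _ hne])
    have hm : W ∪ X ∈ T := by
      refine mem_filter.2 ⟨mem_univ _, mem_union_left _ huW, h1, ?_, union_subset hWU hXU⟩
      rw [h2, coe_union]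
      exact Set.union_subset hWL hXL
    rw [eq_of_subset_of_card_le subset_union_left (hmax _ hm)]
    exact mem_union_right _ hyX

lemma tightLevel_succ_subset {ι : Type*} (E : Finset (Sym2 V)) (a b : ι → ℤ)
    (F : ι → Finset (Sym2 V)) (k : ℕ) : tightLevel E a b F (k + 1) ⊆ tightLevel E a b F k :=
  fun _ h => h.1

lemma exists_tightLevel_succ_eq {ι : Type*} (E : Finset (Sym2 V)) (a b : ι → ℤ)
    (F : ι → Finset (Sym2 V)) : ∃ k, tightLevel E a b F (k + 1) = tightLevel E a b F k := by
  have hanti : Antitone (tightLevel E a b F) :=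
    antitone_nat_of_succ_le (tightLevel_succ_subset E a b F)
  have hfin : ∀ k, (tightLevel E a b F k).Finite := fun k =>
    E.finite_toSet.subset (hanti (Nat.zero_le k))
  by_contra! hne
  have : StrictAnti fun k => (tightLevel E a b F k).ncard := strictAnti_nat_of_succ_lt fun k =>
    Set.ncard_lt_ncard ((tightLevel_succ_subset E a b F k).ssubset_of_ne (hne k)) (hfin k)
  exact not_strictAnti_of_wellFoundedLT _ this

lemma SparseCount.insert_of_not_isTightSet {F : Finset (Sym2 V)} {a b : ℤ} (hF : SparseCount F a b) {e : Sym2 V}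
    (he : ∀ X : Finset V, e ∈ X.sym2 → ¬ IsTightSet F a b X) : SparseCount (insert e F) a b := by
  intro X hX
  have h := hF X hX
  by_cases hm : e ∈ X.sym2
  · have h1 := lt_of_le_of_ne h (he X hm)
    rw [insert_inter_of_mem hm]
    have : (#(insert e (F ∩ X.sym2)) : ℤ) ≤ #(F ∩ X.sym2) + 1 := by
      exact_mod_cast card_insert_le _ _
    linarith
  · rwa [insert_inter_of_notMem hm]

lemma card_swap_inter {F : Finset (Sym2 V)} {e g : Sym2 V} (he : e ∉ F) (hg : g ∈ F)
    (X : Finset V) : #(insert e (F.erase g) ∩ X.sym2) + (if g ∈ X.sym2 then 1 else 0) =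
      #(F ∩ X.sym2) + (if e ∈ X.sym2 then 1 else 0) := by
  have h1 : #(F.erase g ∩ X.sym2) + (if g ∈ X.sym2 then 1 else 0) = #(F ∩ X.sym2) := by
    rw [erase_inter]
    split_ifs with h
    · exact card_erase_add_one (mem_inter.2 ⟨hg, h⟩)
    · rw [erase_eq_of_notMem (fun h' => h (mem_inter.1 h').2), add_zero]
  have h2 : #(insert e (F.erase g) ∩ X.sym2) =
      #(F.erase g ∩ X.sym2) + (if e ∈ X.sym2 then 1 else 0) := by
    split_ifs with h
    · rw [insert_inter_of_mem h, card_insert_of_notMem]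
      simp [he]
    · rw [insert_inter_of_notMem h, add_zero]
  omega

/-- Swapping the new edge `e` with an edge `g` of the smallest tight set `X` containing `e` does
not enlarge the levels up to the one that `g` misses. -/
lemma tightLevel_swap_subset {ι : Type*} {E : Finset (Sym2 V)} {a b : ι → ℤ}
    {F F' : ι → Finset (Sym2 V)} {i : ι} {e g : Sym2 V} {X : Finset V}
    (hF : SparseCount (F i) (a i) (b i)) (heF : e ∉ F i) (hgF : g ∈ F i)
    (hi : F' i = insert e ((F i).erase g)) (hne : ∀ c ≠ i, F' c = F c)
    (heX : e ∈ X.sym2) (hgX : g ∈ X.sym2) (hX : IsTightSet (F i) (a i) (b i) X)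
    (hmin : ∀ Y : Finset V, e ∈ Y.sym2 → IsTightSet (F i) (a i) (b i) Y → X ⊆ Y) (m : ℕ)
    (hm : ∀ k < m, ↑(F i ∩ X.sym2) ⊆ tightLevel E a b F k) :
    ∀ k ≤ m, tightLevel E a b F' k ⊆ tightLevel E a b F k := by
  intro k
  induction k with
  | zero => exact fun _ => subset_rfl
  | succ k ih =>
    intro hk h hh
    specialize ih (by omega)
    specialize hm k (by omega)
    refine ⟨ih hh.1, fun c => ?_⟩
    obtain ⟨Y, hhY, hYt, hYL⟩ := hh.2 c
    replace hYL := hYL.trans ih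
    rcases eq_or_ne c i with rfl | hc
    swap
    · rw [hne c hc] at hYt hYL
      exact ⟨Y, hhY, hYt, hYL⟩
    have hcard := card_swap_inter heF hgF Y
    rw [← hi] at hcard
    have hsub : ↑(F c ∩ Y.sym2) ⊆ tightLevel E a b F k := by
      intro x hx
      obtain ⟨hxF, hxY⟩ := mem_inter.1 hx
      by_cases hxg : x = g
      · exact hxg ▸ hm (mem_inter.2 ⟨hgF, hgX⟩)
      · exact hYL (mem_inter.2 ⟨by rw [hi]; simp [hxg, hxF], hxY⟩)
    unfold IsTightSet at hYt
    by_cases heY : e ∈ Y.sym2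
    · by_cases hgY : g ∈ Y.sym2
      · rw [if_pos heY, if_pos hgY] at hcard
        exact ⟨Y, hhY, by unfold IsTightSet; rw [← hYt]; congr 1; omega, hsub⟩
      · rw [if_pos heY, if_neg hgY] at hcard
        have heXY : e ∈ (X ∩ Y).sym2 := by rw [sym2_inter]; exact mem_inter.2 ⟨heX, heY⟩
        have hXY := nonempty_of_mem_sym2 heXY
        have hlt : (#(F c ∩ (X ∩ Y).sym2) : ℤ) < a c * #(X ∩ Y) + b c := by
          refine lt_of_le_of_ne (hF _ hXY) fun ht => hgY ?_
          exact sym2_mono ((hmin _ heXY ht).trans inter_subset_right) hgX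
        obtain ⟨h1, h2⟩ := hF.uncross 1 hXY hX (Y := Y) (by rw [← hYt]; omega) (by omega)
        refine ⟨X ∪ Y, sym2_mono subset_union_right hhY, h1, ?_⟩
        rw [h2, coe_union]
        exact Set.union_subset hm hsub
    · by_cases hgY : g ∈ Y.sym2
      · have := hF Y (nonempty_of_mem_sym2 hhY)
        rw [if_neg heY, if_pos hgY] at hcard
        omega
      · rw [if_neg heY, if_neg hgY] at hcard
        exact ⟨Y, hhY, by unfold IsTightSet; rw [← hYt]; congr 1; omega, hsub⟩

/-- The augmentation step: a colouring of all edges but one into sparse classes, whose missing edge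
drops out of the levels, can be turned into a colouring of all edges. -/
lemma exists_coloring_of_notMem_tightLevel [Fintype V] {ι : Type*} [DecidableEq ι]
    {E : Finset (Sym2 V)} {a b : ι → ℤ} (n : ℕ) : ∀ (e : Sym2 V) (col : Sym2 V → ι), e ∈ E →
      (∀ i, SparseCount {x ∈ E.erase e | col x = i} (a i) (b i)) →
      e ∉ tightLevel E a b (fun i => {x ∈ E.erase e | col x = i}) n →
      ∃ col' : Sym2 V → ι, ∀ i, SparseCount {x ∈ E | col' x = i} (a i) (b i) := by
  classical
  induction n using Nat.strong_induction_on with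
  | _ n IH =>
  intro e col heE hF hen
  set F : ι → Finset (Sym2 V) := fun i => {x ∈ E.erase e | col x = i} with hFdef
  have heF : ∀ i, e ∉ F i := by simp [F]
  match n with
  | 0 => exact absurd heE hen
  | n + 1 =>
  by_cases hen' : e ∉ tightLevel E a b F n
  · exact IH n (Nat.lt_succ_self n) e col heE hF hen'
  push Not at hen'
  obtain ⟨i, hi⟩ : ∃ i, ∀ X : Finset V, e ∈ X.sym2 → IsTightSet (F i) (a i) (b i) X →
      ¬ ↑(F i ∩ X.sym2) ⊆ tightLevel E a b F n := by
    by_contra! hcon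
    exact hen ⟨hen', hcon⟩
  let T : Finset (Finset V) := {X | e ∈ X.sym2 ∧ IsTightSet (F i) (a i) (b i) X}
  rcases T.eq_empty_or_nonempty with hT | hT
  · refine ⟨Function.update col e i, fun c => ?_⟩
    have hne : ∀ X : Finset V, e ∈ X.sym2 → ¬ IsTightSet (F i) (a i) (b i) X := fun X h1 h2 =>
      notMem_empty X (hT ▸ mem_filter.2 ⟨mem_univ _, h1, h2⟩)
    rcases eq_or_ne c i with rfl | hc
    · refine ((hF c).insert_of_not_isTightSet hne).mono fun x hx => ?_
      by_cases hxe : x = e <;> simp_all [F]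
    · refine (hF c).mono fun x hx => ?_
      by_cases hxe : x = e
      · subst hxe
        simp [hc.symm] at hx
      · simp_all [F]
  obtain ⟨X, hXT, hXmin⟩ := T.exists_min_image card hT
  obtain ⟨heX, hX⟩ := (mem_filter.1 hXT).2
  have hmin : ∀ Y : Finset V, e ∈ Y.sym2 → IsTightSet (F i) (a i) (b i) Y → X ⊆ Y := by
    intro Y heY hY
    have heXY : e ∈ (X ∩ Y).sym2 := by rw [sym2_inter]; exact mem_inter.2 ⟨heX, heY⟩
    have hm : X ∩ Y ∈ T := mem_filter.2 ⟨mem_univ _, heXY,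
      (hF i).isTightSet_inter (nonempty_of_mem_sym2 heXY) hX hY⟩
    exact inter_eq_left.1 (eq_of_subset_of_card_le inter_subset_left (hXmin _ hm))
  have hex : ∃ m, ¬ ↑(F i ∩ X.sym2) ⊆ tightLevel E a b F m := ⟨n, hi X heX hX⟩
  have hmn : Nat.find hex ≤ n := Nat.find_min' hex (hi X heX hX)
  obtain ⟨g, hg, hgm⟩ := Set.not_subset.1 (Nat.find_spec hex)
  obtain ⟨hgF, hgX⟩ := mem_inter.1 hg
  obtain ⟨hgE, hgi⟩ := mem_filter.1 hgF
  have hge : g ≠ e := (mem_erase.1 hgE).1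
  have hFi : ({x ∈ E.erase g | Function.update col e i x = i} : Finset (Sym2 V)) =
      insert e ((F i).erase g) := by
    ext x
    by_cases hxe : x = e
    · subst hxe
      simp [heE, hge.symm]
    · simp [F, hxe, and_assoc]
  have hFc : ∀ c ≠ i, ({x ∈ E.erase g | Function.update col e i x = c} : Finset (Sym2 V)) =
      F c := by
    intro c hc
    ext x
    by_cases hxe : x = e
    · subst hxe
      simp [F, hc.symm]
    · by_cases hxg : x = g
      · subst hxg
        simp [F, hxe, hgi, hc.symm]
      · simp [F, hxe, hxg]
  refine IH (Nat.find hex) (by omega) g (Function.update col e i) (mem_erase.1 hgE).2 ?_ ?_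
  · intro c
    rcases eq_or_ne c i with rfl | hc
    · rw [hFi]
      intro Y hY
      have hcard := card_swap_inter (heF c) hgF Y
      have hle := hF c Y hY
      change (#(F c ∩ Y.sym2) : ℤ) ≤ _ at hle
      by_cases heY : e ∈ Y.sym2
      · by_cases ht : IsTightSet (F c) (a c) (b c) Y
        · have hgY : g ∈ Y.sym2 := sym2_mono (hmin Y heY ht) hgX
          rw [if_pos heY, if_pos hgY] at hcard
          omega
        · have := lt_of_le_of_ne hle ht
          rw [if_pos heY] at hcard
          omega
      · rw [if_neg heY] at hcard
        omega
    · rw [hFc c hc]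
      exact hF c
  · intro hcon
    exact hgm (tightLevel_swap_subset (F := F) (hF i) (heF i) hgF hFi hFc heX hgX hX hmin
      (Nat.find hex) (fun k hk => not_not.1 (Nat.find_min hex hk)) _ le_rfl hcon)

/-- An edge set that is sparse for the sums of the parameters splits into sparse classes. -/
theorem SparseCount.exists_coloring [Fintype V] {ι : Type*} [Fintype ι] [DecidableEq ι] [Nonempty ι]
    {a b : ι → ℤ} (hb : ∀ i, b i ≤ 0) (ha : ∀ i, 0 ≤ a i) (hab : ∀ i, 0 ≤ a i + b i)
    (E : Finset (Sym2 V)) (hE : SparseCount E (∑ i, a i) (∑ i, b i)) :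
    ∃ col : Sym2 V → ι, ∀ i, SparseCount {x ∈ E | col x = i} (a i) (b i) := by
  induction E using Finset.induction_on with
  | empty =>
    refine ⟨fun _ => Classical.arbitrary ι, fun i X hX => ?_⟩
    have : (1 : ℤ) ≤ #X := by exact_mod_cast hX.card_pos
    have := hab i
    simp only [filter_empty, empty_inter, card_empty, Nat.cast_zero]
    nlinarith [ha i]
  | insert e E he ih =>
    obtain ⟨col, hcol⟩ := ih (hE.mono (subset_insert e E))
    have herase : (insert e E).erase e = E := erase_insert he
    have hcol' : ∀ i, SparseCount {x ∈ (insert e E).erase e | col x = i} (a i) (b i) := by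
      rwa [herase]
    obtain ⟨k, hk⟩ := exists_tightLevel_succ_eq (insert e E) a b
      (fun i => {x ∈ (insert e E).erase e | col x = i})
    refine exists_coloring_of_notMem_tightLevel k e col (mem_insert_self e E) hcol' fun hek => ?_
    obtain ⟨U, heU, hU⟩ := exists_isTightSet_forall hb hcol'
      (fun h hh => (hk.symm ▸ hh : h ∈ tightLevel _ a b _ (k + 1)).2) hek
    rw [herase] at hU
    have h1 := hE U (nonempty_of_mem_sym2 heU)
    rw [insert_inter_of_mem heU, card_insert_of_notMem (fun h => he (mem_inter.1 h).1)] at h1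
    have h2 : #(E ∩ U.sym2) = ∑ i, #({x ∈ E | col x = i} ∩ U.sym2) := by
      rw [card_eq_sum_card_fiberwise (f := col) (t := univ) (fun _ _ => by simp)]
      refine sum_congr rfl fun i _ => ?_
      rw [filter_inter]
    have h3 : (#(E ∩ U.sym2) : ℤ) = (∑ i, a i) * #U + ∑ i, b i := by
      rw [h2, Nat.cast_sum, sum_mul, ← sum_add_distrib]
      exact sum_congr rfl fun i _ => hU i
    push_cast at h1
    omega

lemma IsSparse.sparseCount [Fintype V] {G : SimpleGraph V} {a b : ℤ} (hG : IsSparse G a b)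
    (ha : 0 ≤ a) (hab : 0 ≤ a + b) {E : Finset (Sym2 V)} (hE : ↑E ⊆ G.edgeSet) :
    SparseCount E a b := by
  intro X hX
  rcases (E ∩ X.sym2).eq_empty_or_nonempty with h0 | ⟨e, he⟩
  · have : (1 : ℤ) ≤ #X := by exact_mod_cast hX.card_pos
    rw [h0, card_empty, Nat.cast_zero]
    nlinarith
  have hsub : ↑(E ∩ X.sym2) ⊆ ((⊤ : G.Subgraph).induce (X : Set V)).edgeSet := by
    intro x hx
    obtain ⟨h1, h2⟩ := mem_inter.1 hx
    induction x with
    | _ x y =>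
      obtain ⟨hx, hy⟩ := mk_mem_sym2_iff.1 h2
      exact ⟨hx, hy, hE h1⟩
  have h := hG ((⊤ : G.Subgraph).induce (X : Set V)) ⟨e, hsub he⟩
  have hle := Set.ncard_le_ncard hsub (Set.toFinite _)
  rw [Set.ncard_coe_finset] at hle
  rw [SimpleGraph.Subgraph.induce_verts, Set.ncard_coe_finset] at h
  have : (#(E ∩ X.sym2) : ℝ) ≤ a * #X + b := le_trans (by exact_mod_cast hle) h
  exact_mod_cast this

lemma SparseCount.isSparse [Fintype V] {F : Finset (Sym2 V)} {a b : ℤ} (hF : SparseCount F a b)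
    {G : SimpleGraph V} (hG : G.edgeSet ⊆ F) : IsSparse G a b := by
  classical
  intro H hH
  have hsub : H.edgeSet ⊆ ↑(F ∩ H.verts.toFinset.sym2) := by
    intro e he
    refine mem_inter.2 ⟨hG (H.edgeSet_subset he), mem_sym2_iff.2 fun v hv => ?_⟩
    exact Set.mem_toFinset.2 (H.mem_verts_of_mem_edge he hv)
  obtain ⟨e, he⟩ := hH
  have h := hF H.verts.toFinset (nonempty_of_mem_sym2 (mem_inter.1 (hsub he)).2)
  have hle := Set.ncard_le_ncard hsub (Set.toFinite _)
  rw [Set.ncard_coe_finset] at hle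
  rw [← Set.ncard_eq_toFinset_card'] at h
  have : (H.edgeSet.ncard : ℤ) ≤ a * H.verts.ncard + b := le_trans (by exact_mod_cast hle) h
  exact_mod_cast this

end

theorem stmt0 (a₁ a₂ b₁ b₂ : ℤ) (ha₁ : 0 < a₁) (ha₂ : 0 < a₂)
    (hb₁ : -a₁ ≤ b₁) (hb₁' : b₁ ≤ 0) (hb₂ : -a₂ ≤ b₂) (hb₂' : b₂ ≤ 0)
    {V : Type*} [Fintype V] (G : SimpleGraph V)
    (hG : IsSparse G ((a₁ : ℝ) + (a₂ : ℝ)) ((b₁ : ℝ) + (b₂ : ℝ))) :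
    HasSparsePartition G (a₁ : ℝ) (b₁ : ℝ) (a₂ : ℝ) (b₂ : ℝ) := by
  classical
  have hG' : IsSparse G ((a₁ + a₂ : ℤ) : ℝ) ((b₁ + b₂ : ℤ) : ℝ) := by
    push_cast
    exact hG
  have hE : SparseCount G.edgeFinset (∑ i : Bool, bif i then a₁ else a₂)
      (∑ i : Bool, bif i then b₁ else b₂) := by
    simpa using hG'.sparseCount (by omega) (by omega) (E := G.edgeFinset) (by simp)
  obtain ⟨col, hcol⟩ := SparseCount.exists_coloring (by simp [hb₁', hb₂'])
    (by simp [ha₁.le, ha₂.le]) (by simp; omega) G.edgeFinset hE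
  have hedge : ∀ i, (SimpleGraph.fromEdgeSet {x ∈ G.edgeSet | col x = i}).edgeSet =
      {x ∈ G.edgeSet | col x = i} := by
    intro i
    rw [SimpleGraph.edgeSet_fromEdgeSet]
    ext x
    simp only [Set.mem_sdiff, Set.mem_ofPred_eq]
    exact ⟨fun h => h.1, fun h => ⟨h, G.not_isDiag_of_mem_edgeSet h.1⟩⟩
  have hle : ∀ i, SimpleGraph.fromEdgeSet {x ∈ G.edgeSet | col x = i} ≤ G := fun i => by
    rw [← SimpleGraph.edgeSet_subset_edgeSet, hedge]
    exact fun x hx => hx.1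
  refine ⟨_, _, hle true, hle false, ?_, ?_, (hcol true).isSparse ?_, (hcol false).isSparse ?_⟩
  · rw [hedge, hedge]
    ext x
    cases h : col x <;> simp [h]
  · rw [hedge, hedge, Set.disjoint_left]
    rintro x ⟨-, h⟩ ⟨-, h'⟩
    simp [h] at h'
  all_goals
    rw [hedge]
    intro x
    simp
end

section
/- Let a₁, a₂ be positive integers and b₁, b₂ be integers with b₁ ≥ 0 and b₂ ≥ 0. Then every (a₁+a₂, b₁+b₂)-sparse finite simple graph G admits an edge-partition E(G) = E(G₁) ∪ E(G₂) such that G₁ is (a₁,b₁)-sparse and G₂ is (a₂,b₂)-sparse. -/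
/-- The subgraph of `G` spanned by a set of its edges. -/
def SimpleGraph.spannedBy {V : Type*} (G : SimpleGraph V) (X : Set G.edgeSet) : G.Subgraph where
  verts := {v | ∃ e ∈ X, v ∈ (e : Sym2 V)}
  Adj u v := ∃ e ∈ X, (e : Sym2 V) = s(u, v)
  adj_sub := by
    rintro u v ⟨e, -, he⟩
    have := e.2
    rwa [he] at this
  edge_vert := by
    rintro u v ⟨e, heX, he⟩
    exact ⟨e, heX, by simp [he]⟩
  symm := ⟨fun u v ⟨e, heX, he⟩ => ⟨e, heX, by rw [he, Sym2.eq_swap]⟩⟩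

theorem SimpleGraph.edgeSet_spannedBy {V : Type*} (G : SimpleGraph V) (X : Set G.edgeSet) :
    (G.spannedBy X).edgeSet = Subtype.val '' X := by
  ext e
  induction e with
  | _ u v =>
    rw [SimpleGraph.Subgraph.mem_edgeSet]
    simp only [SimpleGraph.spannedBy, Set.mem_image]

/-- In a sparse graph, Hall's theorem injectively assigns to each edge either one of the
`card A` slots at one of its endpoints or one of `card B` universal slots. -/
theorem IsSparse.exists_injective_slot {V : Type*} [Fintype V] {G : SimpleGraph V}
    {A B : Type*} [Fintype A] [Fintype B]
    (hG : IsSparse G (Fintype.card A : ℝ) (Fintype.card B : ℝ)) :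
    ∃ φ : G.edgeSet → (V × A) ⊕ B, Function.Injective φ ∧
      ∀ e v a, φ e = Sum.inl (v, a) → v ∈ (e : Sym2 V) := by
  classical
  let t : G.edgeSet → Finset ((V × A) ⊕ B) := fun e =>
    Finset.disjSum (({v | v ∈ (e : Sym2 V)} : Finset V) ×ˢ (Finset.univ : Finset A)) Finset.univ
  obtain ⟨φ, hφ, hmem⟩ := (Finset.all_card_le_biUnion_card_iff_exists_injective t).1 (by
    intro X
    rcases X.eq_empty_or_nonempty with rfl | hX
    · simp
    have hsub : Finset.disjSum (({v | ∃ e ∈ X, v ∈ (e : Sym2 V)} : Finset V) ×ˢ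
        (Finset.univ : Finset A)) (Finset.univ : Finset B) ⊆ X.biUnion t := by
      rintro (⟨v, a⟩ | b) h
      · simpa [t] using h
      · obtain ⟨e, he⟩ := hX
        exact Finset.mem_biUnion.2 ⟨e, he, by simp [t]⟩
    refine le_trans ?_ (Finset.card_le_card hsub)
    have hedge := G.edgeSet_spannedBy (X : Set G.edgeSet)
    have h := hG (G.spannedBy X) (by rw [hedge]; exact Set.Nonempty.image _ hX)
    have hverts : (G.spannedBy (X : Set G.edgeSet)).verts =
        (({v | ∃ e ∈ X, v ∈ (e : Sym2 V)} : Finset V) : Set V) := by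
      ext v
      simp [SimpleGraph.spannedBy]
    rw [hedge, Set.ncard_image_of_injective _ Subtype.val_injective, hverts,
      Set.ncard_coe_finset, Set.ncard_coe_finset] at h
    rw [Finset.card_disjSum, Finset.card_product, Finset.card_univ, Finset.card_univ, mul_comm]
    exact_mod_cast h)
  refine ⟨φ, hφ, fun e v a h => ?_⟩
  have := hmem e
  rw [h] at this
  simpa [t] using this

/-- If the edges of `K` are edges of `G` whose slots, under an injective slot assignment for `G`,
lie in the image of `(V × A') ⊕ B'`, then `K` is sparse. -/
theorem isSparse_of_slots {V : Type*} [Fintype V] {G K : SimpleGraph V} {A B A' B' : Type*}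
    [Fintype A'] [Fintype B'] (f : A' → A) (g : B' → B)
    {φ : G.edgeSet → (V × A) ⊕ B} (hφ : Function.Injective φ)
    (hinc : ∀ e v a, φ e = Sum.inl (v, a) → v ∈ (e : Sym2 V))
    (hK : ∀ e ∈ K.edgeSet, ∃ (h : e ∈ G.edgeSet) (s : (V × A') ⊕ B'),
      φ ⟨e, h⟩ = Sum.map (Prod.map id f) g s) :
    IsSparse K (Fintype.card A' : ℝ) (Fintype.card B' : ℝ) := by
  classical
  intro H _
  choose hmem s hs using hK
  let ψ : H.edgeSet → (V × A') ⊕ B' := fun e => s e (H.edgeSet_subset e.2)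
  have hψ : Function.Injective ψ := fun e e' h => by
    have := (hs e (H.edgeSet_subset e.2)).trans
      ((congrArg _ h).trans (hs e' (H.edgeSet_subset e'.2)).symm)
    exact Subtype.ext (Subtype.mk.inj (hφ this))
  have hmaps : ∀ e, ψ e ∈ Finset.disjSum (H.verts.toFinset ×ˢ (Finset.univ : Finset A'))
      (Finset.univ : Finset B') := fun e => by
    rcases h : ψ e with ⟨v, a⟩ | b
    · have hv := hinc _ v (f a) ((hs e (H.edgeSet_subset e.2)).trans (congrArg _ h))
      simpa using H.mem_verts_of_mem_edge e.2 hv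
    · simp
  have hcard := Finset.card_le_card_of_injOn (s := Finset.univ) ψ (fun e _ => hmaps e) hψ.injOn
  rw [Finset.card_univ, ← Nat.card_eq_fintype_card, Nat.card_coe_set_eq,
    Finset.card_disjSum, Finset.card_product, Finset.card_univ,
    Finset.card_univ, mul_comm, ← Set.ncard_eq_toFinset_card'] at hcard
  exact_mod_cast hcard

theorem stmt1 (a₁ a₂ b₁ b₂ : ℤ) (ha₁ : 0 < a₁) (ha₂ : 0 < a₂)
    (hb₁ : 0 ≤ b₁) (hb₂ : 0 ≤ b₂)
    {V : Type*} [Fintype V] (G : SimpleGraph V)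
    (hG : IsSparse G ((a₁ : ℝ) + (a₂ : ℝ)) ((b₁ : ℝ) + (b₂ : ℝ))) :
    HasSparsePartition G (a₁ : ℝ) (b₁ : ℝ) (a₂ : ℝ) (b₂ : ℝ) := by
  lift a₁ to ℕ using ha₁.le
  lift a₂ to ℕ using ha₂.le
  lift b₁ to ℕ using hb₁
  lift b₂ to ℕ using hb₂
  obtain ⟨φ, hφ, hinc⟩ := IsSparse.exists_injective_slot
    (A := Fin a₁ ⊕ Fin a₂) (B := Fin b₁ ⊕ Fin b₂) (G := G) (by simpa using hG)
  let E₁ : Set (Sym2 V) := {e | ∃ (h : e ∈ G.edgeSet) (s : (V × Fin a₁) ⊕ Fin b₁),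
    φ ⟨e, h⟩ = Sum.map (Prod.map id Sum.inl) Sum.inl s}
  have hE₁ : E₁ ⊆ G.edgeSet := fun e he => he.1
  have h₁ : (SimpleGraph.fromEdgeSet E₁).edgeSet = E₁ := by
    rw [SimpleGraph.edgeSet_fromEdgeSet]
    exact sdiff_eq_left.2 (Set.disjoint_left.2 fun e he => G.not_isDiag_of_mem_edgeSet (hE₁ he))
  have h₂ : (G \ SimpleGraph.fromEdgeSet E₁).edgeSet = G.edgeSet \ E₁ := by
    rw [SimpleGraph.edgeSet_sdiff, h₁]
  refine ⟨SimpleGraph.fromEdgeSet E₁, G \ SimpleGraph.fromEdgeSet E₁, ?_, sdiff_le, ?_, ?_, ?_, ?_⟩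
  · rw [← SimpleGraph.edgeSet_subset_edgeSet, h₁]
    exact hE₁
  · rw [h₁, h₂, Set.union_sdiff_cancel hE₁]
  · rw [h₁, h₂]
    exact Set.disjoint_sdiff_right
  · have := isSparse_of_slots (K := SimpleGraph.fromEdgeSet E₁) (A' := Fin a₁) (B' := Fin b₁)
      Sum.inl Sum.inl hφ hinc (fun e he => by rwa [h₁] at he)
    simpa using this
  · have := isSparse_of_slots (K := G \ SimpleGraph.fromEdgeSet E₁) (A' := Fin a₂) (B' := Fin b₂)
      Sum.inr Sum.inr hφ hinc (fun e he => by
        rw [h₂] at he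
        refine ⟨he.1, ?_⟩
        rcases hs : φ ⟨e, he.1⟩ with ⟨v, a | a⟩ | b | b
        · exact absurd ⟨he.1, Sum.inl (v, a), hs⟩ he.2
        · exact ⟨Sum.inl (v, a), rfl⟩
        · exact absurd ⟨he.1, Sum.inr b, hs⟩ he.2
        · exact ⟨Sum.inr b, rfl⟩)
    simpa using this
end

section
/- For all positive integers a₁ and a₂ and every natural number N, there exists a finite simple graph G with at least N vertices such that G is (a₁+a₂, 0)-sparse, but G admits no edge-partition E(G) = E(G₁) ∪ E(G₂) with G₁ being (a₁, −1)-sparse and G₂ being (a₂, 1)-sparse. -/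
/-- The pairs all of whose members lie in `S`. -/
def pairsWithin {V : Type*} (S : Set V) : Set (Sym2 V) := {e | ∀ v ∈ e, v ∈ S}

lemma edgeSet_induce_top {V : Type*} (G : SimpleGraph V) (S : Set V) :
    ((⊤ : G.Subgraph).induce S).edgeSet = G.edgeSet ∩ pairsWithin S := by
  ext e
  induction e with
  | h x y => simp [pairsWithin]; tauto

lemma IsSparse.ncard_inter_le {V : Type*} [Fintype V] {G : SimpleGraph V} {a b : ℝ}
    (h : IsSparse G a b) (S : Set V) (h0 : 0 ≤ a * S.ncard + b) :
    ((G.edgeSet ∩ pairsWithin S).ncard : ℝ) ≤ a * S.ncard + b := by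
  have key := h ((⊤ : G.Subgraph).induce S)
  rw [edgeSet_induce_top] at key
  rcases (G.edgeSet ∩ pairsWithin S).eq_empty_or_nonempty with he | he
  · simpa [he] using h0
  · exact key he

/-- A graph of maximum degree at most `2 * d` is `(d, 0)`-sparse. -/
lemma isSparse_of_degree_le {V : Type*} [Fintype V] (G : SimpleGraph V) (d : ℕ)
    (h : ∀ v, (G.neighborSet v).ncard ≤ 2 * d) : IsSparse G (d : ℝ) 0 := by
  classical
  intro H _
  have hsum := H.spanningCoe.sum_degrees_eq_twice_card_edges
  have hE : H.spanningCoe.edgeFinset.card = H.edgeSet.ncard := by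
    rw [← Set.ncard_coe_finset, SimpleGraph.coe_edgeFinset, SimpleGraph.Subgraph.edgeSet_spanningCoe]
  have hdeg : ∀ v, H.spanningCoe.degree v ≤ if v ∈ H.verts then 2 * d else 0 := by
    intro v
    have hd : H.spanningCoe.degree v = (H.neighborSet v).ncard := by
      rw [← SimpleGraph.card_neighborFinset_eq_degree, ← Set.ncard_coe_finset,
        SimpleGraph.coe_neighborFinset]
      rfl
    rw [hd]
    split_ifs with hv
    · exact (Set.ncard_le_ncard (H.neighborSet_subset v) (Set.toFinite _)).trans (h v)
    · have : H.neighborSet v = ∅ := by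
        ext w
        simp only [SimpleGraph.Subgraph.mem_neighborSet, Set.mem_empty_iff_false, iff_false]
        exact fun hw => hv hw.fst_mem
      simp [this]
  have hle := Finset.sum_le_sum (s := Finset.univ) fun v _ => hdeg v
  rw [hsum, hE, ← Finset.sum_filter, Finset.sum_const, ← Set.ncard_coe_finset] at hle
  simp only [Finset.mem_univ, true_and, Finset.coe_filter, Set.ofPred_mem_eq, smul_eq_mul] at hle
  have : H.edgeSet.ncard ≤ d * H.verts.ncard := by nlinarith
  rw [add_zero]
  exact_mod_cast this

/-- The disjoint union of cliques on consecutive blocks of `s` vertices. -/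
def blockCliques (n s : ℕ) : SimpleGraph (Fin n) where
  Adj x y := x ≠ y ∧ x.val / s = y.val / s
  symm := ⟨fun _ _ h => ⟨h.1.symm, h.2.symm⟩⟩
  loopless := ⟨fun _ h => h.1 rfl⟩

/-- The `i`-th block of `s` consecutive vertices. -/
def block (n s i : ℕ) : Finset (Fin n) := Finset.univ.filter fun x => x.val / s = i

lemma card_block {m s i : ℕ} (hs : 0 < s) (hi : i < m) : (block (m * s) s i).card = s := by
  have hms : (i + 1) * s ≤ m * s := Nat.mul_le_mul_right _ hi
  have himage : (block (m * s) s i).map Fin.valEmbedding = Finset.Ico (i * s) ((i + 1) * s) := by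
    ext x
    simp only [block, Finset.mem_map, Finset.mem_filter, Finset.mem_univ, true_and,
      Fin.valEmbedding_apply, Finset.mem_Ico]
    constructor
    · rintro ⟨y, rfl, rfl⟩
      exact ⟨Nat.div_mul_le_self _ _, Nat.lt_mul_of_div_lt (Nat.lt_succ_self _) hs⟩
    · rintro ⟨h1, h2⟩
      exact ⟨⟨x, h2.trans_le hms⟩, Nat.div_eq_of_lt_le h1 h2, rfl⟩
  rw [← Finset.card_map Fin.valEmbedding, himage, Nat.card_Ico, Nat.add_mul, one_mul,
    Nat.add_sub_cancel_left]

lemma ncard_neighborSet_blockCliques_le {m s : ℕ} (hs : 0 < s) (v : Fin (m * s)) :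
    ((blockCliques (m * s) s).neighborSet v).ncard ≤ s - 1 := by
  have hv : v.val / s < m := Nat.div_lt_of_lt_mul (by simp [mul_comm])
  have hmem : v ∈ block (m * s) s (v.val / s) := by simp [block]
  have : (blockCliques (m * s) s).neighborSet v
      = ((block (m * s) s (v.val / s)).erase v : Finset _) := by
    ext w
    simp [blockCliques, block, eq_comm, and_comm]
  rw [this, Set.ncard_coe_finset, Finset.card_erase_of_mem hmem, card_block hs hv]

lemma ncard_edgeSet_blockCliques_inter {m s i : ℕ} (hs : 0 < s) (hi : i < m) :
    ((blockCliques (m * s) s).edgeSet ∩ pairsWithin (block (m * s) s i : Set _)).ncard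
      = s.choose 2 := by
  have : (blockCliques (m * s) s).edgeSet ∩ pairsWithin (block (m * s) s i : Set _)
      = (((block (m * s) s i).offDiag.image Sym2.mk.uncurry : Finset _) : Set _) := by
    ext e
    induction e with
    | h x y =>
      simp only [blockCliques, pairsWithin, block, Set.mem_inter_iff, SimpleGraph.mem_edgeSet]
      simp
      grind
  rw [this, Set.ncard_coe_finset]
  have := Sym2.card_image_offDiag (block (m * s) s i)
  rw [card_block hs hi] at this
  exact this

theorem stmt3 (a₁ a₂ : ℤ) (ha₁ : 0 < a₁) (ha₂ : 0 < a₂) (N : ℕ) :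
    ∃ (n : ℕ) (G : SimpleGraph (Fin n)), N ≤ n ∧
      IsSparse G ((a₁ : ℝ) + (a₂ : ℝ)) 0 ∧
      ¬ HasSparsePartition G (a₁ : ℝ) (-1) (a₂ : ℝ) 1 := by
  lift a₁ to ℕ using ha₁.le with k
  lift a₂ to ℕ using ha₂.le with l
  have hk : 1 ≤ k := by omega
  set s := 2 * (k + l) + 1 with hs
  have hs0 : 0 < s := by omega
  have hchoose : s.choose 2 = (k + l) * s := by
    rw [Nat.choose_two_right, hs, Nat.add_sub_cancel]
    exact Nat.div_eq_of_eq_mul_left two_pos (by ring)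
  refine ⟨(N + 2) * s, blockCliques ((N + 2) * s) s, by nlinarith, ?_, ?_⟩
  · have := isSparse_of_degree_le (blockCliques ((N + 2) * s) s) (k + l)
      fun v => (ncard_neighborSet_blockCliques_le hs0 v).trans (by omega)
    simpa using this
  · rintro ⟨G₁, G₂, -, -, hunion, hdisj, h₁, h₂⟩
    set B : ℕ → Set (Fin ((N + 2) * s)) := fun i => (block ((N + 2) * s) s i : Set _) with hB
    have hcard : ∀ i < N + 2, (B i).ncard = s := fun i hi => by
      rw [hB, Set.ncard_coe_finset, card_block hs0 hi]
    have hkR : (1 : ℝ) ≤ k := by exact_mod_cast hk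
    have hsR : (1 : ℝ) ≤ s := by exact_mod_cast hs0
    have hlow : ∀ i < N + 2, (l : ℝ) * s + 1 ≤ ((G₂.edgeSet ∩ pairsWithin (B i)).ncard : ℝ) := by
      intro i hi
      have hup := h₁.ncard_inter_le (B i) (by
        rw [hcard i hi, Int.cast_natCast]; nlinarith)
      have htot := ncard_edgeSet_blockCliques_inter hs0 hi
      rw [← hunion, Set.union_inter_distrib_right, Set.ncard_union_eq
        (hdisj.mono Set.inter_subset_left Set.inter_subset_left)
        (Set.toFinite _) (Set.toFinite _), hchoose] at htot
      have htotR : ((G₁.edgeSet ∩ pairsWithin (B i)).ncard : ℝ)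
          + (G₂.edgeSet ∩ pairsWithin (B i)).ncard = (k + l) * s := by exact_mod_cast htot
      rw [hcard i hi, Int.cast_natCast] at hup
      linarith
    have hBdisj : Disjoint (B 0) (B 1) := by
      rw [Set.disjoint_left]
      intro x hx hy
      simp only [hB, block, Finset.coe_filter, Finset.mem_univ, true_and, Set.mem_ofPred_eq]
        at hx hy
      omega
    have hBcard : (B 0 ∪ B 1).ncard = s + s := by
      rw [Set.ncard_union_eq hBdisj (Set.toFinite _) (Set.toFinite _),
        hcard 0 (by omega), hcard 1 (by omega)]
    have hup := h₂.ncard_inter_le (B 0 ∪ B 1) (by positivity)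
    have hEdisj : Disjoint (G₂.edgeSet ∩ pairsWithin (B 0)) (G₂.edgeSet ∩ pairsWithin (B 1)) := by
      rw [Set.disjoint_left]
      rintro e ⟨-, h0⟩ ⟨-, h1⟩
      induction e with
      | h x y =>
        exact Set.disjoint_left.1 hBdisj (h0 x (Sym2.mem_mk_left x y))
          (h1 x (Sym2.mem_mk_left x y))
    have hsub : (G₂.edgeSet ∩ pairsWithin (B 0)) ∪ (G₂.edgeSet ∩ pairsWithin (B 1))
        ⊆ G₂.edgeSet ∩ pairsWithin (B 0 ∪ B 1) := by
      rintro e (⟨he, h⟩ | ⟨he, h⟩)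
      · exact ⟨he, fun v hv => Or.inl (h v hv)⟩
      · exact ⟨he, fun v hv => Or.inr (h v hv)⟩
    have hle := Set.ncard_le_ncard hsub (Set.toFinite _)
    rw [Set.ncard_union_eq hEdisj (Set.toFinite _) (Set.toFinite _)] at hle
    have hleR : ((G₂.edgeSet ∩ pairsWithin (B 0)).ncard : ℝ)
        + (G₂.edgeSet ∩ pairsWithin (B 1)).ncard
        ≤ (G₂.edgeSet ∩ pairsWithin (B 0 ∪ B 1)).ncard := by exact_mod_cast hle
    rw [hBcard, Int.cast_natCast] at hup
    push_cast at hup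
    linarith [hlow 0 (by omega), hlow 1 (by omega)]
end

section
/- For all integers a, t with 1 ≤ t < a and every natural number N, there exists a finite simple graph G with at least N vertices such that G is (2a, −2a)-sparse, but G admits no edge-partition E(G) = E(G₁) ∪ E(G₂) with G₁ being (a, −t)-sparse and G₂ being (a, t−2a)-sparse. -/
/-- The set of unordered pairs of distinct elements of `S`. -/
def cliqueEdges {V : Type*} [DecidableEq V] (S : Finset V) : Finset (Sym2 V) :=
  S.offDiag.image Sym2.mk.uncurry

section

variable {V : Type*} [DecidableEq V]

lemma mk_mem_cliqueEdges {S : Finset V} {u v : V} :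
    s(u, v) ∈ cliqueEdges S ↔ u ∈ S ∧ v ∈ S ∧ u ≠ v := by
  simp only [cliqueEdges, Finset.mem_image, Finset.mem_offDiag, Prod.exists, Function.uncurry,
    Sym2.eq_iff]
  constructor
  · rintro ⟨x, y, ⟨hx, hy, hxy⟩, ⟨rfl, rfl⟩ | ⟨rfl, rfl⟩⟩
    · exact ⟨hx, hy, hxy⟩
    · exact ⟨hy, hx, hxy.symm⟩
  · rintro ⟨hu, hv, huv⟩
    exact ⟨u, v, ⟨hu, hv, huv⟩, Or.inl ⟨rfl, rfl⟩⟩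

lemma card_cliqueEdges (S : Finset V) : (cliqueEdges S).card = S.card.choose 2 :=
  Sym2.card_image_offDiag S

lemma disjoint_cliqueEdges {A B : Finset V} (h : (A ∩ B).card ≤ 1) :
    Disjoint (cliqueEdges A) (cliqueEdges B) := by
  rw [Finset.disjoint_left]
  intro e
  induction e with
  | _ u v =>
    simp only [mk_mem_cliqueEdges]
    rintro ⟨hu, hv, huv⟩ ⟨hu', hv', -⟩
    exact huv (Finset.card_le_one.1 h u (Finset.mem_inter.2 ⟨hu, hu'⟩) v
      (Finset.mem_inter.2 ⟨hv, hv'⟩))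

/-- The union of the cliques on `A` and on `B`. -/
def twoCliques (A B : Finset V) : SimpleGraph V :=
  SimpleGraph.fromEdgeSet (↑(cliqueEdges A ∪ cliqueEdges B) : Set (Sym2 V))

lemma twoCliques_adj {A B : Finset V} {u v : V} :
    (twoCliques A B).Adj u v ↔ s(u, v) ∈ cliqueEdges A ∪ cliqueEdges B := by
  simp only [twoCliques, SimpleGraph.fromEdgeSet_adj, Finset.mem_coe, Finset.mem_union,
    mk_mem_cliqueEdges]
  tauto

lemma edgeSet_twoCliques (A B : Finset V) :
    (twoCliques A B).edgeSet = ↑(cliqueEdges A ∪ cliqueEdges B) := by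
  ext e
  induction e with
  | _ u v => rw [SimpleGraph.mem_edgeSet, twoCliques_adj, Finset.mem_coe]

/-- A sparse graph has few edges inside any edge set `F` spanned by a vertex set `S`. -/
lemma IsSparse.ncard_inter_le_s4 [Fintype V] {G : SimpleGraph V} {a b : ℝ} (hG : IsSparse G a b)
    {S : Finset V} {F : Finset (Sym2 V)} (hF : F ⊆ cliqueEdges S)
    (hne : (G.edgeSet ∩ F).Nonempty) :
    ((G.edgeSet ∩ F).ncard : ℝ) ≤ a * S.card + b := by
  let H : G.Subgraph :=
    { verts := S
      Adj := fun u v => G.Adj u v ∧ s(u, v) ∈ F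
      adj_sub := fun h => h.1
      edge_vert := fun h => (mk_mem_cliqueEdges.1 (hF h.2)).1
      symm := ⟨fun u v h => ⟨h.1.symm, Sym2.eq_swap (a := u) ▸ h.2⟩⟩ }
  have hH : H.edgeSet = G.edgeSet ∩ F := by
    ext e
    induction e with
    | _ u v => rfl
  have h := hG H (hH ▸ hne)
  rwa [hH, show H.verts = (S : Set V) from rfl, Set.ncard_coe_finset] at h

/-- Two cliques of order at most `4 * k` with at most one common vertex form a
`(2 * k, -2 * k)`-sparse graph. -/
lemma isSparse_twoCliques [Fintype V] {A B : Finset V} {k : ℕ} (hA : A.card ≤ 4 * k)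
    (hB : B.card ≤ 4 * k) (hAB : (A ∩ B).card ≤ 1) :
    IsSparse (twoCliques A B) (2 * (k : ℝ)) (-(2 * (k : ℝ))) := by
  classical
  intro H hne
  set S : Finset V := H.verts.toFinset with hS
  have hSc : H.verts.ncard = S.card := Set.ncard_eq_toFinset_card' _
  have hsub : H.edgeSet ⊆ ↑(cliqueEdges (S ∩ A) ∪ cliqueEdges (S ∩ B)) := by
    intro e
    induction e with
    | _ u v =>
      intro h
      rw [SimpleGraph.Subgraph.mem_edgeSet] at h
      have h1 := twoCliques_adj.1 h.adj_sub
      have hu : u ∈ S := by simpa [hS] using h.fst_mem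
      have hv : v ∈ S := by simpa [hS] using h.snd_mem
      simp only [Finset.mem_coe, Finset.mem_union, mk_mem_cliqueEdges, Finset.mem_inter] at h1 ⊢
      tauto
  have hS1 : 1 ≤ S.card := by
    obtain ⟨e, he⟩ := hne
    induction e with
    | _ u v =>
      rw [SimpleGraph.Subgraph.mem_edgeSet] at he
      exact Finset.card_pos.2 ⟨u, by simpa [hS] using he.fst_mem⟩
  have hcard : H.edgeSet.ncard ≤ (S ∩ A).card.choose 2 + (S ∩ B).card.choose 2 := by
    calc H.edgeSet.ncard ≤ (cliqueEdges (S ∩ A) ∪ cliqueEdges (S ∩ B)).card := by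
          rw [← Set.ncard_coe_finset]
          exact Set.ncard_le_ncard hsub (Finset.finite_toSet _)
      _ ≤ _ := by
          rw [← card_cliqueEdges, ← card_cliqueEdges]
          exact Finset.card_union_le _ _
  have hsum : (S ∩ A).card + (S ∩ B).card ≤ S.card + 1 := by
    rw [← Finset.card_union_add_card_inter]
    refine add_le_add (Finset.card_le_card ?_) ((Finset.card_le_card ?_).trans hAB)
    · exact Finset.union_subset Finset.inter_subset_left Finset.inter_subset_left
    · exact Finset.inter_subset_inter Finset.inter_subset_right Finset.inter_subset_right
  have hp1 : (S ∩ A).card ≤ S.card := Finset.card_le_card Finset.inter_subset_left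
  have hq1 : (S ∩ B).card ≤ S.card := Finset.card_le_card Finset.inter_subset_left
  have hp : (S ∩ A).card ≤ 4 * k := (Finset.card_le_card Finset.inter_subset_right).trans hA
  have hq : (S ∩ B).card ≤ 4 * k := (Finset.card_le_card Finset.inter_subset_right).trans hB
  have hchoose : ∀ p : ℕ, p ≤ 4 * k → p.choose 2 ≤ 2 * k * (p - 1) := by
    intro p hp
    rw [Nat.choose_two_right]
    refine Nat.div_le_of_le_mul ?_
    calc p * (p - 1) ≤ 4 * k * (p - 1) := Nat.mul_le_mul_right _ hp
      _ = 2 * (2 * k * (p - 1)) := by ring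
  have key : H.edgeSet.ncard ≤ 2 * k * (S.card - 1) :=
    calc H.edgeSet.ncard
        ≤ 2 * k * ((S ∩ A).card - 1) + 2 * k * ((S ∩ B).card - 1) :=
          hcard.trans (add_le_add (hchoose _ hp) (hchoose _ hq))
      _ = 2 * k * (((S ∩ A).card - 1) + ((S ∩ B).card - 1)) := by ring
      _ ≤ _ := Nat.mul_le_mul_left _ (by omega)
  rw [hSc]
  have := (Nat.cast_le (α := ℝ)).2 key
  push_cast [Nat.cast_sub hS1] at this
  linarith

/-- In a partition of `E(G)` into two parts, the first part takes up many edges of any clique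
of order `4 * k`, since the second part is sparse. -/
lemma le_ncard_inter_cliqueEdges [Fintype V] {G G₁ G₂ : SimpleGraph V} {A : Finset V} {k : ℕ}
    {t : ℝ} (ht : 0 ≤ t) (hk : 1 ≤ k) (hA : A.card = 4 * k)
    (hAG : (cliqueEdges A : Set (Sym2 V)) ⊆ G.edgeSet)
    (hun : G₁.edgeSet ∪ G₂.edgeSet = G.edgeSet) (h₂ : IsSparse G₂ k (t - 2 * k)) :
    4 * (k : ℝ) ^ 2 - t ≤ ((G₁.edgeSet ∩ cliqueEdges A).ncard : ℝ) := by
  have hk' : (1 : ℝ) ≤ k := by exact_mod_cast hk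
  have hsplit : (cliqueEdges A).card ≤
      (G₁.edgeSet ∩ cliqueEdges A).ncard + (G₂.edgeSet ∩ cliqueEdges A).ncard := by
    rw [← Set.ncard_coe_finset]
    refine le_trans (Set.ncard_le_ncard ?_ (Set.toFinite _)) (Set.ncard_union_le _ _)
    rw [← Set.union_inter_distrib_right, hun]
    exact Set.subset_inter hAG le_rfl
  have h2 : ((G₂.edgeSet ∩ cliqueEdges A).ncard : ℝ) ≤ k * (4 * k) + (t - 2 * k) := by
    rcases (G₂.edgeSet ∩ (cliqueEdges A : Set (Sym2 V))).eq_empty_or_nonempty with h | h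
    · rw [h, Set.ncard_empty]
      push_cast
      nlinarith
    · have := h₂.ncard_inter_le_s4 le_rfl h
      rw [hA] at this
      push_cast at this
      exact this
  have hs := (Nat.cast_le (α := ℝ)).2 hsplit
  rw [card_cliqueEdges, hA, Nat.cast_choose_two] at hs
  push_cast at hs
  nlinarith

/-- Two cliques of order `4 * k` sharing exactly one vertex admit no partition into a
`(k, -t)`-sparse and a `(k, t - 2 * k)`-sparse graph when `t < k`. -/
lemma not_hasSparsePartition_twoCliques [Fintype V] {A B : Finset V} {k : ℕ} {t : ℝ}
    (ht : 0 ≤ t) (htk : t < k) (hA : A.card = 4 * k) (hB : B.card = 4 * k)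
    (hAB : (A ∩ B).card = 1) :
    ¬ HasSparsePartition (twoCliques A B) k (-t) k (t - 2 * k) := by
  rintro ⟨G₁, G₂, -, -, hun, -, h₁, h₂⟩
  have hk : 1 ≤ k := by
    have : (0 : ℝ) < k := ht.trans_lt htk
    exact_mod_cast this
  have hk' : (1 : ℝ) ≤ k := by exact_mod_cast hk
  have hG := edgeSet_twoCliques A B
  rw [Finset.coe_union] at hG
  have hlA := le_ncard_inter_cliqueEdges ht hk hA (hG ▸ Set.subset_union_left) hun h₂
  have hlB := le_ncard_inter_cliqueEdges ht hk hB (hG ▸ Set.subset_union_right) hun h₂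
  have hsum : (G₁.edgeSet ∩ ↑(cliqueEdges A ∪ cliqueEdges B)).ncard =
      (G₁.edgeSet ∩ cliqueEdges A).ncard + (G₁.edgeSet ∩ cliqueEdges B).ncard := by
    rw [Finset.coe_union, Set.inter_union_distrib_left]
    refine Set.ncard_union_eq ?_ (Set.toFinite _) (Set.toFinite _)
    exact (Finset.disjoint_coe.2 (disjoint_cliqueEdges hAB.le)).mono
      Set.inter_subset_right Set.inter_subset_right
  have hsum' := congrArg (Nat.cast (R := ℝ)) hsum
  push_cast at hsum'
  have hne : (G₁.edgeSet ∩ ↑(cliqueEdges A ∪ cliqueEdges B)).Nonempty := by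
    apply Set.nonempty_of_ncard_ne_zero
    rw [← Nat.pos_iff_ne_zero, ← Nat.cast_pos (α := ℝ), hsum]
    push_cast
    nlinarith
  have hsub : cliqueEdges A ∪ cliqueEdges B ⊆ cliqueEdges (A ∪ B) := by
    intro e
    induction e with
    | _ u v =>
      simp only [Finset.mem_union, mk_mem_cliqueEdges]
      tauto
  have hcard : ((A ∪ B).card : ℝ) = 8 * k - 1 := by
    have h := Finset.card_union_add_card_inter A B
    rw [hA, hB, hAB] at h
    have h' := congrArg (Nat.cast (R := ℝ)) h
    push_cast at h'
    linarith
  have hup := h₁.ncard_inter_le_s4 hsub hne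
  rw [hcard, hsum] at hup
  push_cast at hup
  nlinarith

end

theorem stmt4 (a t : ℤ) (ht1 : 1 ≤ t) (hta : t < a) (N : ℕ) :
    ∃ (n : ℕ) (G : SimpleGraph (Fin n)), N ≤ n ∧
      IsSparse G (2 * (a : ℝ)) (-(2 * (a : ℝ))) ∧
      ¬ HasSparsePartition G (a : ℝ) (-(t : ℝ)) (a : ℝ) ((t : ℝ) - 2 * (a : ℝ)) := by
  lift a to ℕ using by omega with k
  have hcard : ∀ i j, j ≤ 8 * k + N →
      (Finset.univ.filter fun x : Fin (8 * k + N) => i ≤ x.1 ∧ x.1 < j).card = j - i := by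
    intro i j hj
    rw [← Nat.card_Ico, ← Finset.card_map Fin.valEmbedding]
    congr 1
    ext x
    simp only [Finset.mem_map, Finset.mem_filter, Finset.mem_univ, true_and,
      Fin.valEmbedding_apply, Finset.mem_Ico]
    constructor
    · rintro ⟨y, hy, rfl⟩
      exact hy
    · intro hx
      exact ⟨⟨x, by omega⟩, hx, rfl⟩
  have hA := hcard 0 (4 * k) (by omega)
  have hB := hcard (4 * k - 1) (8 * k - 1) (by omega)
  have hAB := hcard (4 * k - 1) (4 * k) (by omega)
  set A := Finset.univ.filter fun x : Fin (8 * k + N) => 0 ≤ x.1 ∧ x.1 < 4 * k with hAdef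
  set B := Finset.univ.filter fun x : Fin (8 * k + N) => 4 * k - 1 ≤ x.1 ∧ x.1 < 8 * k - 1
    with hBdef
  have hinter : A ∩ B =
      Finset.univ.filter fun x : Fin (8 * k + N) => 4 * k - 1 ≤ x.1 ∧ x.1 < 4 * k := by
    ext x
    simp only [hAdef, hBdef, Finset.mem_inter, Finset.mem_filter, Finset.mem_univ, true_and]
    omega
  rw [← hinter] at hAB
  refine ⟨8 * k + N, twoCliques A B, by omega, ?_, ?_⟩
  · rw [Int.cast_natCast]
    exact isSparse_twoCliques (by omega) (by omega) (by omega)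
  · rw [Int.cast_natCast]
    exact not_hasSparsePartition_twoCliques (by exact_mod_cast (by omega : 0 ≤ t))
      (by exact_mod_cast hta) (by omega) (by omega) (by omega)
end

section
/- For every positive integer a and every natural number N, there exists a finite simple graph G with at least N vertices such that G is (a+1, −a−2)-sparse, but G admits no edge-partition E(G) = E(G₁) ∪ E(G₂) with G₁ being (1, −1)-sparse and G₂ being (a, −a−1)-sparse. -/
section Transport

variable {V W : Type*} [Fintype V] [Fintype W]

theorem IsSparse.comap {G : SimpleGraph V} {a b : ℝ} (h : IsSparse G a b) (f : W ↪ V) :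
    IsSparse (G.comap f) a b := by
  intro H hH
  let φ : G.comap f →g G := ⟨f, fun h => h⟩
  have hedge : (H.map φ).edgeSet = Sym2.map f '' H.edgeSet := SimpleGraph.Subgraph.edgeSet_map φ H
  have hverts : (H.map φ).verts = f '' H.verts := rfl
  have := h (H.map φ) (by rw [hedge]; exact hH.image _)
  rwa [hedge, hverts, Set.ncard_image_of_injective _ (Sym2.map.injective f.injective),
    Set.ncard_image_of_injective _ f.injective] at this

theorem SimpleGraph.edgeSet_comap_eq_preimage {α β : Type*} (G : SimpleGraph α) (f : β → α) :
    (G.comap f).edgeSet = Sym2.map f ⁻¹' G.edgeSet := by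
  ext e
  induction e with | _ x y => simp

theorem HasSparsePartition.comap {G : SimpleGraph V} {a₁ b₁ a₂ b₂ : ℝ}
    (h : HasSparsePartition G a₁ b₁ a₂ b₂) (f : W ↪ V) :
    HasSparsePartition (G.comap f) a₁ b₁ a₂ b₂ := by
  obtain ⟨G₁, G₂, h₁, h₂, hun, hdis, hs₁, hs₂⟩ := h
  refine ⟨G₁.comap f, G₂.comap f, fun _ _ h => h₁ h, fun _ _ h => h₂ h,
    ?_, ?_, hs₁.comap f, hs₂.comap f⟩
  · simp only [SimpleGraph.edgeSet_comap_eq_preimage, ← Set.preimage_union, hun]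
  · simp only [SimpleGraph.edgeSet_comap_eq_preimage]
    exact hdis.preimage _

theorem IsSparse.ncard_edgeSet_le {G : SimpleGraph V} {a b : ℝ} (h : IsSparse G a b)
    (hpos : 0 ≤ a * Fintype.card V + b) : (G.edgeSet.ncard : ℝ) ≤ a * Fintype.card V + b := by
  rcases G.edgeSet.eq_empty_or_nonempty with h0 | h0
  · simpa [h0] using hpos
  · simpa [Set.ncard_univ] using h ⊤ (by simpa using h0)

theorem IsSparse.card_le_of_subset {G : SimpleGraph V} {a b : ℝ} (h : IsSparse G a b)
    (S : Finset V) (E : Finset (Sym2 V)) (hEG : (E : Set (Sym2 V)) ⊆ G.edgeSet)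
    (hES : ∀ e ∈ E, ∀ v ∈ e, v ∈ S) (hpos : 0 ≤ a * S.card + b) :
    (E.card : ℝ) ≤ a * S.card + b := by
  rcases E.eq_empty_or_nonempty with h0 | ⟨e₀, he₀⟩
  · simpa [h0] using hpos
  · let H : G.Subgraph := (⊤ : G.Subgraph).induce S
    have hsub : (E : Set (Sym2 V)) ⊆ H.edgeSet := by
      intro e he
      have h1 := hEG he
      have h2 := hES e he
      induction e with | _ x y =>
      simp only [Sym2.mem_iff, forall_eq_or_imp, forall_eq] at h2
      exact ⟨h2.1, h2.2, h1⟩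
    have h1 := h H ⟨e₀, hsub he₀⟩
    have h2 : E.card ≤ H.edgeSet.ncard := by
      rw [← Set.ncard_coe_finset]
      exact Set.ncard_le_ncard hsub (Set.toFinite _)
    have h3 : H.verts.ncard = S.card := Set.ncard_coe_finset S
    rw [h3] at h1
    exact le_trans (by exact_mod_cast h2) h1

end Transport

namespace Necklace

open Finset

variable (a k : ℕ)

/-- The vertices of a necklace of `k` beads: bead `i` consists of the `(i, j)` together with
`(i + 1, 0)`, which it shares with the next bead. -/
abbrev Vertex : Type := ZMod k × Fin (2 * a + 1)

variable {a k}

/-- The pair of vertices that bead `i` shares with its neighbours. -/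
def ends (i : ZMod k) : Sym2 (Vertex a k) := s((i, 0), (i + 1, 0))

section Beads

variable [NeZero k]

/-- The vertex set of the `i`-th bead. -/
def bead (i : ZMod k) : Finset (Vertex a k) :=
  insert (i + 1, 0) (univ.filter fun p => p.1 = i)

/-- The edges of the `i`-th bead with both ends in `S`. -/
def beadEdges (S : Finset (Vertex a k)) (i : ZMod k) : Finset (Sym2 (Vertex a k)) :=
  ((S ∩ bead i).offDiag.image Sym2.mk.uncurry).erase (ends i)

theorem mem_bead {i : ZMod k} {p : Vertex a k} : p ∈ bead i ↔ p = (i + 1, 0) ∨ p.1 = i := by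
  simp [bead]

theorem mk_mem_beadEdges {S : Finset (Vertex a k)} {i : ZMod k} {p q : Vertex a k} :
    s(p, q) ∈ beadEdges S i ↔
      s(p, q) ≠ ends i ∧ (p ∈ S ∧ p ∈ bead i) ∧ (q ∈ S ∧ q ∈ bead i) ∧ p ≠ q := by
  simp only [beadEdges, mem_erase, mem_image, mem_offDiag, mem_inter]
  constructor
  · rintro ⟨h, ⟨x, y⟩, hxy, he⟩
    rcases Sym2.eq_iff.1 he with ⟨rfl, rfl⟩ | ⟨rfl, rfl⟩
    · exact ⟨h, hxy⟩
    · exact ⟨h, hxy.2.1, hxy.1, hxy.2.2.symm⟩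
  · rintro ⟨h, hpq⟩
    exact ⟨h, (p, q), hpq, rfl⟩

variable (a k) in
/-- The necklace: `k` copies of the complete graph on `2 * a + 2` vertices minus an edge, glued
cyclically along the ends of the missing edges. -/
def graph : SimpleGraph (Vertex a k) where
  Adj p q := ∃ i, s(p, q) ∈ beadEdges univ i
  symm := ⟨fun p q ⟨i, h⟩ => ⟨i, by rwa [Sym2.eq_swap]⟩⟩
  loopless := ⟨fun p ⟨i, h⟩ => (mk_mem_beadEdges.1 h).2.2.2 rfl⟩

theorem edgeSet_graph : (graph a k).edgeSet =
    ((univ.biUnion (beadEdges univ) : Finset (Sym2 (Vertex a k))) : Set (Sym2 (Vertex a k))) := by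
  ext e
  induction e with | _ x y => simp [graph]

theorem card_inter_bead (hk : 2 ≤ k) (S : Finset (Vertex a k)) (i : ZMod k) :
    #(S ∩ bead i) = #{p ∈ S | p.1 = i} + if (i + 1, 0) ∈ S then 1 else 0 := by
  have : Fact (1 < k) := ⟨hk⟩
  have h : S ∩ bead i = if (i + 1, 0) ∈ S then insert (i + 1, 0) {p ∈ S | p.1 = i}
      else {p ∈ S | p.1 = i} := by
    ext p
    split_ifs with h <;> simp only [mem_inter, mem_bead, mem_insert, mem_filter] <;> grind
  rw [h]
  split_ifs
  · rw [card_insert_of_notMem (by simp)]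
  · rfl

theorem card_bead (hk : 2 ≤ k) (i : ZMod k) : #(bead i : Finset (Vertex a k)) = 2 * a + 2 := by
  have h := card_inter_bead hk (univ : Finset (Vertex a k)) i
  have h2 : #{p : Vertex a k | p.1 = i} = 2 * a + 1 := by
    have : ({p : Vertex a k | p.1 = i} : Finset _) = {i} ×ˢ univ := by
      ext p; simp only [mem_filter, mem_univ, true_and, mem_product, mem_singleton, and_true]
    rw [this, card_product]; simp
  rw [h2] at h
  simpa using h

theorem ends_mem_image_offDiag (hk : 2 ≤ k) (i : ZMod k) :
    (ends i : Sym2 (Vertex a k)) ∈ (bead i).offDiag.image Sym2.mk.uncurry := by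
  have : Fact (1 < k) := ⟨hk⟩
  refine mem_image.2 ⟨((i, 0), (i + 1, 0)), ?_, rfl⟩
  simp [mem_bead]

theorem card_beadEdges_of_bead_subset (hk : 2 ≤ k) {S : Finset (Vertex a k)} {i : ZMod k}
    (h : bead i ⊆ S) : #(beadEdges S i) = (2 * a + 2).choose 2 - 1 := by
  rw [beadEdges, inter_eq_right.2 h, card_erase_of_mem (ends_mem_image_offDiag hk i),
    ← card_bead hk i]
  congr 1
  exact Sym2.card_image_offDiag _

theorem card_beadEdges_le_choose (S : Finset (Vertex a k)) (i : ZMod k) :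
    #(beadEdges S i) ≤ (#(S ∩ bead i)).choose 2 :=
  (card_erase_le).trans_eq (Sym2.card_image_offDiag _)

theorem cast_choose_two_sub_one (a : ℕ) :
    (((2 * a + 2).choose 2 - 1 : ℕ) : ℤ) = (a + 1) * (2 * a + 1) - 1 := by
  have h : (2 * a + 2).choose 2 = (a + 1) * (2 * a + 1) := by
    rw [Nat.choose_two_right]
    apply Nat.div_eq_of_eq_mul_left two_pos
    simp only [Nat.add_one_sub_one]
    ring
  rw [h, Nat.cast_sub (Nat.mul_pos (by omega) (by omega))]
  push_cast
  ring

theorem card_beadEdges_le (ha : 0 < a) (hk : 2 ≤ k) (S : Finset (Vertex a k)) (i : ZMod k)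
    (hS : 2 ≤ #(S ∩ bead i)) :
    (#(beadEdges S i) : ℤ) ≤ (a + 1) * (#(S ∩ bead i) - 1) - 1 := by
  have hle : #(S ∩ bead i) ≤ 2 * a + 2 := by
    rw [← card_bead hk i]
    exact card_le_card inter_subset_right
  rcases hle.eq_or_lt with h | h
  · have hsub : bead i ⊆ S := by
      rw [← inter_eq_right]
      exact eq_of_subset_of_card_le inter_subset_right (by rw [card_bead hk, h])
    rw [card_beadEdges_of_bead_subset hk hsub, h, cast_choose_two_sub_one]
    push_cast
    apply le_of_eq
    ring
  · have h1 := card_beadEdges_le_choose S i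
    generalize #(S ∩ bead i) = u at *
    generalize #(beadEdges S i) = e at *
    have h2 : u.choose 2 * 2 = u * (u - 1) := by
      rw [Nat.choose_two_right, Nat.div_mul_cancel (Nat.even_mul_pred_self u).two_dvd]
    obtain ⟨w, rfl⟩ : ∃ w, u = w + 2 := ⟨u - 2, by omega⟩
    simp only [Nat.add_succ_sub_one] at h2
    have h3 : (e : ℤ) * 2 ≤ (w + 2) * (w + 1) := by
      exact_mod_cast (Nat.mul_le_mul_right 2 h1).trans_eq h2
    obtain ⟨c, hc⟩ : ∃ c, 2 * a = w + 1 + c := ⟨2 * a - (w + 1), by omega⟩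
    have hc' : (2 * a : ℤ) = w + 1 + c := by exact_mod_cast hc
    have ha' : (1 : ℤ) ≤ a := by exact_mod_cast ha
    push_cast
    rcases Nat.eq_zero_or_pos w with rfl | hw
    · push_cast at *
      nlinarith
    · have : (1 : ℤ) ≤ w := by exact_mod_cast hw
      nlinarith [mul_nonneg (Int.natCast_nonneg w) (Int.natCast_nonneg c)]

theorem exists_not_and_succ {P : ZMod k → Prop} {i j : ZMod k} (hi : P i) (hj : ¬ P j) :
    ∃ l, ¬ P l ∧ P (l + 1) := by
  by_contra! h
  have hn : ∀ n : ℕ, ¬ P (j + n) := by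
    intro n
    induction n with
    | zero => simpa using hj
    | succ n ih => simpa [add_assoc] using h _ ih
  apply hn (i - j).val
  simpa using hi

theorem sum_card_beadEdges_le (ha : 0 < a) (hk : a + 2 ≤ k) (S : Finset (Vertex a k))
    {i : ZMod k} (hi : (beadEdges S i).Nonempty) :
    (∑ l, #(beadEdges S l) : ℤ) ≤ (a + 1) * #S - (a + 2) := by
  have hk2 : 2 ≤ k := by omega
  let x : ZMod k → ℤ := fun l => if ((l, 0) : Vertex a k) ∈ S then 1 else 0
  let t : ZMod k → ℤ := fun l => #{p ∈ S | p.1 = l}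
  let f : ZMod k → ℤ := fun l => (a + 1) * (t l + x (l + 1) - x l) - #(beadEdges S l)
  have hu (l) : (#(S ∩ bead l) : ℤ) = t l + x (l + 1) := by
    rw [card_inter_bead hk2]; push_cast; rfl
  have hx (l) : x l = 0 ∨ x l = 1 := by simp only [x]; split_ifs <;> simp
  have hxt (l) : x l ≤ t l := by
    simp only [x, t]
    split_ifs with h
    · have : 0 < #{p ∈ S | p.1 = l} := card_pos.2 ⟨(l, 0), by simp [h]⟩
      exact_mod_cast this
    · positivity
  have hle1 (l) (h : t l + x (l + 1) ≤ 1) : #(beadEdges S l) = 0 := by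
    have h1 : #(S ∩ bead l) ≤ 1 := by
      have := hu l
      omega
    have := card_beadEdges_le_choose S l
    rwa [Nat.choose_eq_zero_of_lt (by omega), Nat.le_zero] at this
  have hle2 (l) (h : 2 ≤ t l + x (l + 1)) : a + 2 - (a + 1) * x l ≤ f l := by
    have := card_beadEdges_le ha hk2 S l (by have := hu l; omega)
    rw [hu l] at this
    simp only [f]
    linarith
  have ha0 : (0 : ℤ) < a := by exact_mod_cast ha
  have hf0 (l) : 0 ≤ f l := by
    rcases le_or_gt (t l + x (l + 1)) 1 with h | h
    · simp only [f, hle1 l h]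
      have h1 := hxt l
      rcases hx (l + 1) with h2 | h2 <;> rw [h2] <;> push_cast <;> nlinarith
    · have := hle2 l h
      rcases hx l with h2 | h2 <;> rw [h2] at this <;> linarith
  have hsum : ∑ l, f l = (a + 1) * #S - ∑ l, (#(beadEdges S l) : ℤ) := by
    have ht : ∑ l, t l = #S := by
      rw [card_eq_sum_card_fiberwise (f := Prod.fst) (t := univ) (by simp)]
      push_cast
      rfl
    have hs : ∑ l, x (l + 1) = ∑ l, x l := Equiv.sum_comp (Equiv.addRight 1) x
    simp only [f, sum_sub_distrib, ← mul_sum, sum_add_distrib, ht, hs]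
    ring
  suffices a + 2 ≤ ∑ l, f l by linarith
  have hti : 2 ≤ t i + x (i + 1) := by
    by_contra! h
    have := hle1 i (by omega)
    rw [card_eq_zero] at this
    simp [this] at hi
  have hfi := hle2 i hti
  rcases hx i with hxi | hxi
  · rw [hxi] at hfi
    have := single_le_sum (fun l _ => hf0 l) (mem_univ i)
    linarith
  · rw [hxi] at hfi
    by_cases hall : ∀ l, x l = 1
    · have h1 : ∑ _l : ZMod k, (1 : ℤ) ≤ ∑ l, f l := by
        refine sum_le_sum fun l _ => ?_
        have := hle2 l (by have := hxt l; rw [hall] at *; omega)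
        rw [hall l] at this
        linarith
      have h2 : (a + 2 : ℤ) ≤ k := by exact_mod_cast hk
      simp only [sum_const, card_univ, ZMod.card, nsmul_eq_mul, mul_one] at h1
      linarith
    · push Not at hall
      obtain ⟨j, hj⟩ := hall
      obtain ⟨l, hl, hl'⟩ := exists_not_and_succ (P := fun l => x l = 1) hxi hj
      have hl0 : x l = 0 := (hx l).resolve_right hl
      have hne : i ≠ l := by rintro rfl; exact hl hxi
      have hfl : a + 1 ≤ f l := by
        rcases le_or_gt (t l + x (l + 1)) 1 with h | h
        · simp only [f, hle1 l h, hl0, hl']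
          have := hxt l
          push_cast
          nlinarith
        · have := hle2 l h
          rw [hl0] at this
          linarith
      have := add_le_sum (fun l _ => hf0 l) (mem_univ i) (mem_univ l) hne
      linarith

theorem isSparse_graph (ha : 0 < a) (hk : a + 2 ≤ k) :
    IsSparse (graph a k) ((a : ℝ) + 1) (-(a : ℝ) - 2) := by
  classical
  intro H ⟨e, he⟩
  let S : Finset (Vertex a k) := H.verts.toFinset
  have hsub : H.edgeSet ⊆
      ((univ.biUnion (beadEdges S) : Finset (Sym2 (Vertex a k))) : Set (Sym2 (Vertex a k))) := by
    intro e he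
    induction e with | _ x y =>
    have hadj : H.Adj x y := he
    obtain ⟨i, hi⟩ := hadj.adj_sub
    rw [mk_mem_beadEdges] at hi
    simp only [coe_biUnion, Set.mem_iUnion, mem_coe, mem_univ, exists_prop, true_and]
    refine ⟨i, mk_mem_beadEdges.2 ⟨hi.1, ⟨?_, hi.2.1.2⟩, ⟨?_, hi.2.2.1.2⟩, hi.2.2.2⟩⟩
    · simpa [S] using hadj.fst_mem
    · simpa [S] using hadj.snd_mem
  obtain ⟨i, -, hi⟩ := mem_biUnion.1 (mem_coe.1 (hsub he))
  have h1 : H.edgeSet.ncard ≤ ∑ l, #(beadEdges S l) := by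
    refine le_trans ?_ card_biUnion_le
    rw [← Set.ncard_coe_finset]
    exact Set.ncard_le_ncard hsub (Set.toFinite _)
  have h2 := sum_card_beadEdges_le ha hk S ⟨e, hi⟩
  have h3 : H.verts.ncard = #S := Set.ncard_eq_toFinset_card' _
  have h4 : (H.edgeSet.ncard : ℤ) ≤ (a + 1) * #S - (a + 2) := le_trans (by exact_mod_cast h1) h2
  have h5 : (H.edgeSet.ncard : ℝ) ≤ (a + 1) * #S - (a + 2) := by exact_mod_cast h4
  rw [h3]
  linarith

theorem disjoint_beadEdges (hk : 3 ≤ k) {i j : ZMod k} (hij : i ≠ j) :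
    Disjoint (beadEdges (univ : Finset (Vertex a k)) i) (beadEdges univ j) := by
  have h2 : (1 + 1 : ZMod k) ≠ 0 := by
    intro h
    have h' : ((2 : ℕ) : ZMod k) = 0 := by push_cast; rw [← h]; ring
    have := Nat.le_of_dvd two_pos ((ZMod.natCast_eq_zero_iff 2 k).1 h')
    omega
  rw [Finset.disjoint_left]
  intro e hi hj
  induction e with | _ x y =>
  rw [mk_mem_beadEdges] at hi hj
  obtain ⟨-, ⟨-, hxi⟩, ⟨-, hyi⟩, hne⟩ := hi
  obtain ⟨-, ⟨-, hxj⟩, ⟨-, hyj⟩, -⟩ := hj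
  rw [mem_bead] at hxi hyi hxj hyj
  grind

theorem not_hasSparsePartition_graph (ha : 0 < a) (hk : 3 ≤ k) :
    ¬ HasSparsePartition (graph a k) 1 (-1) (a : ℝ) (-(a : ℝ) - 1) := by
  classical
  rintro ⟨G₁, G₂, -, -, hun, -, hs₁, hs₂⟩
  have ha1 : (1 : ℝ) ≤ a := by exact_mod_cast ha
  have hk1 : (1 : ℝ) ≤ k := by exact_mod_cast (by omega : 1 ≤ k)
  have hG : (graph a k).edgeSet.ncard = ∑ _i : ZMod k, ((2 * a + 2).choose 2 - 1) := by
    rw [edgeSet_graph, Set.ncard_coe_finset,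
      card_biUnion fun i _ j _ hij => disjoint_beadEdges hk hij]
    exact sum_congr rfl fun i _ => card_beadEdges_of_bead_subset (by omega) (subset_univ _)
  have h2 (i : ZMod k) : (#{e ∈ beadEdges univ i | e ∈ G₂.edgeSet} : ℝ) ≤
      a * (2 * a + 2) + (-a - 1) := by
    have hc := card_bead (a := a) (by omega : 2 ≤ k) i
    have := hs₂.card_le_of_subset (bead i) {e ∈ beadEdges univ i | e ∈ G₂.edgeSet}
      (fun e he => (mem_filter.1 (mem_coe.1 he)).2) ?_ (by rw [hc]; push_cast; nlinarith)
    · rw [hc] at this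
      exact_mod_cast this
    · intro e he
      have he := (mem_filter.1 he).1
      induction e with | _ x y =>
      rw [mk_mem_beadEdges] at he
      simp [he.2.1.2, he.2.2.1.2]
  have h2' : (G₂.edgeSet.ncard : ℝ) ≤ k * (a * (2 * a + 2) + (-a - 1)) := by
    have hsub : G₂.edgeSet ⊆
        ((univ.biUnion fun i => {e ∈ beadEdges univ i | e ∈ G₂.edgeSet} :
          Finset (Sym2 (Vertex a k))) : Set (Sym2 (Vertex a k))) := by
      intro e he
      have : e ∈ (graph a k).edgeSet := hun ▸ Or.inr he
      rw [edgeSet_graph] at this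
      simpa [he] using this
    have h3 := (Set.ncard_le_ncard hsub (Set.toFinite _)).trans
      ((Set.ncard_coe_finset _).le.trans card_biUnion_le)
    calc (G₂.edgeSet.ncard : ℝ)
        ≤ ∑ i : ZMod k, (#{e ∈ beadEdges univ i | e ∈ G₂.edgeSet} : ℝ) := by exact_mod_cast h3
      _ ≤ ∑ _i : ZMod k, ((a * (2 * a + 2) + (-a - 1)) : ℝ) := sum_le_sum fun i _ => h2 i
      _ = _ := by rw [sum_const, card_univ, ZMod.card, nsmul_eq_mul]
  have hcard : (Fintype.card (Vertex a k) : ℝ) = k * (2 * a + 1) := by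
    simp [Vertex, ZMod.card]
  have h1 := hs₁.ncard_edgeSet_le (by rw [hcard]; nlinarith)
  rw [hcard] at h1
  have hle : (graph a k).edgeSet.ncard ≤ G₁.edgeSet.ncard + G₂.edgeSet.ncard := by
    rw [← hun]
    exact Set.ncard_union_le _ _
  have hle' : ((graph a k).edgeSet.ncard : ℝ) ≤ G₁.edgeSet.ncard + G₂.edgeSet.ncard := by
    exact_mod_cast hle
  have hch : (((2 * a + 2).choose 2 - 1 : ℕ) : ℝ) = (a + 1) * (2 * a + 1) - 1 := by
    exact_mod_cast cast_choose_two_sub_one a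
  rw [hG, sum_const, card_univ, ZMod.card, smul_eq_mul, Nat.cast_mul, hch] at hle'
  nlinarith

end Beads

end Necklace

theorem stmt5 (a : ℤ) (ha : 0 < a) (N : ℕ) :
    ∃ (n : ℕ) (G : SimpleGraph (Fin n)), N ≤ n ∧
      IsSparse G ((a : ℝ) + 1) (-(a : ℝ) - 2) ∧
      ¬ HasSparsePartition G 1 (-1) (a : ℝ) (-(a : ℝ) - 1) := by
  lift a to ℕ using ha.le
  have ha' : 0 < a := by exact_mod_cast ha
  let k := N + a + 2
  have : NeZero k := ⟨by omega⟩
  let f : Fin (Fintype.card (Necklace.Vertex a k)) ≃ Necklace.Vertex a k :=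
    (Fintype.equivFin _).symm
  refine ⟨_, (Necklace.graph a k).comap f, ?_, ?_, ?_⟩
  · have h : Fintype.card (Necklace.Vertex a k) = k * (2 * a + 1) := by
      simp [Necklace.Vertex, ZMod.card]
    rw [h]
    exact (by omega : N ≤ k).trans (Nat.le_mul_of_pos_right k (by omega))
  · simpa using (Necklace.isSparse_graph (a := a) (k := k) ha' (by omega)).comap f.toEmbedding
  · intro h
    refine Necklace.not_hasSparsePartition_graph (a := a) (k := k) ha' (by omega) ?_
    have hG : ((Necklace.graph a k).comap f).comap f.symm.toEmbedding = Necklace.graph a k := by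
      ext x y
      simp
    rw [← hG]
    simpa using h.comap f.symm.toEmbedding
end

section
/- Let k be a positive integer and ε ∈ [0,1) be real. If a finite simple graph G is (k+ε, 0)-sparse, then G is (k+1, −f(k,ε))-sparse. -/
/-- The function `f(k,ε)` from the paper: `f(k,ε) = 2k` if `ε(2k+2) < 2`;
`⌈(2k+2)(1−ε)⌉` if `2/(2k+2) ≤ ε < 1/2`; `k+1` if `1/2 ≤ ε < (k+2)/(2k+3)`;
and `⌈(2k+3)(1−ε)⌉` if `ε ≥ (k+2)/(2k+3)`. -/
noncomputable def fFun (k : ℕ) (ε : ℝ) : ℝ :=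
  if ε * (2 * (k : ℝ) + 2) < 2 then 2 * (k : ℝ)
  else if ε < 1 / 2 then ((⌈(2 * (k : ℝ) + 2) * (1 - ε)⌉ : ℤ) : ℝ)
  else if ε < ((k : ℝ) + 2) / (2 * (k : ℝ) + 3) then (k : ℝ) + 1
  else ((⌈(2 * (k : ℝ) + 3) * (1 - ε)⌉ : ℤ) : ℝ)

theorem SimpleGraph.Subgraph.ncard_edgeSet_le_choose_two {V : Type*} [Finite V]
    {G : SimpleGraph V} (H : G.Subgraph) : H.edgeSet.ncard ≤ H.verts.ncard.choose 2 := by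
  classical
  have hfin : H.verts.Finite := Set.toFinite _
  rw [Set.ncard_eq_toFinset_card _ hfin, ← Sym2.card_image_offDiag, ← Set.ncard_coe_finset]
  refine Set.ncard_le_ncard (fun e he => ?_) (Set.toFinite _)
  induction e using Sym2.ind with
  | _ x y =>
    have hxy : H.Adj x y := he
    simp only [Finset.coe_image, Set.mem_image, Finset.mem_coe, Finset.mem_offDiag,
      Set.Finite.mem_toFinset]
    exact ⟨(x, y), ⟨hxy.fst_mem, hxy.snd_mem, hxy.ne⟩, rfl⟩

theorem le_sub_ceil_of_le_of_le {k n e m : ℕ} {ε : ℝ} (hε1 : ε ≤ 1) (hmn : m ≤ n)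
    (he : (e : ℝ) ≤ (k + ε) * n) :
    (e : ℝ) ≤ (k + 1) * n - (⌈(m : ℝ) * (1 - ε)⌉ : ℤ) := by
  have hmn' : (m : ℝ) ≤ n := by exact_mod_cast hmn
  have hceil : ⌈(m : ℝ) * (1 - ε)⌉ ≤ ((k : ℤ) + 1) * n - e := by
    rw [Int.ceil_le]
    push_cast
    nlinarith
  have hcast : ((⌈(m : ℝ) * (1 - ε)⌉ : ℤ) : ℝ) ≤ ((k : ℝ) + 1) * n - e := by
    exact_mod_cast hceil
  linarith

theorem le_sub_two_mul_of_le_choose_two {k n e : ℕ} (hn2 : 2 ≤ n) (hn : n ≤ 2 * k + 1)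
    (he : (e : ℝ) ≤ n * (n - 1) / 2) : (e : ℝ) ≤ (k + 1) * n - 2 * k := by
  have h1 : (2 : ℝ) ≤ n := by exact_mod_cast hn2
  have h2 : (n : ℝ) ≤ 2 * k + 1 := by exact_mod_cast hn
  nlinarith [mul_nonneg (sub_nonneg.2 h1) (sub_nonneg.2 h2)]

theorem le_sub_succ_of_le_choose_two {k n e : ℕ} (hn1 : 1 ≤ n) (hn : n ≤ 2 * k + 2)
    (he : (e : ℝ) ≤ n * (n - 1) / 2) : (e : ℝ) ≤ (k + 1) * n - (k + 1) := by
  have h1 : (1 : ℝ) ≤ n := by exact_mod_cast hn1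
  have h2 : (n : ℝ) ≤ 2 * k + 2 := by exact_mod_cast hn
  nlinarith [mul_nonneg (sub_nonneg.2 h1) (sub_nonneg.2 h2)]

theorem le_sub_fFun {k n e : ℕ} {ε : ℝ} (hε1 : ε < 1) (hn2 : 2 ≤ n)
    (hchoose : (e : ℝ) ≤ n * (n - 1) / 2) (he : (e : ℝ) ≤ (k + ε) * n) :
    (e : ℝ) ≤ (k + 1) * n - fFun k ε := by
  have hk0 : (0 : ℝ) ≤ k := k.cast_nonneg
  unfold fFun
  split_ifs with h1 h2 h3
  · rcases Nat.lt_or_ge n (2 * k + 2) with hn | hn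
    · exact le_sub_two_mul_of_le_choose_two hn2 (by lia) hchoose
    · have hn' : (2 * k + 2 : ℝ) ≤ n := by exact_mod_cast hn
      have h4 : ε * (k + 1) < 1 := by linarith
      have h5 : 0 ≤ (1 - ε * (k + 1)) * n := mul_nonneg (by linarith) n.cast_nonneg
      have h6 : 0 ≤ (k + 1 : ℝ) * (n - 2 * k - ε * n) := by nlinarith
      have h7 := nonneg_of_mul_nonneg_right h6 (by positivity)
      linarith
  · rcases Nat.lt_or_ge n (2 * k + 2) with hn | hn
    · have hceil : ⌈(2 * (k : ℝ) + 2) * (1 - ε)⌉ ≤ 2 * (k : ℤ) := by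
        rw [Int.ceil_le]
        push_cast
        linarith
      have hcast : ((⌈(2 * (k : ℝ) + 2) * (1 - ε)⌉ : ℤ) : ℝ) ≤ 2 * (k : ℝ) := by
        exact_mod_cast hceil
      linarith [le_sub_two_mul_of_le_choose_two hn2 (by lia : n ≤ 2 * k + 1) hchoose]
    · simpa using le_sub_ceil_of_le_of_le hε1.le hn he
  · rcases Nat.lt_or_ge n (2 * k + 3) with hn | hn
    · exact le_sub_succ_of_le_choose_two (by lia) (by lia) hchoose
    · have hn' : (2 * k + 3 : ℝ) ≤ n := by exact_mod_cast hn
      rw [lt_div_iff₀ (by positivity)] at h3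
      nlinarith
  · rcases Nat.lt_or_ge n (2 * k + 3) with hn | hn
    · rw [not_lt, div_le_iff₀ (by positivity)] at h3
      have hceil : ⌈(2 * (k : ℝ) + 3) * (1 - ε)⌉ ≤ (k : ℤ) + 1 := by
        rw [Int.ceil_le]
        push_cast
        linarith
      have hcast : ((⌈(2 * (k : ℝ) + 3) * (1 - ε)⌉ : ℤ) : ℝ) ≤ (k : ℝ) + 1 := by
        exact_mod_cast hceil
      linarith [le_sub_succ_of_le_choose_two (by lia : 1 ≤ n) (by lia : n ≤ 2 * k + 2) hchoose]
    · simpa using le_sub_ceil_of_le_of_le hε1.le hn he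

theorem stmt6 (k : ℕ) (hk : 0 < k) (ε : ℝ) (hε0 : 0 ≤ ε) (hε1 : ε < 1)
    {V : Type*} [Fintype V] (G : SimpleGraph V)
    (hG : IsSparse G ((k : ℝ) + ε) 0) :
    IsSparse G ((k : ℝ) + 1) (-(fFun k ε)) := by
  intro H hH
  have hchoose := H.ncard_edgeSet_le_choose_two
  have hn2 : 2 ≤ H.verts.ncard := by
    by_contra! hlt
    rw [Nat.choose_eq_zero_of_lt hlt] at hchoose
    have := (Set.ncard_pos (Set.toFinite _)).2 hH
    lia
  have hchoose' : (H.edgeSet.ncard : ℝ) ≤ H.verts.ncard * (H.verts.ncard - 1) / 2 := by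
    rw [← Nat.cast_choose_two]
    exact_mod_cast hchoose
  have he := hG H hH
  rw [add_zero] at he
  rw [← sub_eq_add_neg]
  exact le_sub_fFun hε1 hn2 hchoose' he
end

section
/- Let 𝓗 be a hypergraph with hyperedges F₁, F₂, …, F_r (finite sets) whose union F₁ ∪ ⋯ ∪ F_r has exactly n elements, and let s ≥ 0 be a real number. If for each index i we have |F_i ∩ ⋃_{j ≠ i} F_j| ≥ s, then Σᵢ |F_i| ≥ n + r·s/2. -/
/-- The vertices of a finite family of finite sets, together with half of the incidences at
vertices lying in at least two members, are at most as many as the incidences. -/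
theorem Finset.two_mul_card_biUnion_add_sum_card_inter_le {ι α : Type*} [Fintype ι]
    [DecidableEq ι] [DecidableEq α] (F : ι → Finset α) :
    2 * (Finset.univ.biUnion F).card
        + ∑ i, (F i ∩ (Finset.univ.erase i).biUnion F).card
      ≤ 2 * ∑ i, (F i).card := by
  set U := Finset.univ.biUnion F with hU
  have card_eq (A : Finset α) (hA : A ⊆ U) : A.card = ∑ v ∈ U, if v ∈ A then 1 else 0 := by
    rw [Finset.sum_ite_mem, Finset.inter_eq_right.2 hA, Finset.card_eq_sum_ones]
  have hF (i : ι) : F i ⊆ U := Finset.subset_biUnion_of_mem F (Finset.mem_univ i)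
  rw [Finset.sum_congr rfl fun i _ => card_eq _ (Finset.inter_subset_left.trans (hF i)),
    Finset.sum_congr rfl fun i _ => card_eq _ (hF i), Finset.sum_comm,
    Finset.sum_comm (s := Finset.univ), Finset.card_eq_sum_ones, Finset.mul_sum, Finset.mul_sum,
    ← Finset.sum_add_distrib]
  refine Finset.sum_le_sum fun v hv => ?_
  obtain ⟨i, -, hi⟩ := Finset.mem_biUnion.1 hv
  by_cases hv' : ∃ j, j ≠ i ∧ v ∈ F j
  · obtain ⟨j, hji, hj⟩ := hv'
    have hle : (∑ k, if v ∈ F k ∩ (Finset.univ.erase k).biUnion F then 1 else 0)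
        ≤ ∑ k, if v ∈ F k then 1 else 0 :=
      Finset.sum_le_sum fun k _ => by
        split_ifs with h₁ h₂ <;> simp_all
    have htwo : 2 ≤ ∑ k, if v ∈ F k then 1 else 0 := by
      rw [← Finset.card_filter]
      exact Finset.one_lt_card.2 ⟨i, by simpa using hi, j, by simpa using hj, hji.symm⟩
    omega
  · push Not at hv'
    have hzero : (∑ k, if v ∈ F k ∩ (Finset.univ.erase k).biUnion F then 1 else 0) = 0 := by
      refine Finset.sum_eq_zero fun k _ => if_neg fun hk => ?_
      simp only [Finset.mem_inter, Finset.mem_biUnion, Finset.mem_erase] at hk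
      grind
    have hone : 1 ≤ ∑ k, if v ∈ F k then 1 else 0 := by
      rw [← Finset.card_filter]
      exact Finset.card_pos.2 ⟨i, by simpa using hi⟩
    omega

theorem stmt7 {α : Type*} [DecidableEq α] (r : ℕ) (F : Fin r → Finset α)
    (n : ℕ) (hn : (Finset.univ.biUnion F).card = n)
    (s : ℝ) (hs : 0 ≤ s)
    (h : ∀ i : Fin r, s ≤ (((F i) ∩ ((Finset.univ.erase i).biUnion F)).card : ℝ)) :
    (n : ℝ) + (r : ℝ) * s / 2 ≤ ∑ i : Fin r, ((F i).card : ℝ) := by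
  have hcount := Finset.two_mul_card_biUnion_add_sum_card_inter_le F
  rw [hn] at hcount
  have hcount' : 2 * (n : ℝ) + ∑ i, ((F i ∩ (Finset.univ.erase i).biUnion F).card : ℝ)
      ≤ 2 * ∑ i, ((F i).card : ℝ) := by exact_mod_cast hcount
  have hsum : (r : ℝ) * s ≤ ∑ i, ((F i ∩ (Finset.univ.erase i).biUnion F).card : ℝ) := by
    simpa using Finset.sum_le_sum fun i (_ : i ∈ Finset.univ) => h i
  linarith
end

section
/- Let k be a positive integer and ε ∈ [0,1) be real. Then every (k+ε, 0)-sparse finite simple graph G admits an edge-partition E(G) = E(F) ∪ E(G′) such that F is (1,−1)-sparse (i.e., a forest) and G′ is (k, 1−f(k,ε))-sparse. -/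
section Rank
variable {α : Type*}

/-- `I` is independent with respect to `g` if every nonempty `J ⊆ I` has at most `g J` elements. -/
def CountIndep (g : Finset α → ℤ) (I : Finset α) : Prop :=
  ∀ J ⊆ I, J.Nonempty → (J.card : ℤ) ≤ g J

/-- A monotone, intersecting submodular set function which is positive on singletons. -/
structure IsCountFun [DecidableEq α] (g : Finset α → ℤ) : Prop where
  mono : ∀ ⦃A B⦄, A ⊆ B → g A ≤ g B
  submod : ∀ A B, (A ∩ B).Nonempty → g (A ∪ B) + g (A ∩ B) ≤ g A + g B
  one_le_singleton : ∀ e, 1 ≤ g {e}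

open Classical in
/-- The largest size of an independent subset of `A`. -/
noncomputable def countRank (g : Finset α → ℤ) (A : Finset α) : ℕ :=
  (A.powerset.filter (CountIndep g)).sup Finset.card

variable {g : Finset α → ℤ}

theorem CountIndep.subset {I J : Finset α} (hI : CountIndep g I) (h : J ⊆ I) : CountIndep g J :=
  fun K hK => hI K (hK.trans h)

theorem CountIndep.empty : CountIndep g ∅ := fun J hJ hne => by
  simp [Finset.subset_empty.1 hJ] at hne

theorem CountIndep.card_le_countRank {I A : Finset α} (hI : CountIndep g I) (h : I ⊆ A) :
    I.card ≤ countRank g A := by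
  classical
  exact Finset.le_sup (f := Finset.card) (by simp [h, hI])

theorem exists_card_eq_countRank (g : Finset α → ℤ) (A : Finset α) :
    ∃ I ⊆ A, CountIndep g I ∧ I.card = countRank g A := by
  classical
  obtain ⟨I, hI, h⟩ := Finset.exists_mem_eq_sup (A.powerset.filter (CountIndep g))
    ⟨∅, by simp [CountIndep.empty]⟩ Finset.card
  simp only [Finset.mem_filter, Finset.mem_powerset] at hI
  exact ⟨I, hI.1, hI.2, h.symm⟩

theorem countRank_mono {A B : Finset α} (h : A ⊆ B) : countRank g A ≤ countRank g B := by
  obtain ⟨I, hIA, hI, hc⟩ := exists_card_eq_countRank g A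
  exact hc ▸ hI.card_le_countRank (hIA.trans h)

theorem countRank_empty : countRank g ∅ = 0 := by
  obtain ⟨I, hIA, -, hc⟩ := exists_card_eq_countRank g ∅
  simp [← hc, Finset.subset_empty.1 hIA]

theorem countIndep_of_card_le_countRank {A : Finset α} (h : A.card ≤ countRank g A) :
    CountIndep g A := by
  obtain ⟨I, hIA, hI, hc⟩ := exists_card_eq_countRank g A
  rwa [← Finset.eq_of_subset_of_card_le hIA (hc ▸ h)]

theorem CountIndep.exists_maximal {I A : Finset α} (hI : CountIndep g I) (h : I ⊆ A) :
    ∃ M, I ⊆ M ∧ Maximal (fun J => J ⊆ A ∧ CountIndep g J) M := by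
  have hfin : {J | J ⊆ A ∧ CountIndep g J}.Finite :=
    A.powerset.finite_toSet.subset fun J hJ => by simpa using hJ.1
  exact hfin.exists_le_maximal ⟨h, hI⟩

namespace IsCountFun

variable [DecidableEq α]

theorem one_le (hg : IsCountFun g) {A : Finset α} (hA : A.Nonempty) : 1 ≤ g A := by
  obtain ⟨e, he⟩ := hA
  exact (hg.one_le_singleton e).trans (hg.mono (by simpa using he))

/-- The easy half of the rank formula. -/
theorem card_le_of_cover (hg : IsCountFun g)
    {ι : Type*} {I A : Finset α} (hI : CountIndep g I) (hIA : I ⊆ A)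
    (s : Finset ι) (S : ι → Finset α) (hS : ∀ i ∈ s, (S i).Nonempty) :
    (I.card : ℤ) ≤ (A \ s.biUnion S).card + ∑ i ∈ s, g (S i) := by
  have h1 : I ⊆ (A \ s.biUnion S) ∪ s.biUnion fun i => I ∩ S i := by
    intro e he
    by_cases h : e ∈ s.biUnion S
    · obtain ⟨i, hi, hei⟩ := Finset.mem_biUnion.1 h
      exact Finset.mem_union_right _ (Finset.mem_biUnion.2 ⟨i, hi, by simp [he, hei]⟩)
    · exact Finset.mem_union_left _ (Finset.mem_sdiff.2 ⟨hIA he, h⟩)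
  have h2 : I.card ≤ (A \ s.biUnion S).card + ∑ i ∈ s, (I ∩ S i).card :=
    (Finset.card_le_card h1).trans ((Finset.card_union_le _ _).trans
      (Nat.add_le_add_left Finset.card_biUnion_le _))
  have h3 : ∑ i ∈ s, ((I ∩ S i).card : ℤ) ≤ ∑ i ∈ s, g (S i) := by
    refine Finset.sum_le_sum fun i hi => ?_
    rcases (I ∩ S i).eq_empty_or_nonempty with h | h
    · rw [h]; simpa using zero_le_one.trans (hg.one_le (hS i hi))
    · exact (hI _ Finset.inter_subset_left h).trans (hg.mono Finset.inter_subset_right)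
  have h4 : (I.card : ℤ) ≤ (A \ s.biUnion S).card + ∑ i ∈ s, ((I ∩ S i).card : ℤ) := by
    exact_mod_cast h2
  linarith

/-- The hard half of the rank formula: a maximal independent subset `I` of `A` comes with
disjoint subsets of `A` certifying that no independent subset of `A` is larger. -/
theorem exists_family_of_maximal (hg : IsCountFun g) {I A : Finset α}
    (hI : Maximal (fun J => J ⊆ A ∧ CountIndep g J) I) :
    ∃ (s : Finset (Finset α)) (S : Finset α → Finset α),
      (∀ i ∈ s, (S i).Nonempty ∧ S i ⊆ A) ∧
      (∀ i ∈ s, ∀ j ∈ s, i ≠ j → Disjoint (S i) (S j)) ∧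
      ((A \ s.biUnion S).card : ℤ) + ∑ i ∈ s, g (S i) ≤ I.card := by
  classical
  obtain ⟨⟨hIA, hind⟩, hmax⟩ := hI
  set tight : Finset α → Prop := fun T => T ⊆ I ∧ T.Nonempty ∧ g T = T.card with htight
  set s : Finset (Finset α) := I.powerset.filter (Maximal tight) with hs
  set S : Finset α → Finset α := fun T => A.filter fun e => g (insert e T) ≤ g T with hS
  have mem_s : ∀ {T}, T ∈ s ↔ Maximal tight T := fun {T} => by
    simp only [hs, Finset.mem_filter, Finset.mem_powerset, and_iff_right_iff_imp]
    exact fun h => h.prop.1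
  have sub_S : ∀ {T}, T ∈ s → T ⊆ S T := fun {T} hT e he => by
    simp only [hS, Finset.mem_filter]
    exact ⟨hIA ((mem_s.1 hT).prop.1 he), by rw [Finset.insert_eq_of_mem he]⟩
  have tight_union : ∀ {T T'}, tight T → tight T' → (T ∩ T').Nonempty → tight (T ∪ T') := by
    intro T T' hT hT' hne
    have hsub := Finset.union_subset hT.1 hT'.1
    refine ⟨hsub, hT.2.1.mono Finset.subset_union_left, le_antisymm ?_ ?_⟩
    · have h1 := hg.submod T T' hne
      have h2 := hind (T ∩ T') (Finset.inter_subset_left.trans hT.1) hne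
      have h3 := Finset.card_union_add_card_inter T T'
      have h4 := hT.2.2
      have h5 := hT'.2.2
      omega
    · exact hind _ hsub (hT.2.1.mono Finset.subset_union_left)
  have disj : ∀ T ∈ s, ∀ T' ∈ s, T ≠ T' → Disjoint T T' := by
    intro T hT T' hT' hne
    by_contra h
    rw [Finset.disjoint_iff_inter_eq_empty, ← ne_eq, ← Finset.nonempty_iff_ne_empty] at h
    have hu := tight_union (mem_s.1 hT).prop (mem_s.1 hT').prop h
    exact hne (((mem_s.1 hT).eq_of_le hu Finset.subset_union_left).trans
      ((mem_s.1 hT').eq_of_le hu Finset.subset_union_right).symm)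
  have disjS : ∀ T ∈ s, ∀ T' ∈ s, T ≠ T' → Disjoint (S T) (S T') := by
    intro T hT T' hT' hne
    rw [Finset.disjoint_left]
    intro e he he'
    simp only [hS, Finset.mem_filter] at he he'
    have hmem : e ∈ insert e T ∩ insert e T' := by simp
    have h1 := hg.submod (insert e T) (insert e T') ⟨e, hmem⟩
    have h2 := hg.one_le ⟨e, hmem⟩
    have h3 := hind (T ∪ T') (Finset.union_subset (mem_s.1 hT).prop.1 (mem_s.1 hT').prop.1)
      ((mem_s.1 hT).prop.2.1.mono Finset.subset_union_left)
    have h4 : g (T ∪ T') ≤ g (insert e T ∪ insert e T') := hg.mono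
      (Finset.union_subset_union (Finset.subset_insert _ _) (Finset.subset_insert _ _))
    have h5 := Finset.card_union_of_disjoint (disj T hT T' hT' hne)
    have h6 := (mem_s.1 hT).prop.2.2
    have h7 := (mem_s.1 hT').prop.2.2
    have h8 := he.2
    have h9 := he'.2
    omega
  have g_S : ∀ T ∈ s, g (S T) ≤ T.card := by
    intro T hT
    rw [← (mem_s.1 hT).prop.2.2]
    have key : ∀ F : Finset α, F ⊆ S T → g (T ∪ F) ≤ g T := by
      intro F
      induction F using Finset.induction_on with
      | empty => simp
      | insert e F _ ih =>
        intro hF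
        have h1 := ih ((Finset.subset_insert _ _).trans hF)
        have h2 : g (insert e T) ≤ g T := by
          have := hF (Finset.mem_insert_self e F)
          simp only [hS, Finset.mem_filter] at this
          exact this.2
        have hsub : T ⊆ (T ∪ F) ∩ insert e T :=
          Finset.subset_inter Finset.subset_union_left (Finset.subset_insert _ _)
        have h3 := hg.submod (T ∪ F) (insert e T) ((mem_s.1 hT).prop.2.1.mono hsub)
        have h4 := hg.mono hsub
        have h5 : (T ∪ F) ∪ insert e T = T ∪ insert e F := by
          ext x; simp only [Finset.mem_union, Finset.mem_insert]; tauto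
        rw [h5] at h3
        omega
    exact (hg.mono Finset.subset_union_right).trans (key _ subset_rfl)
  have cover : A \ s.biUnion S ⊆ I := by
    intro e he
    rw [Finset.mem_sdiff] at he
    by_contra heI
    apply he.2
    have hdep : ¬ CountIndep g (insert e I) := fun h =>
      heI (hmax ⟨Finset.insert_subset he.1 hIA, h⟩ (Finset.subset_insert e I)
        (Finset.mem_insert_self e I))
    simp only [CountIndep, not_forall, not_le] at hdep
    obtain ⟨J, hJI, hJne, hJ⟩ := hdep
    have heJ : e ∈ J := by
      by_contra h
      have := hind J ((Finset.subset_insert_iff_of_notMem h).1 hJI) hJne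
      omega
    have hsub : J.erase e ⊆ I := Finset.subset_insert_iff.1 hJI
    have hcard := Finset.card_erase_add_one heJ
    have hne : (J.erase e).Nonempty := by
      rw [Finset.nonempty_iff_ne_empty]
      intro h
      have h1 := hg.one_le hJne
      rw [h] at hcard
      simp at hcard
      omega
    have h1 := hind _ hsub hne
    have h2 := hg.mono (Finset.erase_subset e J)
    have ht : tight (J.erase e) := ⟨hsub, hne, by omega⟩
    have hfin : {T | tight T}.Finite :=
      I.powerset.finite_toSet.subset fun T hT => by simpa using hT.1
    obtain ⟨T, hJT, hT⟩ := hfin.exists_le_maximal ht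
    refine Finset.mem_biUnion.2 ⟨T, mem_s.2 hT, Finset.mem_filter.2 ⟨he.1, ?_⟩⟩
    have hsub' : J.erase e ⊆ T ∩ J := Finset.subset_inter hJT (Finset.erase_subset _ _)
    have h3 := hg.submod T J (hne.mono hsub')
    have h4 := hg.mono hsub'
    have h5 : g (insert e T) ≤ g (T ∪ J) := hg.mono
      (Finset.insert_subset (Finset.mem_union_right _ heJ) Finset.subset_union_left)
    omega
  refine ⟨s, S, fun T hT => ⟨(mem_s.1 hT).prop.2.1.mono (sub_S hT), Finset.filter_subset _ _⟩,
    disjS, ?_⟩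
  have h1 : (A \ s.biUnion S) ∪ s.biUnion id ⊆ I := Finset.union_subset cover
    (Finset.biUnion_subset.2 fun T hT => (mem_s.1 hT).prop.1)
  have h2 : Disjoint (A \ s.biUnion S) (s.biUnion id) :=
    Finset.sdiff_disjoint.mono_right (Finset.biUnion_mono fun T hT => sub_S hT)
  have h3 := Finset.card_le_card h1
  rw [Finset.card_union_of_disjoint h2, Finset.card_biUnion (t := id) disj] at h3
  have h4 : ∑ T ∈ s, g (S T) ≤ ∑ T ∈ s, (T.card : ℤ) := Finset.sum_le_sum g_S
  have h5 : ((A \ s.biUnion S).card : ℤ) + ∑ T ∈ s, (T.card : ℤ) ≤ I.card := by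
    exact_mod_cast h3
  linarith

theorem countRank_le_of_cover (hg : IsCountFun g)
    {ι : Type*} (A : Finset α)
    (s : Finset ι) (S : ι → Finset α) (hS : ∀ i ∈ s, (S i).Nonempty) :
    (countRank g A : ℤ) ≤ (A \ s.biUnion S).card + ∑ i ∈ s, g (S i) := by
  obtain ⟨I, hIA, hI, hc⟩ := exists_card_eq_countRank g A
  rw [← hc]
  exact hg.card_le_of_cover hI hIA s S hS

theorem card_of_maximal (hg : IsCountFun g) {I A : Finset α}
    (hI : Maximal (fun J => J ⊆ A ∧ CountIndep g J) I) : I.card = countRank g A := by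
  refine le_antisymm (hI.prop.2.card_le_countRank hI.prop.1) ?_
  obtain ⟨s, S, hS, -, hle⟩ := hg.exists_family_of_maximal hI
  have := hg.countRank_le_of_cover A s S fun i hi => (hS i hi).1
  omega

theorem exists_family (hg : IsCountFun g) (A : Finset α) :
    ∃ (s : Finset (Finset α)) (S : Finset α → Finset α),
      (∀ i ∈ s, (S i).Nonempty ∧ S i ⊆ A) ∧
      (∀ i ∈ s, ∀ j ∈ s, i ≠ j → Disjoint (S i) (S j)) ∧
      ((A \ s.biUnion S).card : ℤ) + ∑ i ∈ s, g (S i) ≤ countRank g A := by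
  obtain ⟨I, -, hI⟩ := (CountIndep.empty (g := g)).exists_maximal (Finset.empty_subset A)
  rw [← hg.card_of_maximal hI]
  exact hg.exists_family_of_maximal hI

theorem countRank_submod (hg : IsCountFun g) (A B : Finset α) :
    countRank g (A ∪ B) + countRank g (A ∩ B) ≤ countRank g A + countRank g B := by
  obtain ⟨I, hIA, hI, hc⟩ := exists_card_eq_countRank g (A ∩ B)
  obtain ⟨J, hIJ, hJ⟩ := hI.exists_maximal
    (hIA.trans (Finset.inter_subset_left.trans (Finset.subset_union_left (s₂ := B))))
  have h1 := (hJ.prop.2.subset (J := J ∩ A) Finset.inter_subset_left).card_le_countRank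
    Finset.inter_subset_right
  have h2 := (hJ.prop.2.subset (J := J ∩ B) Finset.inter_subset_left).card_le_countRank
    Finset.inter_subset_right
  have h3 := Finset.card_union_add_card_inter (J ∩ A) (J ∩ B)
  have h4 : J ∩ A ∪ J ∩ B = J := by
    rw [← Finset.inter_union_distrib_left]
    exact Finset.inter_eq_left.2 hJ.prop.1
  have h5 : I.card ≤ ((J ∩ A) ∩ (J ∩ B)).card := Finset.card_le_card fun x hx => by
    have hx' := Finset.mem_inter.1 (hIA hx)
    simp [hIJ hx, hx'.1, hx'.2]
  rw [h4] at h3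
  rw [← hc, ← hg.card_of_maximal hJ]
  omega

end IsCountFun

/-- Splitting a set between two submodular functions whose sum dominates cardinality. -/
theorem exists_partition_of_card_le_add [DecidableEq α] (E : Finset α) :
    ∀ h₁ h₂ : Finset α → ℤ, h₁ ∅ = 0 → h₂ ∅ = 0 →
      (∀ A B, h₁ (A ∪ B) + h₁ (A ∩ B) ≤ h₁ A + h₁ B) →
      (∀ A B, h₂ (A ∪ B) + h₂ (A ∩ B) ≤ h₂ A + h₂ B) →
      (∀ A ⊆ E, (A.card : ℤ) ≤ h₁ A + h₂ A) →
      ∃ I₁ I₂, Disjoint I₁ I₂ ∧ I₁ ∪ I₂ = E ∧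
        (∀ J ⊆ I₁, (J.card : ℤ) ≤ h₁ J) ∧ ∀ J ⊆ I₂, (J.card : ℤ) ≤ h₂ J := by
  have contract_submod : ∀ (e : α) (h : Finset α → ℤ),
      (∀ A B, h (A ∪ B) + h (A ∩ B) ≤ h A + h B) → ∀ A B,
      min (h (A ∪ B)) (h (insert e (A ∪ B)) - 1) + min (h (A ∩ B)) (h (insert e (A ∩ B)) - 1) ≤
        min (h A) (h (insert e A) - 1) + min (h B) (h (insert e B) - 1) := by
    intro e h hs A B
    have h1 := hs A B
    have h2 := hs (insert e A) (insert e B)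
    rw [← Finset.insert_union_distrib, ← Finset.insert_inter_distrib] at h2
    have h3 := hs (insert e A) B
    have h4 := hs A (insert e B)
    rw [Finset.insert_union] at h3
    rw [Finset.union_insert] at h4
    by_cases hA : e ∈ A <;> by_cases hB : e ∈ B <;>
      simp only [hA, hB, Finset.insert_eq_of_mem, Finset.mem_union, Finset.mem_inter,
        Finset.insert_inter_of_mem, Finset.insert_inter_of_notMem, Finset.inter_insert_of_mem,
        Finset.inter_insert_of_notMem, and_self, or_self, true_or, or_true,
        not_false_eq_true] at h1 h2 h3 h4 ⊢ <;> omega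
  have insert_indep : ∀ (e : α) (h : Finset α → ℤ) (I : Finset α), e ∉ I →
      (∀ J ⊆ I, (J.card : ℤ) ≤ min (h J) (h (insert e J) - 1)) →
      ∀ J ⊆ insert e I, (J.card : ℤ) ≤ h J := by
    intro e h I _ hI J hJ
    by_cases heJ : e ∈ J
    · have h1 := hI (J.erase e) (Finset.subset_insert_iff.1 hJ)
      rw [Finset.insert_erase heJ] at h1
      have h2 := Finset.card_erase_add_one heJ
      omega
    · exact (hI J ((Finset.subset_insert_iff_of_notMem heJ).1 hJ)).trans (min_le_left _ _)
  induction E using Finset.induction_on with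
  | empty =>
    intro h₁ h₂ h10 h20 _ _ _
    refine ⟨∅, ∅, by simp, by simp, ?_, ?_⟩ <;> intro J hJ <;>
      simp [Finset.subset_empty.1 hJ, h10, h20]
  | insert e E he ih =>
    intro h₁ h₂ h10 h20 hs1 hs2 hE
    have hsub := Finset.subset_insert e E
    by_cases hA : ∀ A ⊆ E, (A.card : ℤ) ≤ min (h₁ A) (h₁ (insert e A) - 1) + h₂ A
    · have h0 := hA ∅ (Finset.empty_subset _)
      obtain ⟨I₁, I₂, hd, hu, hI₁, hI₂⟩ := ih (fun A => min (h₁ A) (h₁ (insert e A) - 1)) h₂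
        (by simp only [Finset.card_empty, h20, h10] at h0 ⊢; omega) h20
        (contract_submod e h₁ hs1) hs2 hA
      have he1 : e ∉ I₁ := fun h => he (hu ▸ Finset.mem_union_left _ h)
      have he2 : e ∉ I₂ := fun h => he (hu ▸ Finset.mem_union_right _ h)
      exact ⟨insert e I₁, I₂, by simp [he2, hd], by rw [Finset.insert_union, hu],
        insert_indep e h₁ I₁ he1 hI₁, hI₂⟩
    by_cases hB : ∀ B ⊆ E, (B.card : ℤ) ≤ h₁ B + min (h₂ B) (h₂ (insert e B) - 1)
    · have h0 := hB ∅ (Finset.empty_subset _)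
      obtain ⟨I₁, I₂, hd, hu, hI₁, hI₂⟩ := ih h₁ (fun A => min (h₂ A) (h₂ (insert e A) - 1))
        h10 (by simp only [Finset.card_empty, h20, h10] at h0 ⊢; omega) hs1
        (contract_submod e h₂ hs2) hB
      have he1 : e ∉ I₁ := fun h => he (hu ▸ Finset.mem_union_left _ h)
      have he2 : e ∉ I₂ := fun h => he (hu ▸ Finset.mem_union_right _ h)
      exact ⟨I₁, insert e I₂, by simp [he1, hd], by rw [Finset.union_insert, hu],
        hI₁, insert_indep e h₂ I₂ he2 hI₂⟩
    push Not at hA hB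
    obtain ⟨A, hAE, hA⟩ := hA
    obtain ⟨B, hBE, hB⟩ := hB
    exfalso
    have heA : e ∉ A := fun h => he (hAE h)
    have heB : e ∉ B := fun h => he (hBE h)
    have a1 := hE A (hAE.trans hsub)
    have b1 := hE B (hBE.trans hsub)
    have s1 := hs1 (insert e A) B
    have s2 := hs2 A (insert e B)
    rw [Finset.insert_union, Finset.insert_inter_of_notMem heB] at s1
    rw [Finset.union_insert, Finset.inter_insert_of_notMem heA] at s2
    have u1 := hE (insert e (A ∪ B)) (Finset.insert_subset_insert e (Finset.union_subset hAE hBE))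
    have u2 := hE (A ∩ B) (Finset.inter_subset_left.trans (hAE.trans hsub))
    rw [Finset.card_insert_of_notMem (by simp [heA, heB])] at u1
    have c := Finset.card_union_add_card_inter A B
    push_cast at u1
    omega

end Rank

section Support
variable {α V : Type*} [DecidableEq V] {ends : α → Finset V}

/-- The set function `A ↦ a * v(A) - b`, where `v(A)` is the number of vertices covered by `A`. -/
def supportCount (ends : α → Finset V) (a b : ℤ) (A : Finset α) : ℤ :=
  a * (A.biUnion ends).card - b

theorem two_le_card_support (hends : ∀ e, (ends e).card = 2) {A : Finset α} (hA : A.Nonempty) :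
    2 ≤ (A.biUnion ends).card := by
  obtain ⟨e, he⟩ := hA
  rw [← hends e]
  exact Finset.card_le_card (Finset.subset_biUnion_of_mem ends he)

theorem isCountFun_supportCount [DecidableEq α] (hends : ∀ e, (ends e).card = 2) {a b : ℤ}
    (ha : 0 ≤ a) (hab : b + 1 ≤ 2 * a) : IsCountFun (supportCount ends a b) where
  mono A B h := by
    have : (A.biUnion ends).card ≤ (B.biUnion ends).card :=
      Finset.card_le_card (Finset.biUnion_subset_biUnion_of_subset_left _ h)
    unfold supportCount
    gcongr
  submod A B _ := by
    have h1 := Finset.card_union_add_card_inter (A.biUnion ends) (B.biUnion ends)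
    have h2 : ((A ∩ B).biUnion ends).card ≤ (A.biUnion ends ∩ B.biUnion ends).card :=
      Finset.card_le_card (Finset.subset_inter
        (Finset.biUnion_subset_biUnion_of_subset_left _ Finset.inter_subset_left)
        (Finset.biUnion_subset_biUnion_of_subset_left _ Finset.inter_subset_right))
    rw [← Finset.union_biUnion] at h1
    have h3 : (((A ∪ B).biUnion ends).card : ℤ) + ((A ∩ B).biUnion ends).card ≤
        (A.biUnion ends).card + (B.biUnion ends).card := by omega
    unfold supportCount
    nlinarith
  one_le_singleton e := by
    simp only [supportCount, Finset.singleton_biUnion, hends]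
    push_cast
    linarith

/-- Rank is superadditive on sets of edges covering disjoint sets of vertices. -/
theorem countRank_add_le_of_disjoint_support [DecidableEq α] {a b : ℤ} (hb : 0 ≤ b)
    {A B : Finset α} (hAB : Disjoint A B) (h : Disjoint (A.biUnion ends) (B.biUnion ends)) :
    countRank (supportCount ends a b) A + countRank (supportCount ends a b) B ≤
      countRank (supportCount ends a b) (A ∪ B) := by
  obtain ⟨I, hIA, hI, hIc⟩ := exists_card_eq_countRank (supportCount ends a b) A
  obtain ⟨K, hKB, hK, hKc⟩ := exists_card_eq_countRank (supportCount ends a b) B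
  rw [← hIc, ← hKc, ← Finset.card_union_of_disjoint (hAB.mono hIA hKB)]
  refine CountIndep.card_le_countRank ?_ (Finset.union_subset_union hIA hKB)
  intro J hJ hne
  have hJu : J = J ∩ I ∪ J ∩ K := by
    rw [← Finset.inter_union_distrib_left]
    exact (Finset.inter_eq_left.2 hJ).symm
  rcases (J ∩ I).eq_empty_or_nonempty with h1 | h1
  · rw [h1, Finset.empty_union] at hJu
    exact hK J (hJu ▸ Finset.inter_subset_right) hne
  rcases (J ∩ K).eq_empty_or_nonempty with h2 | h2
  · rw [h2, Finset.union_empty] at hJu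
    exact hI J (hJu ▸ Finset.inter_subset_right) hne
  have c1 := hI _ Finset.inter_subset_right h1
  have c2 := hK _ Finset.inter_subset_right h2
  have hd : Disjoint ((J ∩ I).biUnion ends) ((J ∩ K).biUnion ends) :=
    h.mono
      (Finset.biUnion_subset_biUnion_of_subset_left _ (Finset.inter_subset_right.trans hIA))
      (Finset.biUnion_subset_biUnion_of_subset_left _ (Finset.inter_subset_right.trans hKB))
  have c3 := Finset.card_union_of_disjoint hd
  rw [← Finset.union_biUnion, ← hJu] at c3
  have c4 := Finset.card_union_le (J ∩ I) (J ∩ K)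
  rw [← hJu] at c4
  unfold supportCount at c1 c2 ⊢
  rw [c3]
  push_cast
  have c5 : (J.card : ℤ) ≤ (J ∩ I).card + (J ∩ K).card := by exact_mod_cast c4
  linarith

/-- A connected set of edges contains a spanning tree. -/
theorem card_support_le_countRank_add_one [DecidableEq α] (hends : ∀ e, (ends e).card = 2)
    {A : Finset α}
    (hconn : ∀ B ⊆ A, B.Nonempty → (A \ B).Nonempty →
      ¬ Disjoint (B.biUnion ends) ((A \ B).biUnion ends)) (hA : A.Nonempty) :
    (A.biUnion ends).card ≤ countRank (supportCount ends 1 1) A + 1 := by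
  set P : Finset α → Prop := fun T => T ⊆ A ∧ T.Nonempty ∧
    CountIndep (supportCount ends 1 1) T ∧ (T.biUnion ends).card = T.card + 1 with hP
  obtain ⟨e₀, he₀⟩ := hA
  have h0 : P {e₀} := by
    refine ⟨by simpa using he₀, by simp, ?_, by simp [hends]⟩
    intro J hJ hne
    rw [Finset.Nonempty.subset_singleton_iff hne] at hJ
    simp [hJ, supportCount, hends]
  have hfin : {T | P T}.Finite :=
    A.powerset.finite_toSet.subset fun T hT => by simpa using hT.1
  obtain ⟨T, -, hT⟩ := hfin.exists_le_maximal h0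
  obtain ⟨hTA, hTne, hTi, hTc⟩ := hT.prop
  suffices hspan : A.biUnion ends ⊆ T.biUnion ends by
    have h1 := Finset.card_le_card hspan
    have h2 := hTi.card_le_countRank hTA
    omega
  by_contra hspan
  obtain ⟨x, hx, hxT⟩ := Finset.not_subset.1 hspan
  obtain ⟨e₁, he₁, hxe₁⟩ := Finset.mem_biUnion.1 hx
  -- an edge of `A` leaving the vertex set of `T`
  obtain ⟨e, heA, ⟨y, hye, hyT⟩, ⟨z, hze, hzT⟩⟩ : ∃ e ∈ A, (∃ y ∈ ends e, y ∈ T.biUnion ends) ∧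
      ∃ z ∈ ends e, z ∉ T.biUnion ends := by
    by_contra! hno
    refine hconn (A.filter fun e => ends e ⊆ T.biUnion ends) (Finset.filter_subset _ _)
      ?_ ?_ ?_
    · obtain ⟨t, ht⟩ := hTne
      exact ⟨t, Finset.mem_filter.2 ⟨hTA ht, Finset.subset_biUnion_of_mem ends ht⟩⟩
    · refine ⟨e₁, Finset.mem_sdiff.2 ⟨he₁, fun h => hxT ((Finset.mem_filter.1 h).2 hxe₁)⟩⟩
    · rw [Finset.disjoint_left]
      intro w hw hw'
      obtain ⟨p, hp, hwp⟩ := Finset.mem_biUnion.1 hw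
      obtain ⟨q, hq, hwq⟩ := Finset.mem_biUnion.1 hw'
      rw [Finset.mem_sdiff] at hq
      exact hq.2 (Finset.mem_filter.2
        ⟨hq.1, hno q hq.1 ⟨w, hwq, (Finset.mem_filter.1 hp).2 hwp⟩⟩)
  have heT : e ∉ T := fun h => hzT (Finset.mem_biUnion.2 ⟨e, h, hze⟩)
  have hgrow : ∀ J ⊆ T, (J.biUnion ends).card + 1 ≤ ((insert e J).biUnion ends).card := by
    intro J hJ
    have hz : z ∉ J.biUnion ends :=
      fun h => hzT (Finset.biUnion_subset_biUnion_of_subset_left _ hJ h)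
    rw [← Finset.card_insert_of_notMem hz, Finset.biUnion_insert]
    exact Finset.card_le_card (Finset.insert_subset (Finset.mem_union_left _ hze)
      Finset.subset_union_right)
  have hnew : P (insert e T) := by
    refine ⟨Finset.insert_subset heA hTA, by simp, ?_, ?_⟩
    · intro J hJ hne
      by_cases heJ : e ∈ J
      · have hsub := Finset.subset_insert_iff.1 hJ
        have hcard := Finset.card_erase_add_one heJ
        have h1 := hgrow _ hsub
        rw [Finset.insert_erase heJ] at h1
        rcases (J.erase e).eq_empty_or_nonempty with h2 | h2
        · have h3 := two_le_card_support hends hne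
          rw [h2, Finset.card_empty] at hcard
          unfold supportCount
          omega
        · have h3 := hTi _ hsub h2
          unfold supportCount at h3 ⊢
          omega
      · exact hTi J ((Finset.subset_insert_iff_of_notMem heJ).1 hJ) hne
    · rw [Finset.card_insert_of_notMem heT]
      refine le_antisymm ?_ (hTc ▸ hgrow T subset_rfl)
      have h1 := Finset.card_union_add_card_inter (ends e) (T.biUnion ends)
      have h2 : 0 < (ends e ∩ T.biUnion ends).card :=
        Finset.card_pos.2 ⟨y, Finset.mem_inter.2 ⟨hye, hyT⟩⟩
      rw [hends] at h1
      rw [Finset.biUnion_insert]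
      omega
  exact heT (hT.le_of_ge hnew (Finset.subset_insert e T) (Finset.mem_insert_self e T))

/-- The rank condition for covering all edges by a forest and a `(k, 1 - f)`-sparse set, in terms
of the numerical conditions on `f`. -/
theorem card_le_countRank_add_countRank [DecidableEq α] (hends : ∀ e, (ends e).card = 2)
    {k f : ℤ} {ε : ℝ}
    (hε0 : 0 ≤ ε) (hε1 : ε < 1) (hf1 : 1 ≤ f) (hf2 : f ≤ 2 * k) (hfε : f ≤ k + 1 ∨ ε < 1 / 2)
    (hblock : ∀ v e : ℤ, 2 ≤ v → 2 * e ≤ v * (v - 1) → (e : ℝ) ≤ (k + ε) * v →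
      e ≤ (k + 1) * v - f)
    (hsimple : ∀ A : Finset α,
      2 * (A.card : ℤ) ≤ (A.biUnion ends).card * ((A.biUnion ends).card - 1))
    (hdens : ∀ A : Finset α, A.Nonempty → (A.card : ℝ) ≤ (k + ε) * (A.biUnion ends).card)
    (A : Finset α) :
    A.card ≤ countRank (supportCount ends 1 1) A +
      countRank (supportCount ends k (f - 1)) A := by
  have hg := isCountFun_supportCount (ends := ends) hends (a := k) (b := f - 1)
    (by omega) (by omega)
  induction A using Finset.strongInduction with
  | H A ih =>
  rcases A.eq_empty_or_nonempty with rfl | hA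
  · simp
  by_cases hconn : ∀ B ⊆ A, B.Nonempty → (A \ B).Nonempty →
      ¬ Disjoint (B.biUnion ends) ((A \ B).biUnion ends)
  swap
  · push Not at hconn
    obtain ⟨B, hBA, hB, hAB, hd⟩ := hconn
    have h1 := ih (A \ B) (Finset.sdiff_ssubset hBA hB)
    have h2 := ih B (Finset.ssubset_iff_subset_ne.2 ⟨hBA, fun h => by simp [h] at hAB⟩)
    have h3 := countRank_add_le_of_disjoint_support (a := 1) (b := 1) (by norm_num)
      Finset.disjoint_sdiff hd
    have h4 := countRank_add_le_of_disjoint_support (a := k) (b := f - 1) (by omega)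
      Finset.disjoint_sdiff hd
    rw [Finset.union_sdiff_of_subset hBA] at h3 h4
    have h5 := Finset.card_sdiff_add_card_eq_card hBA
    omega
  have hr1 := card_support_le_countRank_add_one hends hconn hA
  obtain ⟨s, S, hS, hdisj, hrank⟩ := hg.exists_family A
  -- only the blocks with more elements than their count matter
  set s' := s.filter fun i => supportCount ends k (f - 1) (S i) < (S i).card with hs'
  set B := s'.biUnion S with hB
  have hBA : B ⊆ A := Finset.biUnion_subset.2 fun i hi => (hS i (Finset.mem_filter.1 hi).1).2
  have hAcard : (A.card : ℤ) = (A \ s.biUnion S).card + ∑ i ∈ s, ((S i).card : ℤ) := by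
    have h1 := Finset.card_sdiff_add_card_eq_card
      (Finset.biUnion_subset.2 fun i hi => (hS i hi).2 : s.biUnion S ⊆ A)
    rw [Finset.card_biUnion hdisj] at h1
    exact_mod_cast h1.symm
  have hBcard : (B.card : ℤ) = ∑ i ∈ s', ((S i).card : ℤ) := by
    rw [hB, Finset.card_biUnion fun i hi j hj =>
      hdisj i (Finset.mem_filter.1 hi).1 j (Finset.mem_filter.1 hj).1]
    push_cast; rfl
  have hsplit1 := Finset.sum_filter_add_sum_filter_not s
    (fun i => supportCount ends k (f - 1) (S i) < (S i).card) (fun i => ((S i).card : ℤ))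
  have hsplit2 := Finset.sum_filter_add_sum_filter_not s
    (fun i => supportCount ends k (f - 1) (S i) < (S i).card)
    (fun i => supportCount ends k (f - 1) (S i))
  have hle : ∑ i ∈ s with ¬ supportCount ends k (f - 1) (S i) < (S i).card, ((S i).card : ℤ) ≤
      ∑ i ∈ s with ¬ supportCount ends k (f - 1) (S i) < (S i).card,
        supportCount ends k (f - 1) (S i) :=
    Finset.sum_le_sum fun i hi => not_lt.1 (Finset.mem_filter.1 hi).2
  rw [← hs'] at hsplit1 hsplit2
  suffices hmain : (B.card : ℤ) ≤ countRank (supportCount ends 1 1) A +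
      ∑ i ∈ s', supportCount ends k (f - 1) (S i) by
    zify
    linarith
  have hne' : ∀ i ∈ s', (S i).Nonempty := fun i hi => (hS i (Finset.mem_filter.1 hi).1).1
  by_cases hBA' : B = A
  swap
  · have h1 := ih B (Finset.ssubset_iff_subset_ne.2 ⟨hBA, hBA'⟩)
    have h2 := hg.countRank_le_of_cover B s' S hne'
    rw [← hB, Finset.sdiff_self, Finset.card_empty] at h2
    have h3 := countRank_mono (g := supportCount ends 1 1) hBA
    zify at h1 h3
    push_cast at h2
    linarith
  set v : ℤ := ((A.biUnion ends).card : ℤ) with hv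
  set t : ℤ := (s'.card : ℤ) with ht
  set w : ℤ := ∑ i ∈ s', (((S i).biUnion ends).card : ℤ) with hw
  have hsum : ∑ i ∈ s', supportCount ends k (f - 1) (S i) = k * w - t * (f - 1) := by
    simp only [supportCount, Finset.sum_sub_distrib, Finset.mul_sum, hw, ht, Finset.sum_const,
      nsmul_eq_mul]
    ring
  have hblocks : (B.card : ℤ) ≤ (k + 1) * w - t * f := by
    have : ∑ i ∈ s', ((k + 1) * (((S i).biUnion ends).card : ℤ) - f) = (k + 1) * w - t * f := by
      simp [Finset.sum_sub_distrib, Finset.mul_sum, hw, ht]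
    rw [hBcard, ← this]
    refine Finset.sum_le_sum fun i hi => hblock _ _ ?_ (hsimple _) ?_
    · exact_mod_cast two_le_card_support hends (hne' i hi)
    · exact_mod_cast hdens _ (hne' i hi)
  have hbig : 2 * k * t ≤ w := by
    have : ∑ i ∈ s', 2 * k = 2 * k * t := by simp [ht, mul_comm]
    rw [hw, ← this]
    refine Finset.sum_le_sum fun i hi => ?_
    have h1 := (Finset.mem_filter.1 hi).2
    have h2 := hsimple (S i)
    have h3 : (2 : ℤ) ≤ ((S i).biUnion ends).card := by
      exact_mod_cast two_le_card_support hends (hne' i hi)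
    unfold supportCount at h1
    by_contra! hlt
    nlinarith
  rw [hsum]
  have hr1' : v ≤ (countRank (supportCount ends 1 1) A : ℤ) + 1 := by
    rw [hv]; exact_mod_cast hr1
  rcases lt_or_ge (w - v) t with hD | hD
  · nlinarith
  have htpos : 1 ≤ t := by
    rw [← hBA', hB] at hA
    obtain ⟨e, he⟩ := hA
    obtain ⟨i, hi, -⟩ := Finset.mem_biUnion.1 he
    have : 0 < s'.card := Finset.card_pos.2 ⟨i, hi⟩
    omega
  have hd := hdens A hA
  rw [hBA']
  by_contra! hlt
  have hlt' : v + k * w - t * (f - 1) ≤ A.card := by linarith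
  have hltR : (v : ℝ) + k * w - t * (f - 1) ≤ A.card := by exact_mod_cast hlt'
  have hdR : (A.card : ℝ) ≤ (k + ε) * v := by simpa [hv] using hd
  have hbigR : 2 * (k : ℝ) * t ≤ w := by exact_mod_cast hbig
  have hDR : (t : ℝ) ≤ w - v := by exact_mod_cast hD
  have htR : (1 : ℝ) ≤ t := by exact_mod_cast htpos
  have hkR : (1 : ℝ) ≤ k := by exact_mod_cast (by omega : 1 ≤ k)
  have h1 : (1 - ε) * (2 * k * t) ≤ (1 - ε) * w := by
    apply mul_le_mul_of_nonneg_left hbigR; linarith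
  have key : (f : ℝ) - 1 < (1 - ε) * (2 * k - 1) + k := by
    rcases hfε with h | h
    · have : (f : ℝ) ≤ k + 1 := by exact_mod_cast h
      nlinarith
    · have : (f : ℝ) ≤ 2 * k := by exact_mod_cast hf2
      nlinarith
  have h2 : (k - 1 + ε) * t ≤ (k - 1 + ε) * (w - v) :=
    mul_le_mul_of_nonneg_left hDR (by linarith)
  have h3 := mul_lt_mul_of_pos_left key (by linarith : (0 : ℝ) < t)
  linarith

end Support

/-- The numerical properties of `fFun` that the decomposition uses. -/
theorem exists_int_eq_fFun {k : ℕ} (hk : 0 < k) {ε : ℝ} (hε1 : ε < 1) :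
    ∃ f : ℤ, fFun k ε = f ∧ 1 ≤ f ∧ f ≤ 2 * k ∧ (f ≤ k + 1 ∨ ε < 1 / 2) ∧
      ∀ v e : ℤ, 2 ≤ v → 2 * e ≤ v * (v - 1) → (e : ℝ) ≤ (((k : ℤ) : ℝ) + ε) * v →
        e ≤ (k + 1) * v - f := by
  have hkR : (1 : ℝ) ≤ k := by exact_mod_cast hk
  have hkZ : (1 : ℤ) ≤ k := by exact_mod_cast hk
  have small : ∀ f v e : ℤ, f ≤ 2 * k → 2 ≤ v → v ≤ 2 * k + 1 → 2 * e ≤ v * (v - 1) →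
      e ≤ (k + 1) * v - f := by
    intro f v e hf h2 hv he
    nlinarith [mul_nonneg (sub_nonneg.2 h2) (sub_nonneg.2 hv)]
  have middle : ∀ f v e : ℤ, f ≤ k + 1 → v = 2 * k + 2 → 2 * e ≤ v * (v - 1) →
      e ≤ (k + 1) * v - f := by
    rintro f v e hf rfl he
    nlinarith
  have large : ∀ f v e m : ℤ, (f : ℝ) < m * (1 - ε) + 1 → m ≤ v →
      (e : ℝ) ≤ (((k : ℤ) : ℝ) + ε) * v → e ≤ (k + 1) * v - f := by
    intro f v e m hf hv he
    have hvR : (m : ℝ) ≤ v := by exact_mod_cast hv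
    have h1 : (m : ℝ) * (1 - ε) ≤ v * (1 - ε) :=
      mul_le_mul_of_nonneg_right hvR (by linarith)
    have h2 : (e : ℝ) < (((k : ℤ) : ℝ) + 1) * v - f + 1 := by linarith
    have h3 : e < (k + 1) * v - f + 1 := by exact_mod_cast h2
    omega
  have pos_of_lt : ∀ f : ℤ, (0 : ℝ) < f → 1 ≤ f := fun f h => by exact_mod_cast h
  unfold fFun
  split_ifs with h1 h2 h3
  · refine ⟨2 * k, by push_cast; rfl, by omega, le_rfl, ?_, fun v e hv he hd => ?_⟩
    · rcases Nat.lt_or_ge k 2 with h | h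
      · left; omega
      · right
        have : (2 : ℝ) ≤ k := by exact_mod_cast h
        nlinarith
    · rcases le_or_gt v (2 * k + 1) with h | h
      · exact small _ v e le_rfl hv h he
      · refine large _ v e (2 * k + 2) ?_ (by omega) hd
        push_cast
        nlinarith
  · refine ⟨_, rfl, pos_of_lt _ ?_, ?_, Or.inr h2, fun v e hv he hd => ?_⟩
    · exact lt_of_lt_of_le (by nlinarith) (Int.le_ceil _)
    · rw [Int.ceil_le]; push_cast; nlinarith
    · rcases le_or_gt v (2 * k + 1) with h | h
      · exact small _ v e (by rw [Int.ceil_le]; push_cast; nlinarith) hv h he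
      · refine large _ v e (2 * k + 2) ?_ (by omega) hd
        push_cast
        exact Int.ceil_lt_add_one _
  · refine ⟨k + 1, by push_cast; rfl, by omega, by omega, Or.inl le_rfl,
      fun v e hv he hd => ?_⟩
    rcases le_or_gt v (2 * k + 1) with h | h
    · exact small _ v e (by omega) hv h he
    rcases eq_or_lt_of_le (Int.add_one_le_iff.2 h) with h' | h'
    · exact middle _ v e le_rfl (by omega) he
    · refine large _ v e (2 * k + 3) ?_ (by omega) hd
      rw [lt_div_iff₀ (by positivity)] at h3
      push_cast
      nlinarith
  · rw [not_lt, div_le_iff₀ (by positivity)] at h3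
    have hf : ⌈(2 * (k : ℝ) + 3) * (1 - ε)⌉ ≤ (k : ℤ) + 1 := by
      rw [Int.ceil_le]; push_cast; nlinarith
    refine ⟨_, rfl, pos_of_lt _ ?_, by omega, Or.inl hf, fun v e hv he hd => ?_⟩
    · exact lt_of_lt_of_le (by nlinarith) (Int.le_ceil _)
    rcases le_or_gt v (2 * k + 1) with h | h
    · exact small _ v e (by omega) hv h he
    rcases eq_or_lt_of_le (Int.add_one_le_iff.2 h) with h' | h'
    · exact middle _ v e hf (by omega) he
    · refine large _ v e (2 * k + 3) ?_ (by omega) hd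
      push_cast
      exact Int.ceil_lt_add_one _

section Graph
variable {V : Type*} {G : SimpleGraph V}

open Classical in
/-- The two ends of an edge of `G`. -/
noncomputable def edgeEnds (G : SimpleGraph V) (e : G.edgeSet) : Finset V := (e : Sym2 V).toFinset

theorem card_edgeEnds (e : G.edgeSet) : (edgeEnds G e).card = 2 := by
  classical
  rw [edgeEnds, Sym2.card_toFinset_of_not_isDiag _ (G.not_isDiag_of_mem_edgeSet e.2)]

theorem mem_edgeEnds {e : G.edgeSet} {v : V} : v ∈ edgeEnds G e ↔ v ∈ (e : Sym2 V) := by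
  classical
  simp [edgeEnds]

theorem two_mul_card_le_card_support [DecidableEq V] (A : Finset G.edgeSet) :
    2 * (A.card : ℤ) ≤ (A.biUnion (edgeEnds G)).card * ((A.biUnion (edgeEnds G)).card - 1) := by
  set W := A.biUnion (edgeEnds G) with hW
  have h1 : A.map (Function.Embedding.subtype _) ⊆ W.offDiag.image Sym2.mk.uncurry := by
    intro e he
    obtain ⟨e, heA, rfl⟩ := Finset.mem_map.1 he
    obtain ⟨e, heG⟩ := e
    have hends : ∀ v ∈ e, v ∈ W := fun v hv =>
      Finset.mem_biUnion.2 ⟨_, heA, mem_edgeEnds.2 hv⟩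
    induction e using Sym2.ind with
    | _ x y =>
      exact Finset.mem_image.2 ⟨(x, y), Finset.mem_offDiag.2 ⟨hends x (by simp),
        hends y (by simp), (SimpleGraph.mem_edgeSet G |>.1 heG).ne⟩, rfl⟩
  have h2 := Finset.card_le_card h1
  rw [Finset.card_map, Sym2.card_image_offDiag, Nat.choose_two_right] at h2
  have h3 : 2 * A.card ≤ W.card * (W.card - 1) := by
    have := Nat.div_mul_le_self (W.card * (W.card - 1)) 2
    omega
  rcases Nat.eq_zero_or_pos W.card with h | h
  · rw [h] at h3 ⊢
    push_cast
    omega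
  · zify [h] at h3
    exact h3

theorem IsSparse.card_le [Fintype V] [DecidableEq V] {a b : ℝ} (hG : IsSparse G a b)
    {A : Finset G.edgeSet} (hA : A.Nonempty) :
    (A.card : ℝ) ≤ a * (A.biUnion (edgeEnds G)).card + b := by
  let H : G.Subgraph :=
    { verts := A.biUnion (edgeEnds G)
      Adj := fun x y => ∃ h : s(x, y) ∈ G.edgeSet, (⟨s(x, y), h⟩ : G.edgeSet) ∈ A
      adj_sub := fun ⟨h, _⟩ => h
      edge_vert := fun {x y} ⟨h, hA⟩ => by
        simp only [Finset.mem_coe, Finset.mem_biUnion]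
        exact ⟨_, hA, mem_edgeEnds.2 (Sym2.mem_mk_left x y)⟩
      symm := ⟨fun x y ⟨h, hA⟩ => by
        have hxy : s(y, x) = s(x, y) := Sym2.eq_swap
        simpa only [hxy] using (⟨h, hA⟩ : ∃ h : s(x, y) ∈ G.edgeSet, ⟨s(x, y), h⟩ ∈ A)⟩ }
  have hH : H.edgeSet = Subtype.val '' (A : Set G.edgeSet) := by
    ext e
    induction e using Sym2.ind with
    | _ x y => simp [H]
  have h := hG H (by rw [hH]; exact (Finset.coe_nonempty.2 hA).image _)
  rwa [hH, Set.ncard_image_of_injective _ Subtype.val_injective, Set.ncard_coe_finset,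
    Set.ncard_coe_finset] at h

theorem isSparse_fromEdgeSet [Fintype V] [DecidableEq V] {a b : ℤ} (ha : 0 ≤ a)
    {I : Finset G.edgeSet} (hI : CountIndep (supportCount (edgeEnds G) a b) I) :
    IsSparse (SimpleGraph.fromEdgeSet (Subtype.val '' (I : Set G.edgeSet))) a (-b) := by
  classical
  intro H hH
  set J : Finset G.edgeSet := I.filter fun e => (e : Sym2 V) ∈ H.edgeSet with hJ
  have hHJ : H.edgeSet = Subtype.val '' (J : Set G.edgeSet) := by
    ext e
    constructor
    · intro he
      have h1 := H.edgeSet_subset he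
      rw [SimpleGraph.edgeSet_fromEdgeSet] at h1
      obtain ⟨⟨e', he'I, rfl⟩, -⟩ := h1
      exact ⟨e', by simpa [hJ] using ⟨he'I, he⟩, rfl⟩
    · rintro ⟨e', he', rfl⟩
      exact (Finset.mem_filter.1 he').2
  have hJne : J.Nonempty := by
    rw [hHJ] at hH
    simpa using hH
  have hsupp : (J.biUnion (edgeEnds G)).card ≤ H.verts.ncard := by
    rw [← Set.ncard_coe_finset]
    refine Set.ncard_le_ncard ?_ (Set.toFinite _)
    intro x hx
    obtain ⟨e, he, hxe⟩ := Finset.mem_biUnion.1 (Finset.mem_coe.1 hx)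
    exact H.mem_verts_of_mem_edge (Finset.mem_filter.1 he).2 (mem_edgeEnds.1 hxe)
  have h1 := hI J (Finset.filter_subset _ _) hJne
  unfold supportCount at h1
  rw [hHJ, Set.ncard_image_of_injective _ Subtype.val_injective, Set.ncard_coe_finset]
  have h2 : (J.card : ℝ) ≤ a * (J.biUnion (edgeEnds G)).card - b := by exact_mod_cast h1
  have h3 : (a : ℝ) * (J.biUnion (edgeEnds G)).card ≤ a * H.verts.ncard :=
    mul_le_mul_of_nonneg_left (by exact_mod_cast hsupp) (by exact_mod_cast ha)
  linarith

end Graph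

theorem stmt8 (k : ℕ) (hk : 0 < k) (ε : ℝ) (hε0 : 0 ≤ ε) (hε1 : ε < 1)
    {V : Type*} [Fintype V] (G : SimpleGraph V)
    (hG : IsSparse G ((k : ℝ) + ε) 0) :
    HasSparsePartition G 1 (-1) (k : ℝ) (1 - fFun k ε) := by
  classical
  obtain ⟨f, hf, hf1, hf2, hfε, hblock⟩ := exists_int_eq_fFun hk hε1
  have hg₁ := isCountFun_supportCount (card_edgeEnds (G := G)) (a := 1) (b := 1)
    (by norm_num) (by norm_num)
  have hg₂ := isCountFun_supportCount (card_edgeEnds (G := G)) (a := k) (b := f - 1)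
    (by omega) (by omega)
  have hrank := card_le_countRank_add_countRank (card_edgeEnds (G := G)) hε0 hε1 hf1 hf2 hfε
    hblock two_mul_card_le_card_support fun A hA => by simpa using hG.card_le hA
  obtain ⟨I₁, I₂, hd, hu, hI₁, hI₂⟩ := exists_partition_of_card_le_add Finset.univ
    (fun A => countRank (supportCount (edgeEnds G) 1 1) A)
    (fun A => countRank (supportCount (edgeEnds G) k (f - 1)) A)
    (by simp [countRank_empty]) (by simp [countRank_empty])
    (fun A B => by exact_mod_cast hg₁.countRank_submod A B)
    (fun A B => by exact_mod_cast hg₂.countRank_submod A B)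
    (fun A _ => by exact_mod_cast hrank A)
  have hi₁ := countIndep_of_card_le_countRank (by exact_mod_cast hI₁ I₁ subset_rfl)
  have hi₂ := countIndep_of_card_le_countRank (by exact_mod_cast hI₂ I₂ subset_rfl)
  have hedge : ∀ I : Finset G.edgeSet,
      (SimpleGraph.fromEdgeSet (Subtype.val '' (I : Set G.edgeSet))).edgeSet =
        Subtype.val '' (I : Set G.edgeSet) := by
    intro I
    rw [SimpleGraph.edgeSet_fromEdgeSet, sdiff_eq_left, Set.disjoint_left]
    rintro _ ⟨e, -, rfl⟩
    exact G.not_isDiag_of_mem_edgeSet e.2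
  have hle : ∀ I : Finset G.edgeSet,
      SimpleGraph.fromEdgeSet (Subtype.val '' (I : Set G.edgeSet)) ≤ G := by
    intro I
    rw [← SimpleGraph.edgeSet_subset_edgeSet, hedge]
    rintro _ ⟨e, -, rfl⟩
    exact e.2
  refine ⟨_, _, hle I₁, hle I₂, ?_, ?_, ?_, ?_⟩
  · rw [hedge, hedge, ← Set.image_union, ← Finset.coe_union, hu]
    simp
  · rw [hedge, hedge]
    exact (Set.disjoint_image_iff Subtype.val_injective).2 (Finset.disjoint_coe.2 hd)
  · simpa using isSparse_fromEdgeSet (by norm_num) hi₁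
  · have h := isSparse_fromEdgeSet (by omega) hi₂
    rw [hf]
    push_cast at h
    simpa using h
end

section
/- If a finite simple graph G is (2,−1)-sparse, then there exists an edge-partition E(G) = E(F) ∪ E(P) such that F is a forest and P is a triangle-free pseudoforest, i.e., P is (1,0)-sparse and contains no subgraph isomorphic to K₃. -/
/-- If every `A ⊆ E` satisfies `|A| ≤ r(A) + |N(A)|` for a monotone submodular `r`, then `E` splits
into a set `F` with `|F| ≤ r(F)` and a set admitting an injective choice of elements of the `N e`;
the inverse of that choice is `h`. -/
theorem exists_card_le_and_matching {ι V : Type*} [DecidableEq ι] [DecidableEq V]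
    (E : Finset ι) (r : Finset ι → ℤ) (N : ι → Finset V) (h₀ : V → ι)
    (hmono : Monotone r) (hsub : ∀ A B, r (A ∪ B) + r (A ∩ B) ≤ r A + r B)
    (hE : ∀ A ⊆ E, (A.card : ℤ) ≤ r A + (A.biUnion N).card) :
    ∃ F ⊆ E, (F.card : ℤ) ≤ r F ∧ ∃ h : V → ι, ∀ e ∈ E \ F, ∃ v ∈ N e, h v = e := by
  induction E using Finset.induction_on generalizing r N with
  | empty => exact ⟨∅, by simp, by simpa using hE ∅ (by simp), h₀, by simp⟩
  | insert e E he ih =>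
    by_cases hcontract :
        ∀ A ⊆ E, (A.card : ℤ) ≤ (r (insert e A) - 1) + (A.biUnion N).card
    · obtain ⟨F, hFE, hF, h, hh⟩ := ih (fun A => r (insert e A) - 1) N
        (fun A B hAB => by
          have := hmono (Finset.insert_subset_insert e hAB)
          simpa using this)
        (fun A B => by
          have := hsub (insert e A) (insert e B)
          rw [← Finset.insert_union_distrib, ← Finset.insert_inter_distrib] at this
          linarith) hcontract
      have heF : e ∉ F := fun h' => he (hFE h')
      refine ⟨insert e F, Finset.insert_subset_insert e hFE, ?_, h, fun e' he' => hh e' ?_⟩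
      · rw [Finset.card_insert_of_notMem heF]
        push_cast
        linarith
      · grind
    by_cases hassign :
        ∃ w ∈ N e, ∀ A ⊆ E, (A.card : ℤ) ≤ r A + (A.biUnion fun i => (N i).erase w).card
    · obtain ⟨w, hw, hA⟩ := hassign
      obtain ⟨F, hFE, hF, h, hh⟩ := ih r (fun i => (N i).erase w) hmono hsub hA
      refine ⟨F, hFE.trans (Finset.subset_insert e E), hF, Function.update h w e, ?_⟩
      intro e' he'
      by_cases hee : e' = e
      · exact ⟨w, hee ▸ hw, by simp [hee]⟩
      · obtain ⟨v, hv, rfl⟩ := hh e' (by grind)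
        exact ⟨v, Finset.mem_of_mem_erase hv, by
          rw [Function.update_of_ne (Finset.ne_of_mem_erase hv)]⟩
    exfalso
    have hE' : ∀ A ⊆ E, (A.card : ℤ) ≤ r A + (A.biUnion N).card := fun A hA =>
      hE A (hA.trans (Finset.subset_insert e E))
    let tight : Finset ι → Prop := fun A => A ⊆ E ∧ r A + (A.biUnion N).card ≤ A.card
    have tight_union : ∀ A B, tight A → tight B → tight (A ∪ B) := by
      rintro A B ⟨hA, hA'⟩ ⟨hB, hB'⟩
      refine ⟨Finset.union_subset hA hB, ?_⟩
      have h1 := hE' (A ∩ B) (Finset.inter_subset_left.trans hA)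
      have h2 := hsub A B
      have h3 := Finset.card_union_add_card_inter A B
      have h4 := Finset.card_union_add_card_inter (A.biUnion N) (B.biUnion N)
      have h5 : ((A ∩ B).biUnion N).card ≤ ((A.biUnion N) ∩ (B.biUnion N)).card :=
        Finset.card_le_card (by
          intro v
          simp only [Finset.mem_biUnion, Finset.mem_inter]
          grind)
      rw [Finset.union_biUnion]
      zify at h3 h4 h5
      linarith
    push Not at hcontract hassign
    obtain ⟨A₀, hA₀, hlt⟩ := hcontract
    have hA₀r := hmono (Finset.subset_insert e A₀)
    have hA₀E := hE' A₀ hA₀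
    have hA₀t : tight A₀ := ⟨hA₀, by linarith⟩
    obtain ⟨B, hB⟩ := (E.powerset.finite_toSet.subset
      (fun B (hB : tight B) => Finset.mem_coe.2 (Finset.mem_powerset.2 hB.1))).exists_maximal
        ⟨A₀, hA₀t⟩
    · have hmax : ∀ A, tight A → A ⊆ B := fun A hA =>
        Finset.subset_union_right.trans
          (hB.2 (tight_union B A hB.1 hA) Finset.subset_union_left)
      have hNe : N e ⊆ B.biUnion N := by
        intro w hw
        obtain ⟨A, hA, hAlt⟩ := hassign w hw
        have herase : (A.biUnion fun i => (N i).erase w) = (A.biUnion N).erase w := by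
          ext v
          simp only [Finset.mem_biUnion, Finset.mem_erase]
          tauto
        rw [herase] at hAlt
        have hAE := hE' A hA
        have hwA : w ∈ A.biUnion N := by
          by_contra hcon
          rw [Finset.erase_eq_of_notMem hcon] at hAlt
          linarith
        have := Finset.card_erase_add_one hwA
        have hAt : tight A := ⟨hA, by zify at this; linarith⟩
        exact Finset.biUnion_subset_biUnion_of_subset_left N (hmax A hAt) hwA
      have hA₀B := hmax A₀ hA₀t
      have heB : e ∉ B := fun h' => he (hB.1.1 h')
      have h1 := hsub (insert e A₀) B
      have h2 : insert e A₀ ∪ B = insert e B := by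
        rw [Finset.insert_union, Finset.union_eq_right.2 hA₀B]
      have h3 : insert e A₀ ∩ B = A₀ := by
        rw [Finset.insert_inter_of_notMem heB, Finset.inter_eq_left.2 hA₀B]
      rw [h2, h3] at h1
      have h4 := hE (insert e B) (Finset.insert_subset_insert e hB.1.1)
      rw [Finset.card_insert_of_notMem heB, Finset.biUnion_insert,
        Finset.union_eq_right.2 hNe] at h4
      push_cast at h4
      have h5 := hB.1.2
      linarith

/-- The functions that are constant on the connected components of the graph with edge set `A`. -/
def edgeConstant {V : Type*} (A : Finset (Sym2 V)) : Submodule ℚ (V → ℚ) where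
  carrier := {φ | ∀ u v, s(u, v) ∈ A → φ u = φ v}
  add_mem' := by
    intro φ ψ hφ hψ u v h
    simp [hφ u v h, hψ u v h]
  zero_mem' := by simp
  smul_mem' := by
    intro c φ hφ u v h
    simp [hφ u v h]

section edgeConstant

variable {V : Type*}

theorem mem_edgeConstant {A : Finset (Sym2 V)} {φ : V → ℚ} :
    φ ∈ edgeConstant A ↔ ∀ u v, s(u, v) ∈ A → φ u = φ v :=
  Iff.rfl

theorem edgeConstant_anti {A B : Finset (Sym2 V)} (h : A ⊆ B) :
    edgeConstant B ≤ edgeConstant A :=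
  fun _ hφ u v huv => hφ u v (h huv)

theorem eq_of_mem_edgeConstant_of_reachable {A : Finset (Sym2 V)} {Γ : SimpleGraph V}
    (hΓ : Γ.edgeSet ⊆ A) {φ : V → ℚ} (hφ : φ ∈ edgeConstant A) {u v : V}
    (h : Γ.Reachable u v) : φ u = φ v := by
  obtain ⟨p⟩ := h
  induction p with
  | nil => rfl
  | cons hadj _ ih => exact (hφ _ _ (hΓ hadj)).trans ih

variable [Fintype V]

/-- The rank of a set of edges in the graphic matroid of the complete graph on `V`. -/
noncomputable def edgeRank (A : Finset (Sym2 V)) : ℤ :=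
  Fintype.card V - Module.finrank ℚ (edgeConstant A)

theorem edgeRank_mono : Monotone (edgeRank (V := V)) := by
  intro A B h
  have := Submodule.finrank_mono (edgeConstant_anti h)
  unfold edgeRank
  lia

variable [DecidableEq V]

theorem edgeRank_submodular (A B : Finset (Sym2 V)) :
    edgeRank (A ∪ B) + edgeRank (A ∩ B) ≤ edgeRank A + edgeRank B := by
  have h1 := Submodule.finrank_sup_add_finrank_inf_eq (edgeConstant A) (edgeConstant B)
  have h2 : edgeConstant A ⊓ edgeConstant B = edgeConstant (A ∪ B) := by
    ext φ
    simp only [Submodule.mem_inf, mem_edgeConstant, Finset.mem_union]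
    grind
  have h3 : edgeConstant A ⊔ edgeConstant B ≤ edgeConstant (A ∩ B) :=
    sup_le (edgeConstant_anti Finset.inter_subset_left)
      (edgeConstant_anti Finset.inter_subset_right)
  have h4 := Submodule.finrank_mono h3
  rw [h2] at h1
  unfold edgeRank
  lia

theorem edgeRank_le_card (A : Finset (Sym2 V)) : edgeRank A ≤ A.card := by
  induction A using Finset.induction_on with
  | empty =>
    have : edgeConstant (∅ : Finset (Sym2 V)) = ⊤ := by
      ext φ
      simp [mem_edgeConstant]
    rw [edgeRank, this, finrank_top, Module.finrank_fintype_fun_eq_card]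
    simp
  | insert e A he ih =>
    induction e using Sym2.ind with
    | _ a b =>
      let L : (V → ℚ) →ₗ[ℚ] ℚ := LinearMap.proj (R := ℚ) (φ := fun _ : V => ℚ) a -
        LinearMap.proj (R := ℚ) (φ := fun _ : V => ℚ) b
      have h1 := L.finrank_range_add_finrank_ker
      have h2 := L.range.finrank_le
      have h3 := Submodule.finrank_sup_add_finrank_inf_eq (edgeConstant A) L.ker
      have h4 := (edgeConstant A ⊔ L.ker).finrank_le
      have h5 : edgeConstant A ⊓ L.ker ≤ edgeConstant (insert s(a, b) A) := by
        rintro φ ⟨hφ, hL⟩ u v huv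
        have hab : φ a = φ b := by simpa [L, sub_eq_zero] using hL
        rcases Finset.mem_insert.1 huv with h | h
        · rcases Sym2.eq_iff.1 h with ⟨rfl, rfl⟩ | ⟨rfl, rfl⟩
          exacts [hab, hab.symm]
        · exact hφ u v h
      have h6 := Submodule.finrank_mono h5
      rw [Finset.card_insert_of_notMem he]
      simp only [Module.finrank_fintype_fun_eq_card, Module.finrank_self] at h1 h2 h4
      unfold edgeRank at *
      push_cast
      lia

theorem isAcyclic_of_card_le_edgeRank {F : Finset (Sym2 V)} (hF : (F.card : ℤ) ≤ edgeRank F) :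
    (SimpleGraph.fromEdgeSet (F : Set (Sym2 V))).IsAcyclic := by
  rw [SimpleGraph.isAcyclic_iff_forall_adj_isBridge]
  intro a b hab
  rw [SimpleGraph.isBridge_iff]
  intro hreach
  have habF : s(a, b) ∈ F := by simpa using ((SimpleGraph.fromEdgeSet_adj _).1 hab).1
  have hle : edgeConstant (F.erase s(a, b)) ≤ edgeConstant F := by
    intro φ hφ u v huv
    by_cases h : s(u, v) = s(a, b)
    · have hφab := eq_of_mem_edgeConstant_of_reachable (fun e he => by
        simp at he ⊢
        grind) hφ hreach
      rcases Sym2.eq_iff.1 h with ⟨rfl, rfl⟩ | ⟨rfl, rfl⟩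
      exacts [hφab, hφab.symm]
    · exact hφ u v (Finset.mem_erase.2 ⟨h, huv⟩)
  have h1 := Submodule.finrank_mono hle
  have h2 := edgeRank_le_card (F.erase s(a, b))
  have h3 := Finset.card_erase_add_one habF
  unfold edgeRank at *
  lia

theorem card_sub_card_connectedComponent_le_edgeRank (A : Finset (Sym2 V)) :
    (Fintype.card V : ℤ) -
      Nat.card (SimpleGraph.fromEdgeSet (A : Set (Sym2 V))).ConnectedComponent ≤ edgeRank A := by
  classical
  set Γ := SimpleGraph.fromEdgeSet (A : Set (Sym2 V)) with hΓ
  let L : (Γ.ConnectedComponent → ℚ) →ₗ[ℚ] (V → ℚ) := LinearMap.funLeft ℚ ℚ Γ.connectedComponentMk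
  have hle : edgeConstant A ≤ L.range := by
    intro φ hφ
    refine ⟨fun c => c.lift φ fun v w p _ =>
      eq_of_mem_edgeConstant_of_reachable (by simp [hΓ]) hφ ⟨p⟩, ?_⟩
    ext v
    simp [L, LinearMap.funLeft_apply]
  have h1 := Submodule.finrank_mono hle
  have h2 := L.finrank_range_le
  rw [Module.finrank_fintype_fun_eq_card, ← Nat.card_eq_fintype_card] at h2
  unfold edgeRank
  lia

theorem card_le_edgeRank_add_card_biUnion {A : Finset (Sym2 V)}
    (hA : ∀ B ⊆ A, B.Nonempty → B.card + 1 ≤ 2 * (B.biUnion Sym2.toFinset).card)  :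
    (A.card : ℤ) ≤ edgeRank A + (A.biUnion Sym2.toFinset).card := by
  classical
  have hrank := card_sub_card_connectedComponent_le_edgeRank A
  set Γ := SimpleGraph.fromEdgeSet (A : Set (Sym2 V)) with hΓ
  let κ : Sym2 V → Γ.ConnectedComponent := fun e => Γ.connectedComponentMk e.out.1
  have hκ : ∀ e ∈ A, ∀ v ∈ e, Γ.connectedComponentMk v = κ e := by
    intro e he v hv
    by_cases hne : v = e.out.1
    · simp [κ, ← hne]
    · refine SimpleGraph.ConnectedComponent.sound (SimpleGraph.Adj.reachable ?_)
      have : s(v, e.out.1) = e :=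
        ((Sym2.mem_and_mem_iff hne).1 ⟨hv, Sym2.out_fst_mem e⟩).symm
      simp [hΓ, this, he, hne]
  have h1 := Finset.card_eq_sum_card_fiberwise (s := A) (f := κ) (t := Finset.univ) (by simp)
  have h2 := Finset.card_eq_sum_card_fiberwise (s := (Finset.univ : Finset V))
    (f := Γ.connectedComponentMk) (t := Finset.univ) (by simp)
  have h3 := Finset.card_eq_sum_card_fiberwise (s := A.biUnion Sym2.toFinset)
    (f := Γ.connectedComponentMk) (t := Finset.univ) (by simp)
  have hcomp : ∀ c : Γ.ConnectedComponent, (A.filter (κ · = c)).card + 1 ≤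
      ((Finset.univ : Finset V).filter (Γ.connectedComponentMk · = c)).card +
      ((A.biUnion Sym2.toFinset).filter (Γ.connectedComponentMk · = c)).card := by
    intro c
    rcases (A.filter (κ · = c)).eq_empty_or_nonempty with h | h
    · have : 0 < ((Finset.univ : Finset V).filter (Γ.connectedComponentMk · = c)).card := by
        obtain ⟨v, hv⟩ := c.exists_rep
        exact Finset.card_pos.2 ⟨v, by rw [Finset.mem_filter]; exact ⟨Finset.mem_univ v, hv⟩⟩
      simp only [h, Finset.card_empty]
      lia
    · have h4 := hA _ (Finset.filter_subset _ _) h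
      have h5 : ((A.filter (κ · = c)).biUnion Sym2.toFinset) ⊆
          (A.biUnion Sym2.toFinset).filter (Γ.connectedComponentMk · = c) := by
        intro v
        simp only [Finset.mem_biUnion, Finset.mem_filter, Sym2.mem_toFinset]
        rintro ⟨e, ⟨he, rfl⟩, hv⟩
        exact ⟨⟨e, he, hv⟩, hκ e he v hv⟩
      have h6 := Finset.card_le_card h5
      have h7 := Finset.card_le_card
        (h5.trans (Finset.filter_subset_filter _ (Finset.subset_univ _)))
      lia
  have h8 := Finset.sum_le_sum fun c (_ : c ∈ Finset.univ) => hcomp c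
  simp only [Finset.sum_add_distrib] at h8
  rw [← h1, ← h2, ← h3] at h8
  simp only [Finset.sum_const, Finset.card_univ, smul_eq_mul, mul_one] at h8
  rw [Nat.card_eq_fintype_card] at hrank
  lia

end edgeConstant

/-- Every edge of `P` joins some vertex `v` to `π v`. This forces `P` to be a pseudoforest. -/
def CoveredBy {V : Type*} (P : SimpleGraph V) (π : V → V) : Prop :=
  ∀ ⦃u v⦄, P.Adj u v → π u = v ∨ π v = u

/-- The set of vertices whose orbit under `π` visits `x`. -/
def backwardOrbit {V : Type*} (π : V → V) (x : V) : Set V :=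
  {v | ∃ n, π^[n] v = x}

/-- The number of steps that the orbit of `v` under `π` needs to visit `x`. -/
noncomputable def depth {V : Type*} (π : V → V) (x v : V) : ℕ :=
  sInf {n | π^[n] v = x}

section depth

variable {V : Type*} {π : V → V} {x v : V}

theorem mem_backwardOrbit_of_apply (h : π v ∈ backwardOrbit π x) : v ∈ backwardOrbit π x := by
  obtain ⟨n, hn⟩ := h
  exact ⟨n + 1, hn⟩

theorem mem_backwardOrbit_self : x ∈ backwardOrbit π x :=
  ⟨0, rfl⟩

theorem apply_mem_backwardOrbit (h : v ∈ backwardOrbit π x) (hv : v ≠ x) :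
    π v ∈ backwardOrbit π x := by
  obtain ⟨_ | n, hn⟩ := h
  · exact absurd hn hv
  · exact ⟨n, hn⟩

theorem depth_self : depth π x x = 0 :=
  Nat.sInf_eq_zero.2 (Or.inl rfl)

theorem depth_eq_depth_apply_add_one (h : v ∈ backwardOrbit π x) (hv : v ≠ x) :
    depth π x v = depth π x (π v) + 1 := by
  have h' : {n | π^[n] (π v) = x}.Nonempty := apply_mem_backwardOrbit h hv
  have h1 : π^[depth π x v] v = x := Nat.sInf_mem (s := {n | π^[n] v = x}) h
  have h2 : π^[depth π x (π v)] (π v) = x := Nat.sInf_mem h'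
  apply le_antisymm
  · exact Nat.sInf_le (s := {n | π^[n] v = x}) h2
  · cases hd : depth π x v with
    | zero => exact absurd (by simpa [hd] using h1) hv
    | succ n =>
      rw [hd] at h1
      exact Nat.succ_le_succ (Nat.sInf_le (s := {n | π^[n] (π v) = x}) h1)

theorem eq_of_depth_eq_zero (h : v ∈ backwardOrbit π x) (h0 : depth π x v = 0) : v = x := by
  by_contra hv
  have := depth_eq_depth_apply_add_one h hv
  lia

theorem mem_backwardOrbit_apply_self (hx : x ∈ backwardOrbit π (π x))
    (h : v ∈ backwardOrbit π x) : v ∈ backwardOrbit π (π x) := by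
  obtain ⟨n, rfl⟩ := h
  obtain ⟨m, hm⟩ := hx
  exact ⟨m + n, by rw [Function.iterate_add_apply, hm]⟩

/-- The depths with respect to the three vertices of a 3-cycle never have the same parity. -/
theorem not_even_depth_of_three_cycle {y z : V} (hx : π x = y) (hy : π y = z) (hz : π z = x)
    (hxy : x ≠ y) (hyz : y ≠ z) (hzx : z ≠ x) (hv : v ∈ backwardOrbit π x) :
    ¬ ((Even (depth π x v) ↔ Even (depth π y v)) ∧
      (Even (depth π y v) ↔ Even (depth π z v))) := by
  have step : ∀ {u w : V}, π u = w → u ≠ w → depth π w u = 1 := by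
    rintro u _ rfl hne
    rw [depth_eq_depth_apply_add_one (mem_backwardOrbit_of_apply mem_backwardOrbit_self) hne,
      depth_self]
  obtain ⟨n, hn⟩ := hv
  induction n generalizing v with
  | zero =>
    obtain rfl : v = x := hn
    simp [depth_self, step hx hxy]
  | succ n ih =>
    by_cases hvx : v = x
    · simp [hvx, depth_self, step hx hxy]
    by_cases hvy : v = y
    · simp [hvy, depth_self, step hy hyz]
    by_cases hvz : v = z
    · simp [hvz, depth_self, step hz hzx]
    have h1 : v ∈ backwardOrbit π x := ⟨n + 1, hn⟩
    have h2 : v ∈ backwardOrbit π y := by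
      have := mem_backwardOrbit_apply_self ⟨1, rfl⟩ h1
      rwa [hx] at this
    have h3 : v ∈ backwardOrbit π z := by
      have := mem_backwardOrbit_apply_self ⟨1, rfl⟩ h2
      rwa [hy] at this
    have := ih hn
    rw [depth_eq_depth_apply_add_one h1 hvx, depth_eq_depth_apply_add_one h2 hvy,
      depth_eq_depth_apply_add_one h3 hvz]
    simp only [Nat.even_add_one]
    tauto

end depth

/-- A tree component can be re-rooted at any of its vertices `p`: given a height function `D` on
`C` that decreases along `π` and vanishes only at fixed points, `P` is covered by a map that
fixes `p`. -/
theorem CoveredBy.exists_fixing {V : Type*} {P : SimpleGraph V} {π : V → V}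
    (hcov : CoveredBy P π) {C : Set V} {D : V → ℕ} (hroot : ∀ v ∈ C, D v = 0 → π v = v)
    (hstep : ∀ v ∈ C, D v ≠ 0 → π v ∈ C ∧ D v = D (π v) + 1) {p : V} (hp : p ∈ C) :
    ∃ π' : V → V, CoveredBy P π' ∧ π' p = p ∧ ∀ v, D p < D v → π' v = π v := by
  classical
  induction hn : D p generalizing p with
  | zero => exact ⟨π, hcov, hroot p hp hn, fun _ _ => rfl⟩
  | succ n ih =>
    obtain ⟨hqC, hq⟩ := hstep p hp (by lia)
    obtain ⟨π', hcov', hfix, hagree⟩ := ih hqC (by lia)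
    have hπp : π' p = π p := hagree p (by lia)
    have hpq : p ≠ π p := fun h => by rw [← h] at hq; lia
    refine ⟨Function.update (Function.update π' (π p) p) p p, ?_, by simp, ?_⟩
    · intro u v huv
      have hne := huv.ne
      have := hcov' huv
      grind [Function.update_apply]
    · intro v hv
      rw [Function.update_of_ne (by grind), Function.update_of_ne (by grind)]
      exact hagree v (by lia)

/-- The ordered triangles of a graph. -/
def orderedTriangles {V : Type*} (P : SimpleGraph V) : Set (V × V × V) :=
  {t | P.Adj t.1 t.2.1 ∧ P.Adj t.2.1 t.2.2 ∧ P.Adj t.1 t.2.2}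

theorem ncard_orderedTriangles_lt {V : Type*} [Finite V] {P P' : SimpleGraph V}
    (h : orderedTriangles P' ⊆ orderedTriangles P) {x y z : V}
    (hxyz : (x, y, z) ∈ orderedTriangles P) (hxy : ¬ P'.Adj x y) :
    (orderedTriangles P').ncard < (orderedTriangles P).ncard :=
  Set.ncard_lt_ncard ⟨h, fun h' => hxy (h' hxyz).1⟩ (Set.toFinite _)

theorem SimpleGraph.IsAcyclic.deleteEdges_sup_edge {V : Type*} {F : SimpleGraph V}
    (hF : F.IsAcyclic) {x y : V} {p : F.Walk x y} (hp : p.IsPath) {e : Sym2 V}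
    (he : e ∈ p.edges) : (F.deleteEdges {e} ⊔ SimpleGraph.edge x y).IsAcyclic := by
  classical
  refine SimpleGraph.IsAcyclic.sup_edge_of_not_reachable ?_
    (hF.anti (SimpleGraph.deleteEdges_le _))
  rintro ⟨q⟩
  have hq := (q.bypass_isPath).mapLe (SimpleGraph.deleteEdges_le (G := F) {e})
  have := congrArg Subtype.val ((hF.subsingleton_path x y).elim ⟨p, hp⟩ ⟨_, hq⟩)
  simp only at this
  rw [this, SimpleGraph.Walk.edges_mapLe_eq_edges] at he
  have := q.bypass.edges_subset_edgeSet he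
  simp at this

/-- `F` is a forest in `G` whose complement is covered by `π`, and among all such forests the
complement of `F` has the fewest triangles. -/
structure IsOptimalForest {V : Type*} (G F : SimpleGraph V) (π : V → V) : Prop where
  le : F ≤ G
  isAcyclic : F.IsAcyclic
  coveredBy : CoveredBy (G \ F) π
  ncard_le : ∀ F' ≤ G, F'.IsAcyclic → ∀ π', CoveredBy (G \ F') π' →
    (orderedTriangles (G \ F)).ncard ≤ (orderedTriangles (G \ F')).ncard

namespace IsOptimalForest

variable {V : Type*} [Finite V] {G F : SimpleGraph V} {π : V → V} {x y z : V}

theorem reachable (h : IsOptimalForest G F π) (hxyz : (x, y, z) ∈ orderedTriangles (G \ F)) :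
    F.Reachable x y := by
  by_contra hreach
  have hle : G \ (F ⊔ SimpleGraph.edge x y) ≤ G \ F := sdiff_le_sdiff_left le_sup_left
  have hadj : G.Adj x y ∧ ¬ F.Adj x y := hxyz.1
  refine (h.ncard_le (F ⊔ SimpleGraph.edge x y) (sup_le h.le ?_)
    (h.isAcyclic.sup_edge_of_not_reachable hreach) π fun u v huv => h.coveredBy (hle huv)).not_gt
    (ncard_orderedTriangles_lt (fun t ht => ⟨hle ht.1, hle ht.2.1, hle ht.2.2⟩) hxyz ?_)
  · exact (SimpleGraph.edge_le_iff G).2 (Or.inr hadj.1)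
  · simp [SimpleGraph.edge_adj, hadj.1.ne]

/-- The ends of an edge `ab` on the path of `F` joining the ends `x`, `y` of a triangle edge have
depths of the same parity: `ab` and `xy` could otherwise be exchanged, destroying a triangle without
creating one. -/
theorem even_depth_iff (h : IsOptimalForest G F π)
    (hxyz : (x, y, z) ∈ orderedTriangles (G \ F)) (hx : π x = y)
    {p : F.Walk x y} (hp : p.IsPath) {a b : V} (hab : s(a, b) ∈ p.edges)
    (ha : a ∈ backwardOrbit π x) :
    b ∈ backwardOrbit π x ∧ (Even (depth π x a) ↔ Even (depth π x b)) := by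
  classical
  have hGxy : G.Adj x y := hxyz.1.1
  have hFxy : ¬ F.Adj x y := hxyz.1.2
  have hFab : F.Adj a b := p.adj_of_mem_edges hab
  have hne : s(a, b) ≠ s(x, y) := by
    intro heq
    have : s(x, y) ∈ F.edgeSet := heq ▸ hFab
    exact hFxy this
  set Q := (G \ F).deleteEdges {s(x, y)} with hQ
  have hQadj : ∀ {u v}, Q.Adj u v → π u = v ∧ u ≠ x ∨ π v = u ∧ v ≠ x := by
    intro u v huv
    simp only [hQ, SimpleGraph.deleteEdges_adj, Set.mem_singleton_iff] at huv
    rcases h.coveredBy huv.1 with hu | hv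
    · exact Or.inl ⟨hu, fun hux => huv.2 (by rw [hux] at hu ⊢; rw [← hu, hx])⟩
    · exact Or.inr ⟨hv, fun hvx => huv.2 (by rw [hvx] at hv ⊢; rw [← hv, hx, Sym2.eq_swap])⟩
  have hQparity : ∀ {u v}, Q.Adj u v → u ∈ backwardOrbit π x →
      v ∈ backwardOrbit π x ∧ (Even (depth π x u) ↔ ¬ Even (depth π x v)) := by
    intro u v huv hu
    rcases hQadj huv with ⟨rfl, hux⟩ | ⟨rfl, hvx⟩
    · exact ⟨apply_mem_backwardOrbit hu hux, by
        rw [depth_eq_depth_apply_add_one hu hux, Nat.even_add_one]⟩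
    · have hv := mem_backwardOrbit_of_apply hu
      exact ⟨hv, by rw [depth_eq_depth_apply_add_one hv hvx, Nat.even_add_one, not_not]⟩
  by_cases hcommon : ∃ t, Q.Adj a t ∧ Q.Adj b t
  · obtain ⟨t, hat, hbt⟩ := hcommon
    obtain ⟨ht, hta⟩ := hQparity hat ha
    obtain ⟨hb, htb⟩ := hQparity hbt.symm ht
    exact ⟨hb, by tauto⟩
  exfalso
  set F' := F.deleteEdges {s(a, b)} ⊔ SimpleGraph.edge x y with hF'
  have hadj' : ∀ {u v}, (G \ F').Adj u v → Q.Adj u v ∨ s(u, v) = s(a, b) := by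
    intro u v huv
    have huv' : G.Adj u v ∧ ¬ F'.Adj u v := huv
    by_contra! hcon
    obtain ⟨h1, h2⟩ := hcon
    apply huv'.2
    rw [hF', SimpleGraph.sup_adj, SimpleGraph.deleteEdges_adj, SimpleGraph.adj_edge]
    rw [hQ, SimpleGraph.deleteEdges_adj, SimpleGraph.sdiff_adj] at h1
    simp only [Set.mem_singleton_iff] at h1 ⊢
    have := huv'.1.ne
    tauto
  obtain ⟨π', hcov, hfix, -⟩ := CoveredBy.exists_fixing (P := Q) (π := Function.update π x x)
    (C := backwardOrbit π x) (D := depth π x)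
    (fun u v huv => by
      rcases hQadj huv with ⟨hu, hux⟩ | ⟨hv, hvx⟩
      · exact Or.inl (by rwa [Function.update_of_ne hux])
      · exact Or.inr (by rwa [Function.update_of_ne hvx]))
    (fun v hv h0 => by simp [eq_of_depth_eq_zero hv h0])
    (fun v hv h0 => by
      have hvx : v ≠ x := by
        rintro rfl
        exact h0 depth_self
      rw [Function.update_of_ne hvx]
      exact ⟨apply_mem_backwardOrbit hv hvx, depth_eq_depth_apply_add_one hv hvx⟩) ha
  have hcov' : CoveredBy (G \ F') (Function.update π' a b) := by
    intro u v huv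
    rcases hadj' huv with hQuv | huv'
    · have hne := hQuv.ne
      have := hcov hQuv
      grind [Function.update_apply]
    · rcases Sym2.eq_iff.1 huv' with ⟨rfl, rfl⟩ | ⟨rfl, rfl⟩ <;> simp
  have hF'le : F' ≤ G :=
    sup_le ((SimpleGraph.deleteEdges_le _).trans h.le) ((SimpleGraph.edge_le_iff G).2 (Or.inr hGxy))
  have hQle : Q ≤ G \ F := SimpleGraph.deleteEdges_le _
  have hapex : ∀ {u v w}, s(u, v) = s(a, b) → (G \ F').Adj u w → (G \ F').Adj v w → False := by
    intro u v w huv huw hvw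
    rcases hadj' huw with h1 | h1
    · rcases hadj' hvw with h2 | h2
      · rcases Sym2.eq_iff.1 huv with ⟨rfl, rfl⟩ | ⟨rfl, rfl⟩
        exacts [hcommon ⟨w, h1, h2⟩, hcommon ⟨w, h2, h1⟩]
      · rw [← huv, Sym2.eq_swap (a := u)] at h2
        exact huw.ne (Sym2.congr_right.1 h2).symm
    · rw [← huv] at h1
      exact hvw.ne (Sym2.congr_right.1 h1).symm
  refine (h.ncard_le F' hF'le (h.isAcyclic.deleteEdges_sup_edge hp hab) _ hcov').not_gt
    (ncard_orderedTriangles_lt ?_ hxyz ?_)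
  · rintro ⟨u, v, w⟩ ⟨huv, hvw, huw⟩
    refine ⟨hQle ((hadj' huv).resolve_right fun h' => hapex h' huw hvw),
      hQle ((hadj' hvw).resolve_right fun h' => hapex h' huv.symm huw.symm),
      hQle ((hadj' huw).resolve_right fun h' => hapex h' huv hvw.symm)⟩
  · simp [hF', SimpleGraph.edge_adj, hGxy.ne]

theorem even_depth_of_mem_support (h : IsOptimalForest G F π)
    (hxyz : (x, y, z) ∈ orderedTriangles (G \ F)) (hx : π x = y)
    {p : F.Walk x y} (hp : p.IsPath) {w : V} (hw : w ∈ p.support) :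
    w ∈ backwardOrbit π x ∧ Even (depth π x w) := by
  suffices ∀ {u v : V} (q : F.Walk u v), q.edges ⊆ p.edges → u ∈ backwardOrbit π x →
      Even (depth π x u) → ∀ w ∈ q.support, w ∈ backwardOrbit π x ∧ Even (depth π x w) from
    this p (List.Subset.refl _) mem_backwardOrbit_self (by simp [depth_self]) w hw
  intro u v q
  induction q with
  | nil =>
    intro _ hu hev w hw
    rw [SimpleGraph.Walk.support_nil, List.mem_singleton] at hw
    exact hw ▸ ⟨hu, hev⟩
  | cons hadj q ih =>
    intro hsub hu hev w hw
    rw [SimpleGraph.Walk.edges_cons, List.cons_subset] at hsub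
    rw [SimpleGraph.Walk.support_cons, List.mem_cons] at hw
    obtain ⟨h1, h2⟩ := h.even_depth_iff hxyz hx hp hsub.1 hu
    rcases hw with rfl | hw
    · exact ⟨hu, hev⟩
    · exact ih hsub.2 h1 (h2.1 hev) w hw

theorem not_three_cycle (h : IsOptimalForest G F π)
    (hxyz : (x, y, z) ∈ orderedTriangles (G \ F)) (hx : π x = y) (hy : π y = z) (hz : π z = x) :
    False := by
  classical
  have hyzx : (y, z, x) ∈ orderedTriangles (G \ F) := ⟨hxyz.2.1, hxyz.2.2.symm, hxyz.1.symm⟩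
  have hzxy : (z, x, y) ∈ orderedTriangles (G \ F) := ⟨hxyz.2.2.symm, hxyz.1, hxyz.2.1.symm⟩
  obtain ⟨p₁, hp₁⟩ := (h.reachable hxyz).exists_isPath
  obtain ⟨p₂, hp₂⟩ := (h.reachable hyzx).exists_isPath
  set q := (p₁.append p₂).bypass with hq
  have hqpath : q.reverse.IsPath := ((p₁.append p₂).bypass_isPath).reverse
  have hz₁ : z ∉ p₁.support := by
    intro hz'
    have := h.even_depth_of_mem_support hxyz hx hp₁ hz'
    rw [depth_eq_depth_apply_add_one this.1 hxyz.2.2.ne.symm, hz, depth_self] at this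
    exact absurd this.2 (by decide)
  obtain ⟨d, hd, hd₁, hd₂⟩ := q.exists_boundary_dart {v | v ∈ p₁.support}
    p₁.start_mem_support hz₁
  have hdq : s(d.fst, d.snd) ∈ q.edges := List.mem_map_of_mem hd
  have hd₃ : d.fst ∈ p₂.support := by
    have := (p₁.append p₂).edges_bypass_subset_edges hdq
    rw [SimpleGraph.Walk.edges_append, List.mem_append] at this
    rcases this with h' | h'
    · exact absurd (p₁.snd_mem_support_of_mem_edges h') hd₂
    · exact p₂.fst_mem_support_of_mem_edges h'
  have hd₄ : d.fst ∈ q.reverse.support := by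
    rw [SimpleGraph.Walk.support_reverse, List.mem_reverse]
    exact q.fst_mem_support_of_mem_edges hdq
  obtain ⟨ho, h₁⟩ := h.even_depth_of_mem_support hxyz hx hp₁ hd₁
  obtain ⟨-, h₂⟩ := h.even_depth_of_mem_support hyzx hy hp₂ hd₃
  obtain ⟨-, h₃⟩ := h.even_depth_of_mem_support hzxy hz hqpath hd₄
  exact not_even_depth_of_three_cycle hx hy hz hxyz.1.ne hxyz.2.1.ne hxyz.2.2.ne.symm ho
    (by tauto)

theorem cliqueFree (h : IsOptimalForest G F π) : (G \ F).CliqueFree 3 := by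
  classical
  intro s hs
  obtain ⟨x, y, z, hxy, hxz, hyz, -⟩ := SimpleGraph.is3Clique_iff.1 hs
  have h₁ : (x, y, z) ∈ orderedTriangles (G \ F) := ⟨hxy, hyz, hxz⟩
  have h₂ : (x, z, y) ∈ orderedTriangles (G \ F) := ⟨hxz, hyz.symm, hxy⟩
  have := h.not_three_cycle h₁
  have := h.not_three_cycle h₂
  have := hxy.ne
  have := hxz.ne
  have := hyz.ne
  have := h.coveredBy hxy
  have := h.coveredBy hxz
  have := h.coveredBy hyz
  grind

end IsOptimalForest

theorem exists_isAcyclic_coveredBy {V : Type*} [Fintype V] [DecidableEq V] {A : Finset (Sym2 V)}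
    (hA : ∀ B ⊆ A, B.Nonempty → B.card + 1 ≤ 2 * (B.biUnion Sym2.toFinset).card) :
    ∃ F ⊆ A, (SimpleGraph.fromEdgeSet (F : Set (Sym2 V))).IsAcyclic ∧
      ∃ π, CoveredBy (SimpleGraph.fromEdgeSet (A \ F : Set (Sym2 V))) π := by
  obtain ⟨F, hFA, hF, h, hh⟩ := exists_card_le_and_matching A edgeRank Sym2.toFinset
    (fun v => s(v, v)) edgeRank_mono edgeRank_submodular
    fun B hB => card_le_edgeRank_add_card_biUnion fun B' hB' => hA B' (hB'.trans hB)
  refine ⟨F, hFA, isAcyclic_of_card_le_edgeRank hF, ?_⟩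
  have hother : ∀ v, ∃ w, v ∈ h v → h v = s(v, w) := by
    intro v
    by_cases hv : v ∈ h v
    · obtain ⟨w, hw⟩ := hv
      exact ⟨w, fun _ => hw⟩
    · exact ⟨v, fun hv' => absurd hv' hv⟩
  choose π hπ using hother
  refine ⟨π, fun a b hab => ?_⟩
  obtain ⟨v, hv, hve⟩ := hh s(a, b) (by
    have := ((SimpleGraph.fromEdgeSet_adj _).1 hab).1
    simpa using this)
  rw [Sym2.mem_toFinset] at hv
  have h1 := hπ v (hve ▸ hv)
  rw [hve] at h1
  rcases Sym2.mem_iff.1 hv with rfl | rfl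
  · exact Or.inl (Sym2.congr_right.1 h1).symm
  · rw [Sym2.eq_swap] at h1
    exact Or.inr (Sym2.congr_right.1 h1).symm

theorem IsSparse.card_add_one_le {V : Type*} [Fintype V] [DecidableEq V] {G : SimpleGraph V}
    (hG : IsSparse G 2 (-1)) {B : Finset (Sym2 V)} (hB : (B : Set (Sym2 V)) ⊆ G.edgeSet)
    (hne : B.Nonempty) : B.card + 1 ≤ 2 * (B.biUnion Sym2.toFinset).card := by
  let H : G.Subgraph :=
    { verts := B.biUnion Sym2.toFinset
      Adj := fun u v => s(u, v) ∈ B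
      adj_sub := fun h => hB h
      edge_vert := fun {u v} h => by
        simp only [Finset.coe_biUnion, Set.mem_iUnion, Finset.mem_coe, Sym2.mem_toFinset]
        exact ⟨s(u, v), h, Sym2.mem_mk_left u v⟩
      symm := ⟨fun u v h => by rwa [Sym2.eq_swap]⟩ }
  have hedge : H.edgeSet = B := by
    ext e
    induction e using Sym2.ind with
    | _ u v => exact SimpleGraph.Subgraph.mem_edgeSet
  have := hG H (by rw [hedge]; exact hne)
  rw [hedge, Set.ncard_coe_finset, Set.ncard_coe_finset] at this
  have h' : (B.card : ℝ) + 1 ≤ 2 * (B.biUnion Sym2.toFinset).card := by linarith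
  exact_mod_cast h'

theorem SimpleGraph.IsAcyclic.isSparse {V : Type*} [Fintype V] {F : SimpleGraph V}
    (hF : F.IsAcyclic) : IsSparse F 1 (-1) := by
  classical
  intro H hH
  obtain ⟨e, he⟩ := hH
  have : Nonempty H.verts := by
    induction e using Sym2.ind with
    | _ u v => exact ⟨⟨u, H.edge_vert he⟩⟩
  obtain ⟨T, hHT, -, hT⟩ := (SimpleGraph.connected_top (V := H.verts))
    |>.exists_isTree_le_of_le_of_isAcyclic le_top (hF.subgraph H)
  have h1 := hT.card_edgeFinset
  have h2 : H.edgeSet.ncard ≤ H.coe.edgeSet.ncard := by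
    rw [← H.image_coe_edgeSet_coe]
    exact Set.ncard_image_le (Set.toFinite _)
  have h3 := Set.ncard_le_ncard (SimpleGraph.edgeSet_mono hHT) (Set.toFinite _)
  rw [← SimpleGraph.coe_edgeFinset T, Set.ncard_coe_finset] at h3
  rw [← Nat.card_eq_fintype_card, Nat.card_coe_set_eq] at h1
  have h4 : H.edgeSet.ncard + 1 ≤ H.verts.ncard := by lia
  have h5 : (H.edgeSet.ncard : ℝ) + 1 ≤ H.verts.ncard := by exact_mod_cast h4
  linarith

theorem CoveredBy.isSparse {V : Type*} [Fintype V] {P : SimpleGraph V} {π : V → V}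
    (hcov : CoveredBy P π) : IsSparse P 1 0 := by
  intro H _
  have hsub : H.edgeSet ⊆ (fun v => s(v, π v)) '' H.verts := by
    intro e he
    induction e using Sym2.ind with
    | _ u v =>
      have hadj : H.Adj u v := he
      rcases hcov hadj.adj_sub with h | h
      · exact ⟨u, hadj.fst_mem, by simp [h]⟩
      · exact ⟨v, hadj.snd_mem, by simp [h, Sym2.eq_swap]⟩
  have h1 := (Set.ncard_le_ncard hsub (Set.toFinite _)).trans (Set.ncard_image_le (Set.toFinite _))
  have h2 : (H.edgeSet.ncard : ℝ) ≤ H.verts.ncard := by exact_mod_cast h1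
  linarith

theorem IsSparse.exists_isOptimalForest {V : Type*} [Fintype V] {G : SimpleGraph V}
    (hG : IsSparse G 2 (-1)) : ∃ F π, IsOptimalForest G F π := by
  classical
  let S : Set (SimpleGraph V × (V → V)) :=
    {q | q.1 ≤ G ∧ q.1.IsAcyclic ∧ CoveredBy (G \ q.1) q.2}
  have hS : S.Nonempty := by
    obtain ⟨F, hFG, hF, π, hπ⟩ := exists_isAcyclic_coveredBy (A := G.edgeFinset)
      fun B hB hne => hG.card_add_one_le (fun e he => SimpleGraph.mem_edgeFinset.1 (hB he)) hne
    refine ⟨(SimpleGraph.fromEdgeSet F, π), ?_, hF, ?_⟩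
    · intro u v huv
      simpa using hFG ((SimpleGraph.fromEdgeSet_adj _).1 huv).1
    · rwa [SimpleGraph.coe_edgeFinset, SimpleGraph.fromEdgeSet_sdiff,
        SimpleGraph.fromEdgeSet_edgeSet] at hπ
  obtain ⟨⟨F, π⟩, ⟨h₁, h₂, h₃⟩, hmin⟩ :=
    (Set.toFinite S).exists_minimalFor (fun q => (orderedTriangles (G \ q.1)).ncard) S hS
  refine ⟨F, π, h₁, h₂, h₃, fun F' hF' hac π' hπ' => ?_⟩
  exact (le_total _ _).elim id fun hle => hmin (j := (F', π')) ⟨hF', hac, hπ'⟩ hle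

theorem stmt10 {V : Type*} [Fintype V] (G : SimpleGraph V)
    (hG : IsSparse G 2 (-1)) :
    ∃ F P : SimpleGraph V, F ≤ G ∧ P ≤ G ∧
      F.edgeSet ∪ P.edgeSet = G.edgeSet ∧ Disjoint F.edgeSet P.edgeSet ∧
      IsSparse F 1 (-1) ∧ IsSparse P 1 0 ∧ P.CliqueFree 3 := by
  obtain ⟨F, π, h⟩ := hG.exists_isOptimalForest
  refine ⟨F, G \ F, h.le, sdiff_le, ?_, ?_, h.isAcyclic.isSparse, h.coveredBy.isSparse,
    h.cliqueFree⟩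
  · rw [← SimpleGraph.edgeSet_sup, sup_sdiff_cancel_right h.le]
  · rw [SimpleGraph.edgeSet_sdiff]
    exact Set.disjoint_sdiff_right
end
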